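/- The number of subsets S of the 12×12 board with |S| = 72 such that both S and its complement are connected equals 56578717186086829451888706; equivalently, the sixth gerrymander number (dissections of the 12×12 board into two connected polyominoes of area 72 each) is 28289358593043414725944353. -/

import Mathlib

/-- The grid graph on the `m × n` board: two cells are adjacent when they agree
in one coordinate and differ by exactly 1 in the other. -/
def gridGraph (m n : ℕ) : SimpleGraph (Fin m × Fin n) :=
  SimpleGraph.fromRel (fun a b =>
    (a.1 = b.1 ∧ (a.2 : ℕ) + 1 = (b.2 : ℕ)) ∨ (a.2 = b.2 ∧ (a.1 : ℕ) + 1 = (b.1 : ℕ)))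

/-- A subset of cells is connected if the induced subgraph of the grid graph is
connected (in particular nonempty). -/
def ConnectedRegion (m n : ℕ) (S : Finset (Fin m × Fin n)) : Prop :=
  ((gridGraph m n).induce (S : Set (Fin m × Fin n))).Connected

set_option linter.unusedVariables false
inductive L where
  | n : L
  | v : ℕ → L
inductive O (α : Type) where
  | n : O α
  | s : α → α → α → O α
set_option linter.all false
noncomputable section
namespace G
def X : ℕ := 21778071482940061661667375590452488731669
def MM : ℕ := Nat.pow X 73
def ladd (a b : L) : L :=
  L.rec (motive := fun _ => L) b (fun x => L.rec (motive := fun _ => L) a (fun y => L.v (Nat.add x y)) b) a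
def oadd {α : Type} (f : α → α → α) (a b : O α) : O α :=
  O.rec (motive := fun _ => O α) b (fun e o c => O.rec (motive := fun _ => O α) a
    (fun e' o' c' => O.s (f e e') (f o o') (f c c')) b) a
def lg (a : L) : ℕ := L.rec (motive := fun _ => ℕ) 0 (fun x => x) a
def og {α : Type} (g : α → ℕ) (x : O α) : ℕ := O.rec (motive := fun _ => ℕ) 0 (fun e _ _ => g e) x
def lmk (e o c : L) : O L :=
  L.rec (motive := fun _ => O L) (L.rec (motive := fun _ => O L) (L.rec (motive := fun _ => O L) O.n
    (fun _ => O.s e o c) c) (fun _ => O.s e o c) o) (fun _ => O.s e o c) e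
def omk {α : Type} (e o c : O α) : O (O α) :=
  O.rec (motive := fun _ => O (O α)) (O.rec (motive := fun _ => O (O α)) (O.rec (motive := fun _ => O (O α)) O.n
    (fun _ _ _ => O.s e o c) c) (fun _ _ _ => O.s e o c) o) (fun _ _ _ => O.s e o c) e
/-- join of three tries, the new symbol being put at the boundary -/
def jn {α β : Type} (z : α) (f : α → α → α → β) (x y w : O α) : O β :=
  O.rec (motive := fun _ => O β)
    (O.rec (motive := fun _ => O β)
      (O.rec (motive := fun _ => O β) O.n (fun w0 w1 w2 => O.s (f z z w0) (f z z w1) (f z z w2)) w)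
      (fun y0 y1 y2 => O.rec (motive := fun _ => O β) (O.s (f z y0 z) (f z y1 z) (f z y2 z))
        (fun w0 w1 w2 => O.s (f z y0 w0) (f z y1 w1) (f z y2 w2)) w) y)
    (fun x0 x1 x2 => O.rec (motive := fun _ => O β)
      (O.rec (motive := fun _ => O β) (O.s (f x0 z z) (f x1 z z) (f x2 z z))
        (fun w0 w1 w2 => O.s (f x0 z w0) (f x1 z w1) (f x2 z w2)) w)
      (fun y0 y1 y2 => O.rec (motive := fun _ => O β) (O.s (f x0 y0 z) (f x1 y1 z) (f x2 y2 z))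
        (fun w0 w1 w2 => O.s (f x0 y0 w0) (f x1 y1 w1) (f x2 y2 w2)) w) y) x
def fo {α : Type} (z : α) (ad : α → α → α) (mk : α → α → α → O α) (f : ℕ → α → α) (j : ℕ) (x : O α) : O α :=
  O.rec (motive := fun _ => O α) O.n (fun e o c =>
      Nat.rec (motive := fun _ => O α) (mk (f 0 e) (ad (f 1 o) c) z)
       (fun j' _ => mk (f (Nat.succ j') e) (f (Nat.succ (Nat.succ j')) o) (f j' c)) j) x
def mi {α : Type} (mk : α → α → α → O α) (f : α → α) (x : O α) : O α :=
  O.rec (motive := fun _ => O α) O.n (fun e o c => mk (f e) (f o) (f c)) x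
def br {α : Type} (z : α) (x : O α) (k : α → α → α → ℕ) : ℕ := O.rec (motive := fun _ => ℕ) (k z z z) k x
abbrev Sty (α β : Type) : Type := α → α → α → α → ℕ → (β → β → ℕ → ℕ) → ℕ
def sst {α β γ : Type} (z : α) (ad : α → α → α) (f : ℕ → α → α) (n : α → α) (j : α → α → α → β) (g : α → ℕ)
    (S : Sty β γ) : Sty (O α) γ := fun x o c y r K =>
  br z x fun x0 x1 x2 => br z o fun o0 o1 o2 => br z c fun c0 c1 c2 => br z y fun z0 z1 z2 =>
    S (j (ad (ad x0 c1) (ad (f 0 o1) (n c2))) (ad c0 z2) (ad o0 z1)) (j (ad x1 o0) c1 o1)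
      (j (ad x2 c0) c2 (ad o2 z0)) (j x0 c0 o0) (Nat.add r (g o2)) K
def wl (M w v : ℕ) : L := Nat.rec (motive := fun _ => L) L.n (fun m _ => L.v m) (Nat.add (Nat.mod (Nat.mul v w) M) 1)
def wm (n0 X M : ℕ) (cl : Bool) (n : ℕ) (x : L) : L := L.rec (motive := fun _ => L) L.n
  (fun v => wl M (Nat.pow X (Bool.rec (motive := fun _ => ℕ) n (Nat.succ n) cl)) v) x
def wn (n0 X M : ℕ) (cl : Bool) (n : ℕ) (x : L) : L := L.rec (motive := fun _ => L) L.n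
  (fun v => wl M (Nat.pow X (Bool.rec (motive := fun _ => ℕ) (Nat.sub n0 n) (Nat.succ n) cl)) v) x
def wc (cl : Bool) (n : ℕ) (x : L) : L := L.rec (motive := fun _ => L) L.n
  (fun v => Bool.rec (motive := fun _ => L) (L.v (Nat.mul 4 v)) L.n cl) x
def we (cl : Bool) (n : ℕ) (x : L) : L := L.rec (motive := fun _ => L) L.n
  (fun v => Bool.rec (motive := fun _ => L) L.n (L.v (Nat.mul 4 v)) cl) x
def wgt {α : Type} (mk : α → α → α → O α) (f : Bool → ℕ → α → α) (cl : Bool) (n : ℕ) (x : O α) : O α :=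
  O.rec (motive := fun _ => O α) O.n (fun e o c => Bool.rec (motive := fun _ => O α)
    (mk (f false n e) (f true n o) (f true n c))
    (mk (f true (Nat.succ n) e) (f false (Nat.succ n) o) (f false (Nat.succ n) c)) cl) x
def wpr {α : Type} (mk : α → α → α → O α) (f : Bool → ℕ → α → α) (cl : Bool) (n : ℕ) (x : O α) : O α :=
  O.rec (motive := fun _ => O α) O.n (fun e o c => Bool.rec (motive := fun _ => O α)
    (mk (f false 0 e) (f true 0 o) (f true 0 c)) (mk (f true 0 e) (f false 0 o) (f false 0 c)) cl) x
def os1 {α : Type} (s g : α → ℕ) (x : O α) : ℕ :=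
  O.rec (motive := fun _ => ℕ) 0 (fun e o c => Nat.add (s e) (Nat.add (g o) (g c))) x
def ou {α : Type} (u g : α → ℕ) (x : O α) : ℕ :=
  O.rec (motive := fun _ => ℕ) 0 (fun e o c => Nat.add (u e) (g c)) x
def od {α : Type} (d u : α → ℕ) (x : O α) : ℕ :=
  O.rec (motive := fun _ => ℕ) 0 (fun e o c => Nat.add (d e) (u o)) x
def fc (k : ℕ → ℕ) (r : ℕ) : ℕ := Nat.rec (motive := fun _ => ℕ) 0 (fun r' _ => k r') (Nat.add r 1)
def rN {α : Type} (e X : ℕ) (z : α) (S : Sty α (O α)) (ad : O α → O α → O α)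
    (wc wn : Bool → ℕ → O α → O α) (R : O α → ℕ → ℕ) (v : O α) (r : ℕ) : ℕ :=
  br z v fun a0 a1 a2 => S a0 a1 a2 a0 0 fun a c r0 =>
    fc (fun r' => R (wn true 0 (ad a (wc true 0 c))) r') (Nat.add r (Nat.mul r0 (Nat.pow X e)))
def rM {α : Type} (e X : ℕ) (z : α) (ad : α → α → α) (S : Sty α (O α))
    (we wm : Bool → ℕ → O α → O α) (R : O α → ℕ → ℕ) (v : O α) (r : ℕ) : ℕ :=
  br z v fun a0 a1 a2 => br z (we true 0 v) fun c0 c1 c2 =>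
    S (ad a0 c1) a1 (ad a2 c0) a0 0 fun a c r0 =>
    fc (fun r' => R (wm true 0 a) r') (Nat.add r (Nat.mul r0 (Nat.pow X e)))

end G
end

set_option linter.all false
noncomputable section
namespace G
inductive Sy where
  | e | u | d
deriving DecidableEq
open Sy
def Tt : ℕ → Type
  | 0 => L
  | n + 1 => O (Tt n)
section pairing
variable {R : Type} [CommSemiring R]
def pr : (n : ℕ) → (List Sy → R) → Tt n → R
  | 0, F, x => F [] * (lg x : ℕ)
  | n + 1, F, x => O.rec (motive := fun _ => R) 0 (fun x0 x1 x2 => pr n (fun w => F (e :: w)) x0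
      + (pr n (fun w => F (u :: w)) x1 + pr n (fun w => F (d :: w)) x2)) x
def Zt : (n : ℕ) → Tt n
  | 0 => L.n
  | _ + 1 => O.n
def Mt : (n : ℕ) → Tt n → Tt n → Tt n → O (Tt n)
  | 0 => lmk
  | _ + 1 => omk
theorem pr_s (n : ℕ) (F : List Sy → R) (a b c : Tt n) : pr (n+1) F (O.s a b c) =
  pr n (fun w => F (e :: w)) a + (pr n (fun w => F (u :: w)) b + pr n (fun w => F (d :: w)) c) := rfl
theorem pr_n (n : ℕ) (F : List Sy → R) : pr (n+1) F (O.n) = 0 := rfl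
@[simp] theorem pr_Z (n : ℕ) (F : List Sy → R) : pr n F (Zt n) = 0 := by
  cases n with
  | zero => simp [pr, Zt, lg]
  | succ n => rfl
theorem pr_M (n : ℕ) (F : List Sy → R) (a b c : Tt n) : pr (n+1) F (Mt n a b c) =
    pr n (fun w => F (e :: w)) a + (pr n (fun w => F (u :: w)) b + pr n (fun w => F (d :: w)) c) := by
  cases n with
  | zero =>
    cases a with
    | v x => rfl
    | n => cases b with
      | v x => rfl
      | n => cases c with
        | v x => rfl
        | n => simp [Mt, lmk, pr, lg]
  | succ n =>
    cases a with
    | s _ _ _ => rfl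
    | n => cases b with
      | s _ _ _ => rfl
      | n => cases c with
        | s _ _ _ => rfl
        | n => simp [Mt, omk, pr]
theorem pr_add (n : ℕ) (F F' : List Sy → R) (x : Tt n) : pr n (fun w => F w + F' w) x = pr n F x + pr n F' x := by
  induction n generalizing F F' with
  | zero => simp [pr, add_mul]
  | succ n ih =>
    cases x with
    | n => simp [pr_n]
    | s a b c =>
      simp only [pr_s, ih]
      ac_rfl
theorem pr_zero (n : ℕ) (x : Tt n) : pr n (fun _ => (0 : R)) x = 0 := by
  induction n with
  | zero => simp [pr]
  | succ n ih =>
    cases x with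
    | n => simp [pr_n]
    | s a b c => simp [pr_s, ih]
theorem pr_mul (n : ℕ) (F : List Sy → R) (r : R) (x : Tt n) : pr n (fun w => F w * r) x = pr n F x * r := by
  induction n generalizing F with
  | zero => simp [pr]; ring
  | succ n ih =>
    cases x with
    | n => simp [pr_n]
    | s a b c => simp only [pr_s, ih]; ring
/-- `F` depends on the first `k` letters and on the rest -/
def sp : ℕ → (List Sy → List Sy → R) → List Sy → R
  | 0, F, w => F [] w
  | _ + 1, _, [] => 0
  | k + 1, F, a :: w => sp k (fun s p => F (a :: s) p) w
theorem sp_add (k : ℕ) (F F' : List Sy → List Sy → R) (w : List Sy) :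
    sp k (fun s p => F s p + F' s p) w = sp k F w + sp k F' w := by
  induction k generalizing F F' w with
  | zero => rfl
  | succ k ih => cases w with
    | nil => simp [sp]
    | cons a w => simp only [sp, ih]
theorem sp_zero (k : ℕ) (w : List Sy) : sp k (fun _ _ => (0 : R)) w = 0 := by
  induction k generalizing w with
  | zero => rfl
  | succ k ih => cases w with
    | nil => simp [sp]
    | cons a w => simp only [sp, ih]
theorem prsp_add (n k : ℕ) (F F' : List Sy → List Sy → R) (x : Tt n) :
    pr n (sp k (fun s p => F s p + F' s p)) x = pr n (sp k F) x + pr n (sp k F') x := by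
  rw [← pr_add]; congr 1; funext w; exact sp_add k F F' w
theorem prsp_zero (n k : ℕ) (x : Tt n) : pr n (sp k (fun _ _ => (0 : R))) x = 0 := by
  have : sp k (fun _ _ => (0 : R)) = fun _ => 0 := funext (sp_zero k)
  rw [this, pr_zero]
/-- flip the first unmatched down step -/
def fl : ℕ → List Sy → Option (List Sy)
  | _, [] => none
  | j, e :: s => (fl j s).map (e :: ·)
  | j, u :: s => (fl (j + 1) s).map (u :: ·)
  | 0, d :: s => some (u :: s)
  | j + 1, d :: s => (fl j s).map (d :: ·)
def oz {β : Type} (F : β → R) : Option β → R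
  | none => 0
  | some s => F s
theorem oz_some {β : Type} (F : β → R) (s : β) : oz F (some s) = F s := rfl
@[simp] theorem oz_map {β γ : Type} (F : γ → R) (f : β → γ) (o : Option β) : oz F (o.map f) = oz (fun x => F (f x)) o := by
  cases o <;> rfl
def alle : List Sy → Bool
  | [] => true
  | e :: s => alle s
  | _ :: _ => false
end pairing
section preds
variable (R : Type) [CommSemiring R]
def IsA (n : ℕ) (f : Tt n → Tt n → Tt n) : Prop :=
  ∀ (F : List Sy → R) x y, pr n F (f x y) = pr n F x + pr n F y
def IsG (n : ℕ) (f : Tt n → ℕ) : Prop :=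
  ∀ x, (f x : R) = pr n (fun w => cond (alle w) 1 0) x
def IsJ (i k : ℕ) (f : Tt (i + k) → Tt (i + k) → Tt (i + k) → Tt (i + k + 1)) : Prop :=
  ∀ (F : List Sy → List Sy → R) x y w, pr (i + k + 1) (sp k F) (f x y w) =
    pr (i + k) (sp k (fun s p => F s (e :: p))) x + (pr (i + k) (sp k (fun s p => F s (u :: p))) y
      + pr (i + k) (sp k (fun s p => F s (d :: p))) w)
def IsF (i k : ℕ) (f : ℕ → Tt (i + k) → Tt (i + k)) : Prop :=
  ∀ (F : List Sy → List Sy → R) j x, pr (i + k) (sp k F) (f j x) =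
    pr (i + k) (sp k (fun s p => oz (fun s' => F s' p) (fl j s))) x
def IsF0 (k : ℕ) (f : ℕ → Tt k → Tt k) : Prop :=
  ∀ (F : List Sy → R) j x, pr k F (f j x) = pr k (fun s => oz F (fl j s)) x
def IsN (i k : ℕ) (f : Tt (i + k) → Tt (i + k)) : Prop :=
  ∀ (F : List Sy → List Sy → R) x, pr (i + k) (sp k F) (f x) =
    pr (i + k) (sp k (fun s p => oz (fun p' => F s p') (fl 0 p))) x
variable {R}
theorem IsA.zero : IsA R 0 ladd := by
  intro F x y
  cases x <;> cases y <;> simp [ladd, pr, lg, mul_add]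
theorem IsA.succ {n : ℕ} {f : Tt n → Tt n → Tt n} (h : IsA R n f) : IsA R (n+1) (oadd f) := by
  intro F x y
  cases x with
  | n => rw [pr_n, zero_add]; rfl
  | s a b c =>
    cases y with
    | n => rw [pr_n, add_zero]; rfl
    | s a' b' c' =>
      change pr (n+1) F (O.s (f a a') (f b b') (f c c')) = _
      simp only [pr_s, h _]
      ac_rfl
theorem IsG.zero : IsG R 0 lg := by
  intro x; simp [pr, alle]
theorem IsG.succ {n : ℕ} {f : Tt n → ℕ} (h : IsG R n f) : IsG R (n+1) (og f) := by
  intro x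
  cases x with
  | n => simp [pr_n, og]
  | s a b c =>
    simp only [pr_s, alle]
    change (f a : R) = _
    rw [h a]; simp only [cond_false, pr_zero, add_zero]
theorem IsJ.zero {i : ℕ} : IsJ R i 0 (Mt i) := by
  intro F x y w
  exact pr_M i _ x y w
theorem IsJ.succ {i k : ℕ} {f : Tt (i + k) → Tt (i + k) → Tt (i + k) → Tt (i + k + 1)} (h : IsJ R i k f) :
    IsJ R i (k+1) (jn (Zt (i+k)) f) := by
  intro F x y w
  cases x <;> cases y <;> cases w <;>
    first
    | (simp only [jn]
       change pr ((i+k+1)+1) _ (O.s _ _ _) = _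
       simp only [pr_s, sp, h _, pr_Z]
       change _ = pr ((i+k)+1) _ _ + (pr ((i+k)+1) _ _ + pr ((i+k)+1) _ _)
       simp only [pr_s, pr_n, sp, add_zero, zero_add]
       try ac_rfl)
    | (change (0 : R) = 0 + (0 + 0)
       simp)
theorem IsF.zero {i : ℕ} : IsF R i 0 (fun _ _ => Zt i) := by
  intro F j x
  change pr i _ (Zt i) = pr i _ x
  rw [pr_Z, ← pr_zero i x]; rfl
theorem IsF.succ {i k : ℕ} {f : ℕ → Tt (i + k) → Tt (i + k)} {ad : Tt (i+k) → Tt (i+k) → Tt (i+k)}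
    (ha : IsA R (i+k) ad) (h : IsF R i k f) :
    IsF R i (k+1) (fo (Zt (i+k)) ad (Mt (i+k)) f) := by
  intro F j x
  cases x with
  | n => rfl
  | s a b c =>
    cases j with
    | zero =>
      change pr ((i+k)+1) _ (Mt (i+k) _ _ _) = pr ((i+k)+1) _ (O.s _ _ _)
      simp only [pr_s, pr_M, sp, fl, oz_map, ha _, h _, pr_Z, oz_some, add_zero]
    | succ j =>
      change pr ((i+k)+1) _ (Mt (i+k) _ _ _) = pr ((i+k)+1) _ (O.s _ _ _)
      simp only [pr_s, pr_M, sp, fl, oz_map, h _]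
theorem IsF0.zero : IsF0 R 0 (fun _ _ => Zt 0) := by
  intro F j x
  rw [pr_Z, ← pr_zero 0 x]; rfl
theorem IsF0.succ {k : ℕ} {f : ℕ → Tt k → Tt k} {ad : Tt k → Tt k → Tt k}
    (ha : IsA R k ad) (h : IsF0 R k f) :
    IsF0 R (k+1) (fo (Zt k) ad (Mt k) f) := by
  intro F j x
  cases x with
  | n => rfl
  | s a b c =>
    cases j with
    | zero =>
      change pr (k+1) _ (Mt k _ _ _) = pr (k+1) _ (O.s _ _ _)
      simp only [pr_s, pr_M, fl, oz_map, ha _, h _, pr_Z, oz_some, add_zero]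
    | succ j =>
      change pr (k+1) _ (Mt k _ _ _) = pr (k+1) _ (O.s _ _ _)
      simp only [pr_s, pr_M, fl, oz_map, h _]
theorem IsN.zero {i : ℕ} {f : ℕ → Tt i → Tt i} (h : IsF0 R i f) : IsN R i 0 (f 0) := by
  intro F x
  exact h _ 0 x
theorem IsN.succ {i k : ℕ} {f : Tt (i + k) → Tt (i + k)} (h : IsN R i k f) : IsN R i (k+1) (mi (Mt (i+k)) f) := by
  intro F x
  cases x with
  | n => rfl
  | s a b c =>
    change pr ((i+k)+1) _ (Mt (i+k) _ _ _) = pr ((i+k)+1) _ (O.s _ _ _)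
    simp only [pr_s, pr_M, sp, h _]
end preds
end G
end

set_option linter.all false
noncomputable section
namespace G
open Sy
section site
variable {R : Type} [CommSemiring R]
def SF (K : List Sy → Sy → R) (Z : R) : ℕ → List Sy → Sy → List Sy → R
  | 0, p, l, _ => K p l
  | _ + 1, _, _, [] => 0
  | n + 1, p, e, e :: s => SF K Z n (e :: p) e s + SF K Z n (d :: p) u s
  | n + 1, p, e, u :: s => SF K Z n (d :: p) e s + SF K Z n (e :: p) d s
  | n + 1, p, d, e :: s => SF K Z n (d :: p) e s + SF K Z n (e :: p) d s
  | n + 1, p, e, d :: s => SF K Z n (u :: p) e s + SF K Z n (e :: p) u s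
  | n + 1, p, u, e :: s => SF K Z n (u :: p) e s + SF K Z n (e :: p) u s
  | n + 1, p, u, u :: s => SF K Z n (e :: p) e s
  | n + 1, p, d, u :: s => oz (fun s' => SF K Z n (e :: p) e s') (fl 0 s)
  | n + 1, p, u, d :: s => oz (fun p' => SF K Z n (e :: p') e s) (fl 0 p)
  | _ + 1, p, d, d :: s => cond (alle p && alle s) Z 0
/-- pairing of a fused state -/
def QS (K : List Sy → Sy → R) (Z : R) (n k : ℕ) (x o c y : Tt n) : R :=
  pr n (sp k (fun s p => SF K Z k (e :: p) e s)) x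
  + pr n (sp k (fun s p => SF K Z k (d :: p) e s + SF K Z k (e :: p) d s)) o
  + pr n (sp k (fun s p => SF K Z k (u :: p) e s + SF K Z k (e :: p) u s)) c
  + pr n (sp k (fun s p => SF K Z k (d :: p) u s)) y
variable (R) in
def IsS (n k : ℕ) (S : Sty (Tt n) (Tt (n+1))) : Prop :=
  ∀ x o c y (r : ℕ) K', ∃ a b, ∃ r0 : ℕ, S x o c y r K' = K' a b r0 ∧
    ∀ (K : List Sy → Sy → R) (Z : R), (∀ p, K p d = 0) →
      pr (n+1) (fun w => K w e) a + pr (n+1) (fun w => K w u) b + r0 * Z = QS K Z n k x o c y + r * Z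
theorem IsS.zero {n : ℕ} : IsS R n 0 (fun x o c z r K => K (Mt n x c o) (Mt n c (Zt n) z) r) := by
  intro x o c y r K'
  refine ⟨_, _, _, rfl, ?_⟩
  intro K Z hK
  simp only [pr_M, QS, sp, SF, hK, add_zero, pr_Z, pr_add]
  ring
theorem br_eq {n : ℕ} (x : Tt (n+1)) : ∃ x0 x1 x2, (∀ k, br (Zt n) x k = k x0 x1 x2) ∧
    ∀ (F : List Sy → R), pr (n+1) F x = pr n (fun w => F (e :: w)) x0
      + (pr n (fun w => F (u :: w)) x1 + pr n (fun w => F (d :: w)) x2) := by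
  cases x with
  | n => exact ⟨Zt n, Zt n, Zt n, fun k => rfl, fun F => by simp only [pr_n, pr_Z, add_zero]⟩
  | s a b c => exact ⟨a, b, c, fun k => rfl, fun F => rfl⟩
theorem pr_alle (n k : ℕ) (Z : R) (x : Tt (n + k)) :
    pr (n + k) (sp k (fun s p => cond (alle p && alle s) Z 0)) x
      = pr (n + k) (fun w => cond (alle w) 1 0) x * Z := by
  induction k with
  | zero =>
    rw [← pr_mul]; congr 1; funext w
    simp only [sp, alle, Bool.and_true]
    cases alle w <;> simp
  | succ k ih =>
    obtain ⟨x0, x1, x2, -, h⟩ := br_eq (R := R) (n := n + k) x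
    have h' : ∀ F : List Sy → R, pr (n + (k+1)) F x = _ := h
    rw [h', h']
    simp only [sp, alle, Bool.and_false, cond_false]
    rw [ih, pr_zero, pr_zero]
    have := prsp_zero (R := R) (n + k) k
    rw [this, this]
    simp
theorem br_eq' {n : ℕ} (x : Tt (n+1)) : ∃ x0 x1 x2, (∀ k, br (Zt n) x k = k x0 x1 x2) ∧
    ∀ (k : ℕ) (F : List Sy → List Sy → R), pr (n+1) (sp (k+1) F) x = pr n (sp k fun s p => F (e :: s) p) x0
      + (pr n (sp k fun s p => F (u :: s) p) x1 + pr n (sp k fun s p => F (d :: s) p) x2) := by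
  obtain ⟨x0, x1, x2, h1, h2⟩ := br_eq (R := R) x
  exact ⟨x0, x1, x2, h1, fun k F => h2 _⟩
theorem IsS.succ {i k : ℕ} {S : Sty (Tt (i + k + 1)) (Tt (i + k + 2))} {ad : Tt (i + k) → Tt (i + k) → Tt (i + k)}
    {f : ℕ → Tt (i + k) → Tt (i + k)} {nn : Tt (i + k) → Tt (i + k)}
    {j : Tt (i + k) → Tt (i + k) → Tt (i + k) → Tt (i + k + 1)} {g : Tt (i + k) → ℕ}
    (ha : IsA R (i + k) ad) (hf : IsF R i k f) (hn : IsN R i k nn) (hj : IsJ R i k j) (hg : IsG R (i + k) g)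
    (hS : IsS R (i + k + 1) k S) :
    IsS R (i + k + 1) (k + 1) (sst (Zt (i + k)) ad f nn j g S) := by
  intro x o c y r K'
  obtain ⟨x0, x1, x2, hx, hx'⟩ := br_eq' (R := R) (n := i + k) x
  obtain ⟨o0, o1, o2, ho, ho'⟩ := br_eq' (R := R) (n := i + k) o
  obtain ⟨c0, c1, c2, hc, hc'⟩ := br_eq' (R := R) (n := i + k) c
  obtain ⟨y0, y1, y2, hy, hy'⟩ := br_eq' (R := R) (n := i + k) y
  have : sst (Zt (i + k)) ad f nn j g S x o c y r K' = S (j (ad (ad x0 c1) (ad (f 0 o1) (nn c2))) (ad c0 y2) (ad o0 y1)) (j (ad x1 o0) c1 o1)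
      (j (ad x2 c0) c2 (ad o2 y0)) (j x0 c0 o0) (Nat.add r (g o2)) K' := by
    exact (hx _).trans ((ho _).trans ((hc _).trans (hy _)))
  rw [this]
  obtain ⟨a, b, r0, h1, h2⟩ := hS (j (ad (ad x0 c1) (ad (f 0 o1) (nn c2))) (ad c0 y2) (ad o0 y1)) (j (ad x1 o0) c1 o1)
      (j (ad x2 c0) c2 (ad o2 y0)) (j x0 c0 o0) (Nat.add r (g o2)) K'
  refine ⟨a, b, r0, h1, ?_⟩
  intro K Z hK
  rw [h2 K Z hK]
  simp only [QS, hx', ho', hc', hy', hj _, ha _, hf _, hn _, sp, SF, prsp_add, Nat.add_eq, Nat.cast_add, hg _, add_mul,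
    ← pr_alle, alle, fl, oz_map, oz_some]
  ring
end site
end G
end

set_option linter.all false
noncomputable section
namespace G
open Sy
/-- colour at the end of a word -/
def ec : Bool → List Sy → Bool
  | b, [] => b
  | b, e :: w => ec b w
  | b, _ :: w => ec (!b) w
/-- number of black cells of a word -/
def blk : Bool → List Sy → ℕ
  | b, [] => b.toNat
  | b, e :: w => b.toNat + blk b w
  | b, _ :: w => b.toNat + blk (!b) w
theorem ec_not (b : Bool) (w : List Sy) : ec (!b) w = !(ec b w) := by
  induction w generalizing b with
  | nil => rfl
  | cons a w ih => cases a <;> simp only [ec, ih]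
theorem blk_not (b : Bool) (w : List Sy) : blk (!b) w + blk b w = w.length + 1 := by
  induction w generalizing b with
  | nil => cases b <;> rfl
  | cons a w ih =>
    have := ih b
    cases a <;> cases b <;> simp_all [blk] <;> omega
theorem alle_ec (b : Bool) (w : List Sy) (h : alle w = true) : ec b w = b := by
  induction w with
  | nil => rfl
  | cons a w ih => cases a <;> simp_all [alle, ec]
theorem alle_blk (w : List Sy) (h : alle w = true) : blk true w = w.length + 1 := by
  induction w with
  | nil => rfl
  | cons a w ih => cases a <;> simp_all [alle, blk]; omega
theorem fl_inv (j : ℕ) (s s' : List Sy) (h : fl j s = some s') (b : Bool) :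
    s'.length = s.length ∧ ec b s' = ec b s ∧ blk b s' = blk b s := by
  induction s generalizing j s' b with
  | nil => simp [fl] at h
  | cons a w ih =>
    cases a with
    | e =>
      simp only [fl, Option.map_eq_some_iff] at h
      obtain ⟨t, ht, rfl⟩ := h
      have := ih j t ht b
      simp [ec, blk, this]
    | u =>
      simp only [fl, Option.map_eq_some_iff] at h
      obtain ⟨t, ht, rfl⟩ := h
      have := ih _ t ht (!b)
      simp [ec, blk, this]
    | d =>
      cases j with
      | zero =>
        simp only [fl, Option.some.injEq] at h
        subst h
        simp [ec, blk]
      | succ j =>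
        simp only [fl, Option.map_eq_some_iff] at h
        obtain ⟨t, ht, rfl⟩ := h
        have := ih _ t ht (!b)
        simp [ec, blk, this]
/-- result of one site -/
inductive Rs where
  | dead : Rs
  | fin : Rs
  | nx : List Sy → Sy → List Sy → Rs
/-- transition at one site; the last argument tells whether the new cell differs from its left neighbour -/
def tr (p : List Sy) : Sy → Sy → List Sy → Bool → Rs
  | e, e, s, false => .nx (e :: p) e s
  | e, e, s, true => .nx (d :: p) u s
  | e, u, s, true => .nx (d :: p) e s
  | e, u, s, false => .nx (e :: p) d s
  | d, e, s, true => .nx (d :: p) e s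
  | d, e, s, false => .nx (e :: p) d s
  | e, d, s, true => .nx (u :: p) e s
  | e, d, s, false => .nx (e :: p) u s
  | u, e, s, true => .nx (u :: p) e s
  | u, e, s, false => .nx (e :: p) u s
  | u, u, s, false => .nx (e :: p) e s
  | d, u, s, false => match fl 0 s with
    | none => .dead
    | some s' => .nx (e :: p) e s'
  | u, d, s, false => match fl 0 p with
    | none => .dead
    | some p' => .nx (e :: p') e s
  | d, d, s, false => cond (alle p && alle s) .fin .dead
  | _, _, _, true => .dead
theorem tr_inv (q v : Bool) (p : List Sy) (l a : Sy) (s p' : List Sy) (l' : Sy) (s' : List Sy)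
    (h : tr p l a s (v != q) = .nx p' l' s') :
    p'.length = p.length + 1 ∧ s'.length = s.length ∧ blk v p' = v.toNat + blk q p ∧ ec v p' = ec q p ∧
      ec v (l' :: s') = ec q (l :: a :: s) := by
  cases l <;> cases a <;> cases v <;> cases q <;> simp only [tr, Bool.bne_true, Bool.bne_false, Bool.not_true, Bool.not_false, reduceCtorEq, Rs.nx.injEq] at h <;>
    first
    | (obtain ⟨rfl, rfl, rfl⟩ := h; simp [ec, blk]; done)
    | (split at h
       · simp at h
       · rename_i t ht
         simp only [Rs.nx.injEq] at h
         obtain ⟨rfl, rfl, rfl⟩ := h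
         have h1 := fl_inv _ _ _ ht true
         have h2 := fl_inv _ _ _ ht false
         simp [ec, blk, h1, h2])
    | (cases hc : (alle p && alle s) <;> simp [hc] at h)
section bsum
variable {M : Type} [AddCommMonoid M]
def bsum : ℕ → (List Bool → M) → M
  | 0, g => g []
  | k + 1, g => bsum k (fun w => g (true :: w)) + bsum k (fun w => g (false :: w))
theorem bsum_hom {N : Type} [AddCommMonoid N] (φ : M → N) (hφ : ∀ x y, φ (x + y) = φ x + φ y) (k : ℕ) (g : List Bool → M) :
    φ (bsum k g) = bsum k (fun w => φ (g w)) := by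
  induction k generalizing g with
  | zero => rfl
  | succ k ih => simp only [bsum, hφ, ih]
theorem bsum_congr (k : ℕ) (g g' : List Bool → M) (h : ∀ w, w.length = k → g w = g' w) : bsum k g = bsum k g' := by
  induction k generalizing g g' with
  | zero => exact h [] rfl
  | succ k ih =>
    simp only [bsum]
    congr 1
    · exact ih _ _ fun w hw => h _ (by simp [hw])
    · exact ih _ _ fun w hw => h _ (by simp [hw])
theorem bsum_zero (k : ℕ) : bsum k (fun _ => (0 : M)) = 0 := by
  induction k with
  | zero => rfl
  | succ k ih => simp only [bsum, ih, add_zero]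
theorem bsum_true (k : ℕ) (z : M) : bsum k (fun w => cond (w.all id) z 0) = z := by
  induction k with
  | zero => rfl
  | succ k ih => simp [bsum, ih, bsum_zero]
end bsum
section row
variable {R : Type} [CommSemiring R]
def rs {α : Type} (D : α) (Fi : α) (f : List Sy → Sy → List Sy → α) : Rs → α
  | .dead => D
  | .fin => Fi
  | .nx p l s => f p l s
def RW (K : List Sy → Sy → R) (Z : R) : Bool → List Bool → List Sy → Sy → List Sy → R
  | _, [], p, l, _ => K p l
  | _, _ :: _, _, _, [] => 0
  | q, v :: vs, p, l, a :: s => rs 0 (cond ((v :: vs).all id) Z 0) (fun p' l' s' => RW K Z v vs p' l' s') (tr p l a s (v != q))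
theorem RW_add (K K' : List Sy → Sy → R) (Z Z' : R) (q : Bool) (vs : List Bool) (p : List Sy) (l : Sy) (s : List Sy) :
    RW (K + K') (Z + Z') q vs p l s = RW K Z q vs p l s + RW K' Z' q vs p l s := by
  induction vs generalizing q p l s with
  | nil => rfl
  | cons v vs ih =>
    cases s with
    | nil => simp [RW]
    | cons a s =>
      simp only [RW]
      cases tr p l a s (v != q) with
      | dead => simp [rs]
      | fin => simp only [rs]; cases ((v :: vs).all id) <;> simp
      | nx p' l' s' => simp only [rs, ih]
def cnt1 (vs : List Bool) : ℕ := (vs.map Bool.toNat).sum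
theorem cnt1_all (vs : List Bool) (h : vs.all id = true) : cnt1 vs = vs.length := by
  induction vs with
  | nil => rfl
  | cons v vs ih => simp_all [cnt1]; omega
theorem row_lemma (X : R) (m : ℕ) (I : Bool → List Sy → Sy → List Sy → Prop) (K K' : List Sy → Sy → R) (Z : R)
    (hstep : ∀ q v p l a s p' l' s', I q p l (a :: s) → tr p l a s (v != q) = .nx p' l' s' → I v p' l' s')
    (hfin : ∀ q p s, I q p d (d :: s) → alle p = true → alle s = true → q = true)
    (hend : ∀ q p l, I q p l [] → p.length = m → K p l * X ^ (blk q p) = K' p l)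
    (k : ℕ) (q : Bool) (p : List Sy) (l : Sy) (s : List Sy) (hI : I q p l s) (hs : s.length = k) (hp : p.length + k = m) :
    bsum k (fun vs => RW K Z q vs p l s * X ^ (blk q p + cnt1 vs)) = SF K' (Z * X ^ (m + 1)) k p l s := by
  induction k generalizing q p l s with
  | zero =>
    have : s = [] := List.length_eq_zero_iff.1 hs
    subst this
    simp only [bsum, RW, SF, cnt1]
    exact hend q p l hI hp
  | succ k ih =>
    obtain _ | ⟨a, s⟩ := s
    · simp at hs
    have hs' : s.length = k := by simpa using hs
    have key : ∀ v : Bool, bsum k (fun vs => RW K Z q (v :: vs) p l (a :: s) * X ^ (blk q p + cnt1 (v :: vs))) =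
        rs 0 (cond v (Z * X ^ (m+1)) 0) (fun p' l' s' => SF K' (Z * X ^ (m + 1)) k p' l' s') (tr p l a s (v != q)) := by
      intro v
      simp only [RW]
      cases ht : tr p l a s (v != q) with
      | dead => simp [rs, bsum_zero]
      | fin =>
        simp only [rs]
        have hl : l = d ∧ a = d ∧ alle p = true ∧ alle s = true := by
          cases l <;> cases a <;> cases hv : (v != q) <;> simp [tr, hv] at ht <;> first
            | (split at ht <;> simp at ht; done)
            | (cases hc : (alle p && alle s) <;> simp_all)
        obtain ⟨rfl, rfl, h1, h2⟩ := hl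
        have hq := hfin q p s hI h1 h2
        subst hq
        cases v with
        | false => simp [bsum_zero]
        | true =>
          rw [cond_true]
          trans bsum k (fun w => cond (w.all id) (Z * X ^ (m+1)) 0)
          · apply bsum_congr
            intro w hw
            simp only [List.all_cons, id, Bool.true_and]
            cases hw' : w.all id with
            | false =>
              simp
            | true =>
              have h3 : cnt1 (true :: w) = 1 + w.length := by
                rw [← cnt1_all w hw']; simp [cnt1]
              rw [h3, alle_blk p h1, hw, cond_true, cond_true]
              congr 2; omega
          · exact bsum_true k _
      | nx p' l' s' =>
        obtain ⟨i1, i2, i3, i4, i5⟩ := tr_inv q v p l a s p' l' s' ht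
        simp only [rs]
        rw [← ih v p' l' s' (hstep _ _ _ _ _ _ _ _ _ hI ht) (by omega) (by omega)]
        apply bsum_congr
        intro w _
        congr 2
        rw [i3]; simp [cnt1]; omega
    simp only [bsum]
    rw [key, key]
    cases q <;> simp only [Bool.bne_true, Bool.bne_false, Bool.not_true, Bool.not_false]
    · cases l <;> cases a <;> simp only [tr, rs, SF] <;> first
        | rfl
        | (rw [add_comm]; done)
        | (cases fl 0 s <;> simp [rs, oz]; done)
        | (cases fl 0 p <;> simp [rs, oz]; done)
        | simp
        | skip
      cases hc : (alle p && alle s)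
      · simp [rs]
      · simp only [Bool.and_eq_true] at hc
        have := hfin _ _ _ hI hc.1 hc.2
        simp at this
    · cases l <;> cases a <;> simp only [tr, rs, SF] <;> first
        | rfl
        | (rw [add_comm]; done)
        | (cases fl 0 s <;> simp [rs, oz]; done)
        | (cases fl 0 p <;> simp [rs, oz]; done)
        | simp
        | skip
      cases hc : (alle p && alle s) <;> simp [rs]
end row
end G
end

set_option linter.all false
noncomputable section
namespace G
open Sy
def one : List Sy → Bool
  | [] => false
  | e :: w => one w
  | _ :: w => alle w
def oned : List Sy → Bool
  | [] => false
  | e :: w => oned w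
  | u :: _ => false
  | d :: w => alle w
def udw : List Sy → Bool
  | [] => false
  | e :: w => udw w
  | u :: w => oned w
  | d :: _ => false
section weights
variable {R : Type} [CommSemiring R]
def wtM (X : R) (cl : Bool) (m : ℕ) (w : List Sy) : R := X ^ (m + blk cl w)
def wtN (X : R) (cl : Bool) (m : ℕ) (w : List Sy) : R :=
  cond (ec cl w) (X ^ (m + blk cl w)) (X ^ (12 - (m + blk cl w)))
def wtC (cl : Bool) (m : ℕ) (w : List Sy) : R := cond (ec cl w) 0 4
def wtE (cl : Bool) (m : ℕ) (w : List Sy) : R := cond (ec cl w) 4 0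
variable (R) in
def IsW (n : ℕ) (wt : Bool → ℕ → List Sy → R) (f : Bool → ℕ → Tt n → Tt n) : Prop :=
  ∀ cl m F x, pr n F (f cl m x) = pr n (fun w => F w * wt cl m w) x
variable (R) in
def IsP (n : ℕ) (A : List Sy → Bool) (f : Tt n → ℕ) : Prop :=
  ∀ x, (f x : R) = pr n (fun w => cond (A w) 1 0) x
theorem lg_wl (M w v : ℕ) (hM : (M : R) = 0) : ((lg (wl M w v) : ℕ) : R) = v * w := by
  change (((v * w) % M : ℕ) : R) = _
  conv_rhs => rw [← Nat.cast_mul, ← Nat.mod_add_div (v * w) M]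
  simp [hM]
theorem IsW.zeroM (X M : ℕ) (hM : (M : R) = 0) : IsW R 0 (wtM (X : R)) (wm 12 X M) := by
  intro cl m F x
  cases x with
  | n => simp [pr, wm, lg]
  | v a =>
    change F [] * ((lg (wl M _ a) : ℕ) : R) = F [] * wtM (X : R) cl m [] * (a : ℕ)
    rw [lg_wl _ _ _ hM]
    cases cl <;> simp [wtM, blk] <;> ring
theorem IsW.zeroN (X M : ℕ) (hM : (M : R) = 0) : IsW R 0 (wtN (X : R)) (wn 12 X M) := by
  intro cl m F x
  cases x with
  | n => simp [pr, wn, lg]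
  | v a =>
    change F [] * ((lg (wl M _ a) : ℕ) : R) = F [] * wtN (X : R) cl m [] * (a : ℕ)
    rw [lg_wl _ _ _ hM]
    cases cl <;> simp [wtN, blk, ec] <;> ring
theorem IsW.zeroC : IsW R 0 wtC wc := by
  intro cl m F x
  cases x with
  | n => simp [pr, wc, lg]
  | v a => cases cl <;> simp [pr, wc, lg, wtC, ec]; ring
theorem IsW.zeroE : IsW R 0 wtE we := by
  intro cl m F x
  cases x with
  | n => simp [pr, we, lg]
  | v a => cases cl <;> simp [pr, we, lg, wtE, ec]; ring
theorem IsW.succM {n : ℕ} {X : R} {f : Bool → ℕ → Tt n → Tt n} (h : IsW R n (wtM X) f) : IsW R (n+1) (wtM X) (wgt (Mt n) f) := by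
  intro cl m F x
  cases x with
  | n => rfl
  | s a b c =>
    cases cl
    · change pr (n+1) _ (Mt n _ _ _) = _
      simp only [pr_M, pr_s, h _ _, wtM, blk, Bool.toNat, cond_false, zero_add, Bool.not_false]
    · change pr (n+1) _ (Mt n _ _ _) = _
      simp only [pr_M, pr_s, h _ _, wtM, blk, Bool.toNat, cond_true, Bool.not_true, Nat.succ_eq_add_one, add_assoc]
theorem IsW.succN {n : ℕ} {X : R} {f : Bool → ℕ → Tt n → Tt n} (h : IsW R n (wtN X) f) : IsW R (n+1) (wtN X) (wgt (Mt n) f) := by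
  intro cl m F x
  cases x with
  | n => rfl
  | s a b c =>
    cases cl
    · change pr (n+1) _ (Mt n _ _ _) = _
      simp only [pr_M, pr_s, h _ _, wtN, blk, ec, Bool.toNat, cond_false, zero_add, Bool.not_false]
    · change pr (n+1) _ (Mt n _ _ _) = _
      simp only [pr_M, pr_s, h _ _, wtN, blk, ec, Bool.toNat, cond_true, Bool.not_true, Nat.succ_eq_add_one, add_assoc]
theorem IsW.succC {n : ℕ} {f : Bool → ℕ → Tt n → Tt n} (h : IsW R n wtC f) : IsW R (n+1) wtC (wpr (Mt n) f) := by
  intro cl m F x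
  cases x with
  | n => rfl
  | s a b c =>
    cases cl <;> change pr (n+1) _ (Mt n _ _ _) = _ <;>
      simp only [pr_M, pr_s, h _ _, wtC, ec, Bool.not_false, Bool.not_true]
theorem IsW.succE {n : ℕ} {f : Bool → ℕ → Tt n → Tt n} (h : IsW R n wtE f) : IsW R (n+1) wtE (wpr (Mt n) f) := by
  intro cl m F x
  cases x with
  | n => rfl
  | s a b c =>
    cases cl <;> change pr (n+1) _ (Mt n _ _ _) = _ <;>
      simp only [pr_M, pr_s, h _ _, wtE, ec, Bool.not_false, Bool.not_true]
theorem IsP.zero1 : IsP R 0 one (fun _ => 0) := by intro x; simp [pr, one]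
theorem IsP.zerou : IsP R 0 oned (fun _ => 0) := by intro x; simp [pr, oned]
theorem IsP.zerod : IsP R 0 udw (fun _ => 0) := by intro x; simp [pr, udw]
theorem IsP.succ1 {n : ℕ} {s g : Tt n → ℕ} (hs : IsP R n one s) (hg : IsG R n g) : IsP R (n+1) one (os1 s g) := by
  intro x
  cases x with
  | n => simp [os1, pr_n]
  | s a b c =>
    change ((s a + (g b + g c) : ℕ) : R) = _
    simp only [Nat.cast_add, hs _, hg _, pr_s, one]
theorem IsP.succu {n : ℕ} {s g : Tt n → ℕ} (hs : IsP R n oned s) (hg : IsG R n g) : IsP R (n+1) oned (ou s g) := by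
  intro x
  cases x with
  | n => simp [ou, pr_n]
  | s a b c =>
    change ((s a + g c : ℕ) : R) = _
    simp only [Nat.cast_add, hs _, hg _, pr_s, oned, cond_false, pr_zero, zero_add]
theorem IsP.succd {n : ℕ} {s g : Tt n → ℕ} (hs : IsP R n udw s) (hg : IsP R n oned g) : IsP R (n+1) udw (od s g) := by
  intro x
  cases x with
  | n => simp [od, pr_n]
  | s a b c =>
    change ((s a + g b : ℕ) : R) = _
    simp only [Nat.cast_add, hs _, hg _, pr_s, udw, cond_false, pr_zero, add_zero]
end weights
section rows
variable {R : Type} [CommSemiring R]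
def FA (w : List Sy) : R := cond (one w) 1 0 + 4 * cond (udw w) 1 0
def kN (X : R) (Gf : List Sy → R) (p : List Sy) : Sy → R
  | e => Gf p * wtN X true 0 p
  | u => Gf p * wtN X true 0 p * wtC true 0 p
  | d => 0
def kM (X : R) (Gf : List Sy → R) (p : List Sy) : Sy → R
  | e => Gf p * wtM X true 0 p
  | u => 0
  | d => 0
def GN (X : R) (n E : ℕ) (Gf : List Sy → R) (w : List Sy) : R := SF (kN X Gf) (X ^ E) n [] e w
def GM (X : R) (n E : ℕ) (Gf : List Sy → R) (w : List Sy) : R :=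
  SF (kM X Gf) (X ^ E) n [] e w + SF (kM X Gf) (X ^ E) n [] u w * wtE true 0 w
variable (R) in
def IsR (n : ℕ) (Gf : List Sy → R) (f : Tt n → ℕ → ℕ) : Prop := ∀ v r, (f v r : R) = r + pr n Gf v
theorem IsR.zero {n : ℕ} {s t : Tt n → ℕ} (hs : IsP R n one s) (ht : IsP R n udw t) :
    IsR R n FA (fun v r => Nat.add r (Nat.add (s v) (Nat.mul 4 (t v)))) := by
  intro v r
  change ((r + (s v + 4 * t v) : ℕ) : R) = _
  have : FA (R := R) = fun w => cond (one w) 1 0 + cond (udw w) 1 0 * 4 := by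
    funext w; simp only [FA]; ring
  rw [this, pr_add, pr_mul, ← hs, ← ht]
  push_cast; ring
theorem pr_congr (n : ℕ) (F F' : List Sy → R) (x : Tt n) (h : ∀ w, w.length = n → F w = F' w) : pr n F x = pr n F' x := by
  induction n generalizing F F' with
  | zero => simp [pr, h []]
  | succ n ih =>
    cases x with
    | n => rfl
    | s a b c =>
      simp only [pr_s]
      rw [ih _ _ a fun w hw => h (e :: w) (by simp [hw]), ih _ _ b fun w hw => h (u :: w) (by simp [hw]),
        ih _ _ c fun w hw => h (d :: w) (by simp [hw])]
theorem sp_full (k : ℕ) (F : List Sy → List Sy → R) (w : List Sy) (h : w.length = k) : sp k F w = F w [] := by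
  induction k generalizing F w with
  | zero => rw [List.length_eq_zero_iff.1 h]; rfl
  | succ k ih =>
    cases w with
    | nil => simp at h
    | cons a w => exact ih _ w (by simpa using h)
theorem pr_sp_full (k : ℕ) (F : List Sy → List Sy → R) (x : Tt k) : pr k (sp k F) x = pr k (fun w => F w []) x :=
  pr_congr _ _ _ _ fun w hw => sp_full k F w hw
theorem IsR.succN {n E : ℕ} {X : ℕ} {S : Sty (Tt n) (Tt (n+1))} {ad : Tt (n+1) → Tt (n+1) → Tt (n+1)}
    {wc wn : Bool → ℕ → Tt (n+1) → Tt (n+1)} {Gf : List Sy → R} {f : Tt (n+1) → ℕ → ℕ}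
    (hS : IsS R n n S) (ha : IsA R (n+1) ad) (hc : IsW R (n+1) wtC wc) (hn : IsW R (n+1) (wtN (X : R)) wn)
    (hf : IsR R (n+1) Gf f) : IsR R (n+1) (GN (X : R) (n+1) E Gf) (rN E X (Zt n) S ad wc wn f) := by
  intro v r
  obtain ⟨a0, a1, a2, h1, h2⟩ := br_eq (R := R) v
  have e1 : rN E X (Zt n) S ad wc wn f v r = S a0 a1 a2 a0 0 fun a c r0 =>
    fc (fun r' => f (wn true 0 (ad a (wc true 0 c))) r') (Nat.add r (Nat.mul r0 (Nat.pow X E))) := h1 _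
  rw [e1]
  obtain ⟨a, b, r0, h3, h4⟩ := hS a0 a1 a2 a0 0 fun a c r0 =>
    fc (fun r' => f (wn true 0 (ad a (wc true 0 c))) r') (Nat.add r (Nat.mul r0 (Nat.pow X E)))
  rw [h3]
  change ((f (wn true 0 (ad a (wc true 0 b))) (r + r0 * X ^ E) : ℕ) : R) = _
  have h5 := h4 (kN (X : R) Gf) ((X : R) ^ E) (fun p => rfl)
  rw [hf, hn, ha, hc, h2]
  simp only [QS, pr_sp_full, kN, Nat.cast_zero, zero_mul, add_zero] at h5
  simp only [GN, SF]
  push_cast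
  rw [add_assoc, add_comm ((r0 : R) * _), h5]
  simp only [pr_add]
  ring
theorem IsR.succM {n E : ℕ} {X : ℕ} {S : Sty (Tt n) (Tt (n+1))} {ad : Tt n → Tt n → Tt n}
    {we wm : Bool → ℕ → Tt (n+1) → Tt (n+1)} {Gf : List Sy → R} {f : Tt (n+1) → ℕ → ℕ}
    (hS : IsS R n n S) (ha : IsA R n ad) (hc : IsW R (n+1) wtE we) (hn : IsW R (n+1) (wtM (X : R)) wm)
    (hf : IsR R (n+1) Gf f) : IsR R (n+1) (GM (X : R) (n+1) E Gf) (rM E X (Zt n) ad S we wm f) := by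
  intro v r
  obtain ⟨a0, a1, a2, h1, h2⟩ := br_eq (R := R) v
  obtain ⟨c0, c1, c2, h1', h2'⟩ := br_eq (R := R) (we true 0 v)
  have e1 : rM E X (Zt n) ad S we wm f v r = S (ad a0 c1) a1 (ad a2 c0) a0 0 fun a c r0 =>
    fc (fun r' => f (wm true 0 a) r') (Nat.add r (Nat.mul r0 (Nat.pow X E))) := (h1 _).trans (h1' _)
  rw [e1]
  obtain ⟨a, b, r0, h3, h4⟩ := hS (ad a0 c1) a1 (ad a2 c0) a0 0 fun a c r0 =>
    fc (fun r' => f (wm true 0 a) r') (Nat.add r (Nat.mul r0 (Nat.pow X E)))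
  rw [h3]
  change ((f (wm true 0 a) (r + r0 * X ^ E) : ℕ) : R) = _
  have h5 := h4 (kM (X : R) Gf) ((X : R) ^ E) (fun p => rfl)
  have h6 : pr (n+1) (GM (X : R) (n+1) E Gf) v = pr (n+1) (fun w => SF (kM (X : R) Gf) ((X : R) ^ E) (n+1) [] e w) v
      + pr (n+1) (fun w => SF (kM (X : R) Gf) ((X : R) ^ E) (n+1) [] u w) (we true 0 v) := by
    rw [hc, ← pr_add]; rfl
  rw [hf, hn, h6, h2, h2']
  simp only [QS, pr_sp_full, kM, Nat.cast_zero, zero_mul, add_zero, pr_zero, ha _] at h5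
  simp only [SF, fl, oz, pr_zero, add_zero]
  push_cast
  rw [add_assoc, add_comm ((r0 : R) * _), h5]
  simp only [pr_add]
  ring
end rows
end G
end

set_option linter.all false
noncomputable section
namespace G
open Sy
/-- end-of-row rule -/
def dK (N : Bool) (Dr : List Sy → ℕ) (p : List Sy) : Sy → ℕ
  | e => Dr p
  | u => cond N (cond (ec true p) 0 (Dr p * 4)) 0
  | d => 0
def allB (rs : List (List Bool)) : Bool := rs.all (fun r => r.all id)
def FAn (w : List Sy) : ℕ := cond (one w) 1 0 + 4 * cond (udw w) 1 0
/-- start-of-row rule -/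
def stR (N v0 : Bool) (w : List Sy) (f : Sy → ℕ) : ℕ :=
  cond N (cond v0 (f e) 0) (cond (v0 == ec true w) (f e) (cond (ec true w) (f u * 4) 0))
/-- deterministic weight of the remaining rows (each row in scanning order) -/
def DD : Bool → List (List Bool) → List Sy → ℕ
  | _, [], w => FAn w
  | _, [] :: _, _ => 0
  | N, (v0 :: vs) :: rs, w => stR N v0 w
      (fun l => RW (dK N (DD (!N) rs)) (cond (allB rs) 1 0) v0 vs [] l w)
section tsum
variable {M : Type} [AddCommMonoid M]
def tsum : ℕ → (List (List Bool) → M) → M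
  | 0, g => g []
  | k + 1, g => bsum 12 (fun r => tsum k (fun rs => g (r :: rs)))
theorem tsum_hom {N : Type} [AddCommMonoid N] (φ : M → N) (hφ : ∀ x y, φ (x + y) = φ x + φ y) (k : ℕ)
    (g : List (List Bool) → M) : φ (tsum k g) = tsum k (fun w => φ (g w)) := by
  induction k generalizing g with
  | zero => rfl
  | succ k ih => simp only [tsum, bsum_hom φ hφ, ih]
theorem tsum_zero (k : ℕ) : tsum k (fun _ => (0 : M)) = 0 := by
  induction k with
  | zero => rfl
  | succ k ih => simp only [tsum, ih, bsum_zero]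
theorem tsum_all (k : ℕ) (z : M) : tsum k (fun rs => cond (allB rs) z 0) = z := by
  induction k with
  | zero => rfl
  | succ k ih =>
    simp only [tsum, allB, List.all_cons]
    have : ∀ r : List Bool, tsum k (fun rs => cond (r.all id && rs.all (fun r => r.all id)) z 0) = cond (r.all id) z 0 := by
      intro r
      cases r.all id
      · simp [tsum_zero]
      · simpa [allB] using ih
    simp only [this, bsum_true]
theorem tsum_congr (k : ℕ) (g g' : List (List Bool) → M)
    (h : ∀ w, w.length = k → (∀ r ∈ w, r.length = 12) → g w = g' w) : tsum k g = tsum k g' := by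
  induction k generalizing g g' with
  | zero => exact h [] rfl (by simp)
  | succ k ih =>
    simp only [tsum]
    apply bsum_congr
    intro r hr
    apply ih
    intro w hw hw'
    exact h _ (by simp [hw]) (by simpa [hr] using hw')
end tsum
def cntc (rs : List (List Bool)) : ℕ := (rs.map cnt1).sum
theorem allB_cnt (rs : List (List Bool)) (h : allB rs = true) (h' : ∀ r ∈ rs, r.length = 12) : cntc rs = 12 * rs.length := by
  induction rs with
  | nil => rfl
  | cons r rs ih =>
    simp only [allB, List.all_cons, Bool.and_eq_true] at h
    have := ih h.2 (fun r hr => h' r (by simp [hr]))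
    simp only [cntc, List.map_cons, List.sum_cons, List.length_cons] at *
    rw [this, cnt1_all r h.1, h' r (by simp)]; ring
section main
variable {R : Type} [CommSemiring R]
theorem RW_cast (K : List Sy → Sy → ℕ) (Z : ℕ) (q : Bool) (vs : List Bool) (p : List Sy) (l : Sy) (s : List Sy) :
    ((RW K Z q vs p l s : ℕ) : R) = RW (fun p l => (K p l : R)) (Z : R) q vs p l s := by
  induction vs generalizing q p l s with
  | nil => rfl
  | cons v vs ih =>
    cases s with
    | nil => simp [RW]
    | cons a s =>
      simp only [RW]
      cases tr p l a s (v != q) with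
      | dead => simp [rs]
      | fin => simp only [rs]; cases ((v :: vs).all id) <;> simp
      | nx p' l' s' => simp only [rs, ih]
theorem RW_mul (K : List Sy → Sy → R) (Z x : R) (q : Bool) (vs : List Bool) (p : List Sy) (l : Sy) (s : List Sy) :
    RW (fun p l => K p l * x) (Z * x) q vs p l s = RW K Z q vs p l s * x := by
  induction vs generalizing q p l s with
  | nil => rfl
  | cons v vs ih =>
    cases s with
    | nil => simp [RW]
    | cons a s =>
      simp only [RW]
      cases tr p l a s (v != q) with
      | dead => simp [rs]
      | fin => simp only [rs]; cases ((v :: vs).all id) <;> simp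
      | nx p' l' s' => simp only [rs, ih]
theorem RW_tsum (k : ℕ) (K : List (List Bool) → List Sy → Sy → R) (Z : List (List Bool) → R) (q : Bool) (vs : List Bool)
    (p : List Sy) (l : Sy) (s : List Sy) :
    tsum k (fun rs => RW (K rs) (Z rs) q vs p l s) = RW (fun p l => tsum k (fun rs => K rs p l)) (tsum k Z) q vs p l s := by
  have h := tsum_hom (M := (List Sy → Sy → R) × R) (fun x => RW x.1 x.2 q vs p l s)
    (fun x y => RW_add _ _ _ _ _ _ _ _ _) k (fun rs => (K rs, Z rs))
  rw [← h]
  have h2 := tsum_hom (M := (List Sy → Sy → R) × R) (fun x => x.2) (fun x y => rfl) k (fun rs => (K rs, Z rs))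
  have h1 : (tsum k (fun rs => (K rs, Z rs))).1 = fun p l => tsum k (fun rs => K rs p l) := by
    funext p l
    exact tsum_hom (M := (List Sy → Sy → R) × R) (fun x => x.1 p l) (fun x y => rfl) k (fun rs => (K rs, Z rs))
  simp only [h1]
  congr 1
def GR (X : R) : ℕ → Bool → List Sy → R
  | 0, _ => FA
  | k + 1, true => GN X 11 (12 * (k + 1)) (GR X k false)
  | k + 1, false => GM X 11 (12 * (k + 1)) (GR X k true)
theorem ec_ec (b : Bool) (w : List Sy) : ec (ec b w) w = b := by
  induction w generalizing b with
  | nil => rfl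
  | cons a w ih => cases a <;> simp only [ec, ih, ec_not, Bool.not_not]
/-- sum of `RW` over one row and the remaining ones -/
theorem rowsum (X : R) (N : Bool) (k : ℕ) (Gk : List Sy → R) (l : Sy) (v0 : Bool) (w : List Sy) (hw : w.length = 11)
    (hl : cond N (v0 = true) (ec v0 (l :: w) = true))
    (hG : ∀ p, p.length = 11 → tsum k (fun rs => (DD (!N) rs p : R) * X ^ cntc rs) = Gk p) :
    bsum 11 (fun vs => tsum k (fun rs => ((RW (dK N (DD (!N) rs)) (cond (allB rs) 1 0) v0 vs [] l w : ℕ) : R)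
        * X ^ cntc ((v0 :: vs) :: rs)))
      = SF (cond N (kN X Gk) (kM X Gk)) (X ^ (12 * (k+1))) 11 [] l w := by
  have hK : ∀ p, p.length = 11 → ∀ l, tsum k (fun rs => ((dK N (DD (!N) rs) p l : ℕ) : R) * X ^ cntc rs)
      = match l with
        | e => Gk p
        | u => cond N (Gk p * wtC true 0 p) 0
        | d => 0 := by
    intro p hp l
    cases l with
    | e => exact hG p hp
    | u =>
      cases N with
      | false => simp [dK, tsum_zero]
      | true =>
        simp only [dK, cond_true, wtC]
        cases ec true p with
        | true => simp [tsum_zero]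
        | false =>
          simp only [cond_false]
          rw [← hG p hp, tsum_hom (fun x : R => x * 4) (fun x y => by ring)]
          congr 1; funext rs; push_cast; ring
    | d => simp [dK, tsum_zero]
  have hZ : tsum k (fun rs => ((cond (allB rs) 1 0 : ℕ) : R) * X ^ cntc rs) = X ^ (12 * k) := by
    rw [← tsum_all k (X ^ (12 * k))]
    apply tsum_congr
    intro rs h1 h2
    cases h : allB rs
    · simp
    · rw [allB_cnt rs h h2, h1]; simp
  have e1 : ∀ vs, tsum k (fun rs => ((RW (dK N (DD (!N) rs)) (cond (allB rs) 1 0) v0 vs [] l w : ℕ) : R)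
        * X ^ cntc ((v0 :: vs) :: rs)) = RW (fun p l => tsum k (fun rs => ((dK N (DD (!N) rs) p l : ℕ) : R) * X ^ cntc rs))
          (X ^ (12 * k)) v0 vs [] l w * X ^ (blk v0 [] + cnt1 vs) := by
    intro vs
    rw [← hZ, ← RW_tsum, tsum_hom (fun x : R => x * X ^ (blk v0 [] + cnt1 vs)) (fun x y => by ring)]
    congr 1
    funext rs
    rw [RW_cast, RW_mul, mul_assoc, ← pow_add]
    congr 2
    simp [cntc, cnt1, blk]; ring
  simp only [e1]
  rw [show X ^ (12 * (k+1)) = X ^ (12 * k) * X ^ (11 + 1) by ring]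
  refine row_lemma X 11 (fun q p l s => cond N (ec q p = true) (ec q (l :: s) = true)) _ _ _ ?_ ?_ ?_ 11 v0 [] l w ?_ hw rfl
  · intro q v p l a s p' l' s' h1 h2
    obtain ⟨-, -, -, h3, h4⟩ := tr_inv _ _ _ _ _ _ _ _ _ h2
    cases N
    · exact h4.trans h1
    · exact h3.trans h1
  · intro q p s h1 h2 h3
    cases N
    · simpa [ec, alle_ec _ _ h3] using h1
    · simpa [alle_ec _ _ h2] using h1
  · intro q p l h1 h2
    simp only [hK p h2 l]
    cases N with
    | false =>
      cases l with
      | e =>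
        have : q = true := h1
        subst this
        simp [kM, wtM]
      | u => simp [kM]
      | d => simp [kM]
    | true =>
      have h3 : X ^ blk q p = wtN X true 0 p := by
        have h1 : ec q p = true := h1
        cases q with
        | true => simp [wtN, h1]
        | false =>
          have h4 := ec_not true p
          simp only [Bool.not_true, h1] at h4
          have h5 : ec true p = false := by simpa using h4.symm
          have h6 := blk_not true p
          simp only [wtN, h5, cond_false]
          congr 1
          simp only [Bool.not_true] at h6
          omega
      rw [h3]
      cases l with
      | e => rfl
      | u => simp only [cond_true, kN]; ring
      | d => simp [kN]
  · cases N
    · exact hl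
    · exact hl
theorem GR_eq (X : R) (k : ℕ) (N : Bool) (w : List Sy) (hw : w.length = 11) :
    tsum k (fun rs => (DD N rs w : R) * X ^ cntc rs) = GR X k N w := by
  induction k generalizing N w with
  | zero => simp [tsum, DD, cntc, GR, FAn, FA]; cases one w <;> cases udw w <;> simp
  | succ k ih =>
    change bsum 11 _ + bsum 11 _ = _
    cases N with
    | true =>
      have h := rowsum X true k (GR X k false) e true w hw rfl (fun p hp => ih _ p hp)
      simp only [DD, stR, cond_true, cond_false, Nat.cast_zero, zero_mul, tsum_zero, bsum_zero, add_zero]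
      exact h
    | false =>
      have h0 : ∀ v0 l, ec v0 (l :: w) = true → _ :=
        fun v0 l hl => rowsum X false k (GR X k true) l v0 w hw hl (fun p hp => ih _ p hp)
      have hx : ∀ v0, bsum 11 (fun vs => tsum k (fun rs => (((RW (dK false (DD true rs)) (cond (allB rs) 1 0) v0 vs [] u w * 4 : ℕ) : R)
        * X ^ cntc ((v0 :: vs) :: rs)))) = bsum 11 (fun vs => tsum k (fun rs => ((RW (dK false (DD true rs)) (cond (allB rs) 1 0) v0 vs [] u w : ℕ) : R)
        * X ^ cntc ((v0 :: vs) :: rs))) * 4 := by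
        intro v0
        rw [bsum_hom (fun x : R => x * 4) (fun x y => by ring)]
        congr 1; funext vs
        rw [tsum_hom (fun x : R => x * 4) (fun x y => by ring)]
        congr 1; funext rs
        push_cast; ring
      have hee := ec_ec true w
      simp only [DD, stR, cond_false, Bool.not_false, GR, GM, wtE]
      cases hb : ec true w with
      | true =>
        simp only [beq_self_eq_true, cond_true, show (false == true) = false from rfl, cond_false]
        rw [hx]
        have h1 := h0 true e hb
        have h2 := h0 false u (by simpa [ec] using hb)
        simp only [Bool.not_false, cond_false] at h1 h2
        rw [h1, h2]
      | false =>
        rw [hb] at hee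
        simp only [beq_self_eq_true, cond_true, show (true == false) = false from rfl, cond_false, Nat.cast_zero, zero_mul,
          tsum_zero, bsum_zero, mul_zero, add_zero, zero_add]
        exact h0 false e hee
end main
end G
end

set_option linter.all false
noncomputable section
namespace G
open Sy
def T0 : Type := L
def A0 : T0 → T0 → T0 := ladd
def Z0 : T0 := L.n
def g0 : T0 → ℕ := lg
def M0 : T0 → T0 → T0 → O T0 := lmk
def WM0 : Bool → ℕ → T0 → T0 := wm 12 X MM
def WN0 : Bool → ℕ → T0 → T0 := wn 12 X MM
def WC0 : Bool → ℕ → T0 → T0 := wc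
def WE0 : Bool → ℕ → T0 → T0 := we
def T1 : Type := O T0
def A1 : T1 → T1 → T1 := oadd A0
def Z1 : T1 := O.n
def g1 : T1 → ℕ := og g0
def M1 : T1 → T1 → T1 → O T1 := omk
def WM1 : Bool → ℕ → T1 → T1 := wgt M0 WM0
def WN1 : Bool → ℕ → T1 → T1 := wgt M0 WN0
def WC1 : Bool → ℕ → T1 → T1 := wpr M0 WC0
def WE1 : Bool → ℕ → T1 → T1 := wpr M0 WE0
def T2 : Type := O T1
def A2 : T2 → T2 → T2 := oadd A1
def Z2 : T2 := O.n
def g2 : T2 → ℕ := og g1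
def M2 : T2 → T2 → T2 → O T2 := omk
def WM2 : Bool → ℕ → T2 → T2 := wgt M1 WM1
def WN2 : Bool → ℕ → T2 → T2 := wgt M1 WN1
def WC2 : Bool → ℕ → T2 → T2 := wpr M1 WC1
def WE2 : Bool → ℕ → T2 → T2 := wpr M1 WE1
def T3 : Type := O T2
def A3 : T3 → T3 → T3 := oadd A2
def Z3 : T3 := O.n
def g3 : T3 → ℕ := og g2
def M3 : T3 → T3 → T3 → O T3 := omk
def WM3 : Bool → ℕ → T3 → T3 := wgt M2 WM2
def WN3 : Bool → ℕ → T3 → T3 := wgt M2 WN2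
def WC3 : Bool → ℕ → T3 → T3 := wpr M2 WC2
def WE3 : Bool → ℕ → T3 → T3 := wpr M2 WE2
def T4 : Type := O T3
def A4 : T4 → T4 → T4 := oadd A3
def Z4 : T4 := O.n
def g4 : T4 → ℕ := og g3
def M4 : T4 → T4 → T4 → O T4 := omk
def WM4 : Bool → ℕ → T4 → T4 := wgt M3 WM3
def WN4 : Bool → ℕ → T4 → T4 := wgt M3 WN3
def WC4 : Bool → ℕ → T4 → T4 := wpr M3 WC3
def WE4 : Bool → ℕ → T4 → T4 := wpr M3 WE3
def T5 : Type := O T4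
def A5 : T5 → T5 → T5 := oadd A4
def Z5 : T5 := O.n
def g5 : T5 → ℕ := og g4
def M5 : T5 → T5 → T5 → O T5 := omk
def WM5 : Bool → ℕ → T5 → T5 := wgt M4 WM4
def WN5 : Bool → ℕ → T5 → T5 := wgt M4 WN4
def WC5 : Bool → ℕ → T5 → T5 := wpr M4 WC4
def WE5 : Bool → ℕ → T5 → T5 := wpr M4 WE4
def T6 : Type := O T5
def A6 : T6 → T6 → T6 := oadd A5
def Z6 : T6 := O.n
def g6 : T6 → ℕ := og g5
def M6 : T6 → T6 → T6 → O T6 := omk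
def WM6 : Bool → ℕ → T6 → T6 := wgt M5 WM5
def WN6 : Bool → ℕ → T6 → T6 := wgt M5 WN5
def WC6 : Bool → ℕ → T6 → T6 := wpr M5 WC5
def WE6 : Bool → ℕ → T6 → T6 := wpr M5 WE5
def T7 : Type := O T6
def A7 : T7 → T7 → T7 := oadd A6
def Z7 : T7 := O.n
def g7 : T7 → ℕ := og g6
def M7 : T7 → T7 → T7 → O T7 := omk
def WM7 : Bool → ℕ → T7 → T7 := wgt M6 WM6
def WN7 : Bool → ℕ → T7 → T7 := wgt M6 WN6
def WC7 : Bool → ℕ → T7 → T7 := wpr M6 WC6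
def WE7 : Bool → ℕ → T7 → T7 := wpr M6 WE6
def T8 : Type := O T7
def A8 : T8 → T8 → T8 := oadd A7
def Z8 : T8 := O.n
def g8 : T8 → ℕ := og g7
def M8 : T8 → T8 → T8 → O T8 := omk
def WM8 : Bool → ℕ → T8 → T8 := wgt M7 WM7
def WN8 : Bool → ℕ → T8 → T8 := wgt M7 WN7
def WC8 : Bool → ℕ → T8 → T8 := wpr M7 WC7
def WE8 : Bool → ℕ → T8 → T8 := wpr M7 WE7
def T9 : Type := O T8
def A9 : T9 → T9 → T9 := oadd A8
def Z9 : T9 := O.n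
def g9 : T9 → ℕ := og g8
def M9 : T9 → T9 → T9 → O T9 := omk
def WM9 : Bool → ℕ → T9 → T9 := wgt M8 WM8
def WN9 : Bool → ℕ → T9 → T9 := wgt M8 WN8
def WC9 : Bool → ℕ → T9 → T9 := wpr M8 WC8
def WE9 : Bool → ℕ → T9 → T9 := wpr M8 WE8
def T10 : Type := O T9
def A10 : T10 → T10 → T10 := oadd A9
def Z10 : T10 := O.n
def g10 : T10 → ℕ := og g9
def M10 : T10 → T10 → T10 → O T10 := omk
def WM10 : Bool → ℕ → T10 → T10 := wgt M9 WM9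
def WN10 : Bool → ℕ → T10 → T10 := wgt M9 WN9
def WC10 : Bool → ℕ → T10 → T10 := wpr M9 WC9
def WE10 : Bool → ℕ → T10 → T10 := wpr M9 WE9
def T11 : Type := O T10
def A11 : T11 → T11 → T11 := oadd A10
def Z11 : T11 := O.n
def g11 : T11 → ℕ := og g10
def WM11 : Bool → ℕ → T11 → T11 := wgt M10 WM10
def WN11 : Bool → ℕ → T11 → T11 := wgt M10 WN10
def WC11 : Bool → ℕ → T11 → T11 := wpr M10 WC10
def WE11 : Bool → ℕ → T11 → T11 := wpr M10 WE10
def J0_0 : T0 → T0 → T0 → T1 := M0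
def F0_0 : ℕ → T0 → T0 := fun _ _ => Z0
def J0_1 : T1 → T1 → T1 → T2 := jn Z0 J0_0
def F0_1 : ℕ → T1 → T1 := fo Z0 A0 M0 F0_0
def J0_2 : T2 → T2 → T2 → T3 := jn Z1 J0_1
def F0_2 : ℕ → T2 → T2 := fo Z1 A1 M1 F0_1
def J0_3 : T3 → T3 → T3 → T4 := jn Z2 J0_2
def F0_3 : ℕ → T3 → T3 := fo Z2 A2 M2 F0_2
def J0_4 : T4 → T4 → T4 → T5 := jn Z3 J0_3
def F0_4 : ℕ → T4 → T4 := fo Z3 A3 M3 F0_3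
def J0_5 : T5 → T5 → T5 → T6 := jn Z4 J0_4
def F0_5 : ℕ → T5 → T5 := fo Z4 A4 M4 F0_4
def J0_6 : T6 → T6 → T6 → T7 := jn Z5 J0_5
def F0_6 : ℕ → T6 → T6 := fo Z5 A5 M5 F0_5
def J0_7 : T7 → T7 → T7 → T8 := jn Z6 J0_6
def F0_7 : ℕ → T7 → T7 := fo Z6 A6 M6 F0_6
def J0_8 : T8 → T8 → T8 → T9 := jn Z7 J0_7
def F0_8 : ℕ → T8 → T8 := fo Z7 A7 M7 F0_7
def J0_9 : T9 → T9 → T9 → T10 := jn Z8 J0_8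
def F0_9 : ℕ → T9 → T9 := fo Z8 A8 M8 F0_8
def J0_10 : T10 → T10 → T10 → T11 := jn Z9 J0_9
def F0_10 : ℕ → T10 → T10 := fo Z9 A9 M9 F0_9
def J1_0 : T1 → T1 → T1 → T2 := M1
def F1_0 : ℕ → T1 → T1 := fun _ _ => Z1
def J1_1 : T2 → T2 → T2 → T3 := jn Z1 J1_0
def F1_1 : ℕ → T2 → T2 := fo Z1 A1 M1 F1_0
def J1_2 : T3 → T3 → T3 → T4 := jn Z2 J1_1
def F1_2 : ℕ → T3 → T3 := fo Z2 A2 M2 F1_1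
def J1_3 : T4 → T4 → T4 → T5 := jn Z3 J1_2
def F1_3 : ℕ → T4 → T4 := fo Z3 A3 M3 F1_2
def J1_4 : T5 → T5 → T5 → T6 := jn Z4 J1_3
def F1_4 : ℕ → T5 → T5 := fo Z4 A4 M4 F1_3
def J1_5 : T6 → T6 → T6 → T7 := jn Z5 J1_4
def F1_5 : ℕ → T6 → T6 := fo Z5 A5 M5 F1_4
def J1_6 : T7 → T7 → T7 → T8 := jn Z6 J1_5
def F1_6 : ℕ → T7 → T7 := fo Z6 A6 M6 F1_5
def J1_7 : T8 → T8 → T8 → T9 := jn Z7 J1_6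
def F1_7 : ℕ → T8 → T8 := fo Z7 A7 M7 F1_6
def J1_8 : T9 → T9 → T9 → T10 := jn Z8 J1_7
def F1_8 : ℕ → T9 → T9 := fo Z8 A8 M8 F1_7
def J1_9 : T10 → T10 → T10 → T11 := jn Z9 J1_8
def F1_9 : ℕ → T10 → T10 := fo Z9 A9 M9 F1_8
def J2_0 : T2 → T2 → T2 → T3 := M2
def F2_0 : ℕ → T2 → T2 := fun _ _ => Z2
def J2_1 : T3 → T3 → T3 → T4 := jn Z2 J2_0
def F2_1 : ℕ → T3 → T3 := fo Z2 A2 M2 F2_0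
def J2_2 : T4 → T4 → T4 → T5 := jn Z3 J2_1
def F2_2 : ℕ → T4 → T4 := fo Z3 A3 M3 F2_1
def J2_3 : T5 → T5 → T5 → T6 := jn Z4 J2_2
def F2_3 : ℕ → T5 → T5 := fo Z4 A4 M4 F2_2
def J2_4 : T6 → T6 → T6 → T7 := jn Z5 J2_3
def F2_4 : ℕ → T6 → T6 := fo Z5 A5 M5 F2_3
def J2_5 : T7 → T7 → T7 → T8 := jn Z6 J2_4
def F2_5 : ℕ → T7 → T7 := fo Z6 A6 M6 F2_4
def J2_6 : T8 → T8 → T8 → T9 := jn Z7 J2_5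
def F2_6 : ℕ → T8 → T8 := fo Z7 A7 M7 F2_5
def J2_7 : T9 → T9 → T9 → T10 := jn Z8 J2_6
def F2_7 : ℕ → T9 → T9 := fo Z8 A8 M8 F2_6
def J2_8 : T10 → T10 → T10 → T11 := jn Z9 J2_7
def F2_8 : ℕ → T10 → T10 := fo Z9 A9 M9 F2_7
def J3_0 : T3 → T3 → T3 → T4 := M3
def F3_0 : ℕ → T3 → T3 := fun _ _ => Z3
def J3_1 : T4 → T4 → T4 → T5 := jn Z3 J3_0
def F3_1 : ℕ → T4 → T4 := fo Z3 A3 M3 F3_0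
def J3_2 : T5 → T5 → T5 → T6 := jn Z4 J3_1
def F3_2 : ℕ → T5 → T5 := fo Z4 A4 M4 F3_1
def J3_3 : T6 → T6 → T6 → T7 := jn Z5 J3_2
def F3_3 : ℕ → T6 → T6 := fo Z5 A5 M5 F3_2
def J3_4 : T7 → T7 → T7 → T8 := jn Z6 J3_3
def F3_4 : ℕ → T7 → T7 := fo Z6 A6 M6 F3_3
def J3_5 : T8 → T8 → T8 → T9 := jn Z7 J3_4
def F3_5 : ℕ → T8 → T8 := fo Z7 A7 M7 F3_4
def J3_6 : T9 → T9 → T9 → T10 := jn Z8 J3_5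
def F3_6 : ℕ → T9 → T9 := fo Z8 A8 M8 F3_5
def J3_7 : T10 → T10 → T10 → T11 := jn Z9 J3_6
def F3_7 : ℕ → T10 → T10 := fo Z9 A9 M9 F3_6
def J4_0 : T4 → T4 → T4 → T5 := M4
def F4_0 : ℕ → T4 → T4 := fun _ _ => Z4
def J4_1 : T5 → T5 → T5 → T6 := jn Z4 J4_0
def F4_1 : ℕ → T5 → T5 := fo Z4 A4 M4 F4_0
def J4_2 : T6 → T6 → T6 → T7 := jn Z5 J4_1
def F4_2 : ℕ → T6 → T6 := fo Z5 A5 M5 F4_1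
def J4_3 : T7 → T7 → T7 → T8 := jn Z6 J4_2
def F4_3 : ℕ → T7 → T7 := fo Z6 A6 M6 F4_2
def J4_4 : T8 → T8 → T8 → T9 := jn Z7 J4_3
def F4_4 : ℕ → T8 → T8 := fo Z7 A7 M7 F4_3
def J4_5 : T9 → T9 → T9 → T10 := jn Z8 J4_4
def F4_5 : ℕ → T9 → T9 := fo Z8 A8 M8 F4_4
def J4_6 : T10 → T10 → T10 → T11 := jn Z9 J4_5
def F4_6 : ℕ → T10 → T10 := fo Z9 A9 M9 F4_5
def J5_0 : T5 → T5 → T5 → T6 := M5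
def F5_0 : ℕ → T5 → T5 := fun _ _ => Z5
def J5_1 : T6 → T6 → T6 → T7 := jn Z5 J5_0
def F5_1 : ℕ → T6 → T6 := fo Z5 A5 M5 F5_0
def J5_2 : T7 → T7 → T7 → T8 := jn Z6 J5_1
def F5_2 : ℕ → T7 → T7 := fo Z6 A6 M6 F5_1
def J5_3 : T8 → T8 → T8 → T9 := jn Z7 J5_2
def F5_3 : ℕ → T8 → T8 := fo Z7 A7 M7 F5_2
def J5_4 : T9 → T9 → T9 → T10 := jn Z8 J5_3
def F5_4 : ℕ → T9 → T9 := fo Z8 A8 M8 F5_3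
def J5_5 : T10 → T10 → T10 → T11 := jn Z9 J5_4
def F5_5 : ℕ → T10 → T10 := fo Z9 A9 M9 F5_4
def J6_0 : T6 → T6 → T6 → T7 := M6
def F6_0 : ℕ → T6 → T6 := fun _ _ => Z6
def J6_1 : T7 → T7 → T7 → T8 := jn Z6 J6_0
def F6_1 : ℕ → T7 → T7 := fo Z6 A6 M6 F6_0
def J6_2 : T8 → T8 → T8 → T9 := jn Z7 J6_1
def F6_2 : ℕ → T8 → T8 := fo Z7 A7 M7 F6_1
def J6_3 : T9 → T9 → T9 → T10 := jn Z8 J6_2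
def F6_3 : ℕ → T9 → T9 := fo Z8 A8 M8 F6_2
def J6_4 : T10 → T10 → T10 → T11 := jn Z9 J6_3
def F6_4 : ℕ → T10 → T10 := fo Z9 A9 M9 F6_3
def J7_0 : T7 → T7 → T7 → T8 := M7
def F7_0 : ℕ → T7 → T7 := fun _ _ => Z7
def J7_1 : T8 → T8 → T8 → T9 := jn Z7 J7_0
def F7_1 : ℕ → T8 → T8 := fo Z7 A7 M7 F7_0
def J7_2 : T9 → T9 → T9 → T10 := jn Z8 J7_1
def F7_2 : ℕ → T9 → T9 := fo Z8 A8 M8 F7_1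
def J7_3 : T10 → T10 → T10 → T11 := jn Z9 J7_2
def F7_3 : ℕ → T10 → T10 := fo Z9 A9 M9 F7_2
def J8_0 : T8 → T8 → T8 → T9 := M8
def F8_0 : ℕ → T8 → T8 := fun _ _ => Z8
def J8_1 : T9 → T9 → T9 → T10 := jn Z8 J8_0
def F8_1 : ℕ → T9 → T9 := fo Z8 A8 M8 F8_0
def J8_2 : T10 → T10 → T10 → T11 := jn Z9 J8_1
def F8_2 : ℕ → T10 → T10 := fo Z9 A9 M9 F8_1
def J9_0 : T9 → T9 → T9 → T10 := M9
def F9_0 : ℕ → T9 → T9 := fun _ _ => Z9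
def J9_1 : T10 → T10 → T10 → T11 := jn Z9 J9_0
def F9_1 : ℕ → T10 → T10 := fo Z9 A9 M9 F9_0
def J10_0 : T10 → T10 → T10 → T11 := M10
def F10_0 : ℕ → T10 → T10 := fun _ _ => Z10
def N0_0 : T0 → T0 := F0_0 0
def N0_1 : T1 → T1 := mi M0 N0_0
def N0_2 : T2 → T2 := mi M1 N0_1
def N0_3 : T3 → T3 := mi M2 N0_2
def N0_4 : T4 → T4 := mi M3 N0_3
def N0_5 : T5 → T5 := mi M4 N0_4
def N0_6 : T6 → T6 := mi M5 N0_5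
def N0_7 : T7 → T7 := mi M6 N0_6
def N0_8 : T8 → T8 := mi M7 N0_7
def N0_9 : T9 → T9 := mi M8 N0_8
def N0_10 : T10 → T10 := mi M9 N0_9
def N1_0 : T1 → T1 := F0_1 0
def N1_1 : T2 → T2 := mi M1 N1_0
def N1_2 : T3 → T3 := mi M2 N1_1
def N1_3 : T4 → T4 := mi M3 N1_2
def N1_4 : T5 → T5 := mi M4 N1_3
def N1_5 : T6 → T6 := mi M5 N1_4
def N1_6 : T7 → T7 := mi M6 N1_5
def N1_7 : T8 → T8 := mi M7 N1_6
def N1_8 : T9 → T9 := mi M8 N1_7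
def N1_9 : T10 → T10 := mi M9 N1_8
def N2_0 : T2 → T2 := F0_2 0
def N2_1 : T3 → T3 := mi M2 N2_0
def N2_2 : T4 → T4 := mi M3 N2_1
def N2_3 : T5 → T5 := mi M4 N2_2
def N2_4 : T6 → T6 := mi M5 N2_3
def N2_5 : T7 → T7 := mi M6 N2_4
def N2_6 : T8 → T8 := mi M7 N2_5
def N2_7 : T9 → T9 := mi M8 N2_6
def N2_8 : T10 → T10 := mi M9 N2_7
def N3_0 : T3 → T3 := F0_3 0
def N3_1 : T4 → T4 := mi M3 N3_0
def N3_2 : T5 → T5 := mi M4 N3_1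
def N3_3 : T6 → T6 := mi M5 N3_2
def N3_4 : T7 → T7 := mi M6 N3_3
def N3_5 : T8 → T8 := mi M7 N3_4
def N3_6 : T9 → T9 := mi M8 N3_5
def N3_7 : T10 → T10 := mi M9 N3_6
def N4_0 : T4 → T4 := F0_4 0
def N4_1 : T5 → T5 := mi M4 N4_0
def N4_2 : T6 → T6 := mi M5 N4_1
def N4_3 : T7 → T7 := mi M6 N4_2
def N4_4 : T8 → T8 := mi M7 N4_3
def N4_5 : T9 → T9 := mi M8 N4_4
def N4_6 : T10 → T10 := mi M9 N4_5
def N5_0 : T5 → T5 := F0_5 0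
def N5_1 : T6 → T6 := mi M5 N5_0
def N5_2 : T7 → T7 := mi M6 N5_1
def N5_3 : T8 → T8 := mi M7 N5_2
def N5_4 : T9 → T9 := mi M8 N5_3
def N5_5 : T10 → T10 := mi M9 N5_4
def N6_0 : T6 → T6 := F0_6 0
def N6_1 : T7 → T7 := mi M6 N6_0
def N6_2 : T8 → T8 := mi M7 N6_1
def N6_3 : T9 → T9 := mi M8 N6_2
def N6_4 : T10 → T10 := mi M9 N6_3
def N7_0 : T7 → T7 := F0_7 0
def N7_1 : T8 → T8 := mi M7 N7_0
def N7_2 : T9 → T9 := mi M8 N7_1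
def N7_3 : T10 → T10 := mi M9 N7_2
def N8_0 : T8 → T8 := F0_8 0
def N8_1 : T9 → T9 := mi M8 N8_0
def N8_2 : T10 → T10 := mi M9 N8_1
def N9_0 : T9 → T9 := F0_9 0
def N9_1 : T10 → T10 := mi M9 N9_0
def N10_0 : T10 → T10 := F0_10 0
def S0 : Sty T10 T11 := fun x o c z r K => K (M10 x c o) (M10 c Z10 z) r
def S1 : Sty T10 T11 := sst Z9 A9 F9_0 N9_0 J9_0 g9 S0
def S2 : Sty T10 T11 := sst Z9 A9 F8_1 N8_1 J8_1 g9 S1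
def S3 : Sty T10 T11 := sst Z9 A9 F7_2 N7_2 J7_2 g9 S2
def S4 : Sty T10 T11 := sst Z9 A9 F6_3 N6_3 J6_3 g9 S3
def S5 : Sty T10 T11 := sst Z9 A9 F5_4 N5_4 J5_4 g9 S4
def S6 : Sty T10 T11 := sst Z9 A9 F4_5 N4_5 J4_5 g9 S5
def S7 : Sty T10 T11 := sst Z9 A9 F3_6 N3_6 J3_6 g9 S6
def S8 : Sty T10 T11 := sst Z9 A9 F2_7 N2_7 J2_7 g9 S7
def S9 : Sty T10 T11 := sst Z9 A9 F1_8 N1_8 J1_8 g9 S8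
def S10 : Sty T10 T11 := sst Z9 A9 F0_9 N0_9 J0_9 g9 S9
def I0 : T0 := L.v 1
def D0 : T0 := L.v 2
def K0 : T0 := L.n
def I1 : T1 := O.s I0 Z0 Z0
def D1 : T1 := O.s D0 Z0 Z0
def K1 : T1 := O.s K0 D0 Z0
def I2 : T2 := O.s I1 Z1 Z1
def D2 : T2 := O.s D1 Z1 Z1
def K2 : T2 := O.s K1 D1 Z1
def I3 : T3 := O.s I2 Z2 Z2
def D3 : T3 := O.s D2 Z2 Z2
def K3 : T3 := O.s K2 D2 Z2
def I4 : T4 := O.s I3 Z3 Z3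
def D4 : T4 := O.s D3 Z3 Z3
def K4 : T4 := O.s K3 D3 Z3
def I5 : T5 := O.s I4 Z4 Z4
def D5 : T5 := O.s D4 Z4 Z4
def K5 : T5 := O.s K4 D4 Z4
def I6 : T6 := O.s I5 Z5 Z5
def D6 : T6 := O.s D5 Z5 Z5
def K6 : T6 := O.s K5 D5 Z5
def I7 : T7 := O.s I6 Z6 Z6
def D7 : T7 := O.s D6 Z6 Z6
def K7 : T7 := O.s K6 D6 Z6
def I8 : T8 := O.s I7 Z7 Z7
def D8 : T8 := O.s D7 Z7 Z7
def K8 : T8 := O.s K7 D7 Z7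
def I9 : T9 := O.s I8 Z8 Z8
def D9 : T9 := O.s D8 Z8 Z8
def K9 : T9 := O.s K8 D8 Z8
def I10 : T10 := O.s I9 Z9 Z9
def D10 : T10 := O.s D9 Z9 Z9
def K10 : T10 := O.s K9 D9 Z9
def I11 : T11 := O.s I10 Z10 Z10
def D11 : T11 := O.s D10 Z10 Z10
def K11 : T11 := O.s K10 D10 Z10
def s0 : T0 → ℕ := fun _ => 0
def u0 : T0 → ℕ := fun _ => 0
def d0 : T0 → ℕ := fun _ => 0
def s1 : T1 → ℕ := os1 s0 g0
def u1 : T1 → ℕ := ou u0 g0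
def d1 : T1 → ℕ := od d0 u0
def s2 : T2 → ℕ := os1 s1 g1
def u2 : T2 → ℕ := ou u1 g1
def d2 : T2 → ℕ := od d1 u1
def s3 : T3 → ℕ := os1 s2 g2
def u3 : T3 → ℕ := ou u2 g2
def d3 : T3 → ℕ := od d2 u2
def s4 : T4 → ℕ := os1 s3 g3
def u4 : T4 → ℕ := ou u3 g3
def d4 : T4 → ℕ := od d3 u3
def s5 : T5 → ℕ := os1 s4 g4
def u5 : T5 → ℕ := ou u4 g4
def d5 : T5 → ℕ := od d4 u4
def s6 : T6 → ℕ := os1 s5 g5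
def u6 : T6 → ℕ := ou u5 g5
def d6 : T6 → ℕ := od d5 u5
def s7 : T7 → ℕ := os1 s6 g6
def u7 : T7 → ℕ := ou u6 g6
def d7 : T7 → ℕ := od d6 u6
def s8 : T8 → ℕ := os1 s7 g7
def u8 : T8 → ℕ := ou u7 g7
def d8 : T8 → ℕ := od d7 u7
def s9 : T9 → ℕ := os1 s8 g8
def u9 : T9 → ℕ := ou u8 g8
def d9 : T9 → ℕ := od d8 u8
def s10 : T10 → ℕ := os1 s9 g9
def u10 : T10 → ℕ := ou u9 g9
def d10 : T10 → ℕ := od d9 u9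
def s11 : T11 → ℕ := os1 s10 g10
def u11 : T11 → ℕ := ou u10 g10
def d11 : T11 → ℕ := od d10 u10
def R0 (v : T11) (r : ℕ) : ℕ := Nat.add r (Nat.add (s11 v) (Nat.mul 4 (d11 v)))
def R1 : T11 → ℕ → ℕ := rN 12 X Z10 S10 A11 WC11 WN11 R0
def R2 : T11 → ℕ → ℕ := rM 24 X Z10 A10 S10 WE11 WM11 R1
def R3 : T11 → ℕ → ℕ := rN 36 X Z10 S10 A11 WC11 WN11 R2
def R4 : T11 → ℕ → ℕ := rM 48 X Z10 A10 S10 WE11 WM11 R3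
def R5 : T11 → ℕ → ℕ := rN 60 X Z10 S10 A11 WC11 WN11 R4
def R6 : T11 → ℕ → ℕ := rM 72 X Z10 A10 S10 WE11 WM11 R5
def R7 : T11 → ℕ → ℕ := rN 84 X Z10 S10 A11 WC11 WN11 R6
def R8 : T11 → ℕ → ℕ := rM 96 X Z10 A10 S10 WE11 WM11 R7
def R9 : T11 → ℕ → ℕ := rN 108 X Z10 S10 A11 WC11 WN11 R8
def R10 : T11 → ℕ → ℕ := rM 120 X Z10 A10 S10 WE11 WM11 R9
def R11 : T11 → ℕ → ℕ := rN 132 X Z10 S10 A11 WC11 WN11 R10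
def val : ℕ := R11 (WM11 true 0 (A11 I11 K11)) 0
def cntf (x v : ℕ) : ℕ := Nat.mod (Nat.div v (Nat.pow x 72)) x
section inst
variable (R : Type) [CommSemiring R]
theorem hA0 : IsA R 0 A0 := IsA.zero
theorem hg0 : IsG R 0 g0 := IsG.zero
theorem hWM0 (h : (MM : R) = 0) : IsW R 0 (wtM (X : R)) WM0 := IsW.zeroM X MM h
theorem hWN0 (h : (MM : R) = 0) : IsW R 0 (wtN (X : R)) WN0 := IsW.zeroN X MM h
theorem hWC0 : IsW R 0 wtC WC0 := IsW.zeroC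
theorem hWE0 : IsW R 0 wtE WE0 := IsW.zeroE
theorem hA1 : IsA R 1 A1 := IsA.succ (hA0 R)
theorem hg1 : IsG R 1 g1 := IsG.succ (hg0 R)
theorem hWM1 (h : (MM : R) = 0) : IsW R 1 (wtM (X : R)) WM1 := IsW.succM (hWM0 R h)
theorem hWN1 (h : (MM : R) = 0) : IsW R 1 (wtN (X : R)) WN1 := IsW.succN (hWN0 R h)
theorem hWC1 : IsW R 1 wtC WC1 := IsW.succC (hWC0 R)
theorem hWE1 : IsW R 1 wtE WE1 := IsW.succE (hWE0 R)
theorem hA2 : IsA R 2 A2 := IsA.succ (hA1 R)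
theorem hg2 : IsG R 2 g2 := IsG.succ (hg1 R)
theorem hWM2 (h : (MM : R) = 0) : IsW R 2 (wtM (X : R)) WM2 := IsW.succM (hWM1 R h)
theorem hWN2 (h : (MM : R) = 0) : IsW R 2 (wtN (X : R)) WN2 := IsW.succN (hWN1 R h)
theorem hWC2 : IsW R 2 wtC WC2 := IsW.succC (hWC1 R)
theorem hWE2 : IsW R 2 wtE WE2 := IsW.succE (hWE1 R)
theorem hA3 : IsA R 3 A3 := IsA.succ (hA2 R)
theorem hg3 : IsG R 3 g3 := IsG.succ (hg2 R)
theorem hWM3 (h : (MM : R) = 0) : IsW R 3 (wtM (X : R)) WM3 := IsW.succM (hWM2 R h)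
theorem hWN3 (h : (MM : R) = 0) : IsW R 3 (wtN (X : R)) WN3 := IsW.succN (hWN2 R h)
theorem hWC3 : IsW R 3 wtC WC3 := IsW.succC (hWC2 R)
theorem hWE3 : IsW R 3 wtE WE3 := IsW.succE (hWE2 R)
theorem hA4 : IsA R 4 A4 := IsA.succ (hA3 R)
theorem hg4 : IsG R 4 g4 := IsG.succ (hg3 R)
theorem hWM4 (h : (MM : R) = 0) : IsW R 4 (wtM (X : R)) WM4 := IsW.succM (hWM3 R h)
theorem hWN4 (h : (MM : R) = 0) : IsW R 4 (wtN (X : R)) WN4 := IsW.succN (hWN3 R h)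
theorem hWC4 : IsW R 4 wtC WC4 := IsW.succC (hWC3 R)
theorem hWE4 : IsW R 4 wtE WE4 := IsW.succE (hWE3 R)
theorem hA5 : IsA R 5 A5 := IsA.succ (hA4 R)
theorem hg5 : IsG R 5 g5 := IsG.succ (hg4 R)
theorem hWM5 (h : (MM : R) = 0) : IsW R 5 (wtM (X : R)) WM5 := IsW.succM (hWM4 R h)
theorem hWN5 (h : (MM : R) = 0) : IsW R 5 (wtN (X : R)) WN5 := IsW.succN (hWN4 R h)
theorem hWC5 : IsW R 5 wtC WC5 := IsW.succC (hWC4 R)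
theorem hWE5 : IsW R 5 wtE WE5 := IsW.succE (hWE4 R)
theorem hA6 : IsA R 6 A6 := IsA.succ (hA5 R)
theorem hg6 : IsG R 6 g6 := IsG.succ (hg5 R)
theorem hWM6 (h : (MM : R) = 0) : IsW R 6 (wtM (X : R)) WM6 := IsW.succM (hWM5 R h)
theorem hWN6 (h : (MM : R) = 0) : IsW R 6 (wtN (X : R)) WN6 := IsW.succN (hWN5 R h)
theorem hWC6 : IsW R 6 wtC WC6 := IsW.succC (hWC5 R)
theorem hWE6 : IsW R 6 wtE WE6 := IsW.succE (hWE5 R)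
theorem hA7 : IsA R 7 A7 := IsA.succ (hA6 R)
theorem hg7 : IsG R 7 g7 := IsG.succ (hg6 R)
theorem hWM7 (h : (MM : R) = 0) : IsW R 7 (wtM (X : R)) WM7 := IsW.succM (hWM6 R h)
theorem hWN7 (h : (MM : R) = 0) : IsW R 7 (wtN (X : R)) WN7 := IsW.succN (hWN6 R h)
theorem hWC7 : IsW R 7 wtC WC7 := IsW.succC (hWC6 R)
theorem hWE7 : IsW R 7 wtE WE7 := IsW.succE (hWE6 R)
theorem hA8 : IsA R 8 A8 := IsA.succ (hA7 R)
theorem hg8 : IsG R 8 g8 := IsG.succ (hg7 R)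
theorem hWM8 (h : (MM : R) = 0) : IsW R 8 (wtM (X : R)) WM8 := IsW.succM (hWM7 R h)
theorem hWN8 (h : (MM : R) = 0) : IsW R 8 (wtN (X : R)) WN8 := IsW.succN (hWN7 R h)
theorem hWC8 : IsW R 8 wtC WC8 := IsW.succC (hWC7 R)
theorem hWE8 : IsW R 8 wtE WE8 := IsW.succE (hWE7 R)
theorem hA9 : IsA R 9 A9 := IsA.succ (hA8 R)
theorem hg9 : IsG R 9 g9 := IsG.succ (hg8 R)
theorem hWM9 (h : (MM : R) = 0) : IsW R 9 (wtM (X : R)) WM9 := IsW.succM (hWM8 R h)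
theorem hWN9 (h : (MM : R) = 0) : IsW R 9 (wtN (X : R)) WN9 := IsW.succN (hWN8 R h)
theorem hWC9 : IsW R 9 wtC WC9 := IsW.succC (hWC8 R)
theorem hWE9 : IsW R 9 wtE WE9 := IsW.succE (hWE8 R)
theorem hA10 : IsA R 10 A10 := IsA.succ (hA9 R)
theorem hg10 : IsG R 10 g10 := IsG.succ (hg9 R)
theorem hWM10 (h : (MM : R) = 0) : IsW R 10 (wtM (X : R)) WM10 := IsW.succM (hWM9 R h)
theorem hWN10 (h : (MM : R) = 0) : IsW R 10 (wtN (X : R)) WN10 := IsW.succN (hWN9 R h)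
theorem hWC10 : IsW R 10 wtC WC10 := IsW.succC (hWC9 R)
theorem hWE10 : IsW R 10 wtE WE10 := IsW.succE (hWE9 R)
theorem hA11 : IsA R 11 A11 := IsA.succ (hA10 R)
theorem hg11 : IsG R 11 g11 := IsG.succ (hg10 R)
theorem hWM11 (h : (MM : R) = 0) : IsW R 11 (wtM (X : R)) WM11 := IsW.succM (hWM10 R h)
theorem hWN11 (h : (MM : R) = 0) : IsW R 11 (wtN (X : R)) WN11 := IsW.succN (hWN10 R h)
theorem hWC11 : IsW R 11 wtC WC11 := IsW.succC (hWC10 R)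
theorem hWE11 : IsW R 11 wtE WE11 := IsW.succE (hWE10 R)
theorem hJ0_0 : IsJ R 0 0 J0_0 := IsJ.zero
theorem hF0_0 : IsF R 0 0 F0_0 := IsF.zero
theorem hE0 : IsF0 R 0 F0_0 := IsF0.zero
theorem hJ0_1 : IsJ R 0 1 J0_1 := IsJ.succ (hJ0_0 R)
theorem hF0_1 : IsF R 0 1 F0_1 := IsF.succ (hA0 R) (hF0_0 R)
theorem hE1 : IsF0 R 1 F0_1 := IsF0.succ (hA0 R) (hE0 R)
theorem hJ0_2 : IsJ R 0 2 J0_2 := IsJ.succ (hJ0_1 R)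
theorem hF0_2 : IsF R 0 2 F0_2 := IsF.succ (hA1 R) (hF0_1 R)
theorem hE2 : IsF0 R 2 F0_2 := IsF0.succ (hA1 R) (hE1 R)
theorem hJ0_3 : IsJ R 0 3 J0_3 := IsJ.succ (hJ0_2 R)
theorem hF0_3 : IsF R 0 3 F0_3 := IsF.succ (hA2 R) (hF0_2 R)
theorem hE3 : IsF0 R 3 F0_3 := IsF0.succ (hA2 R) (hE2 R)
theorem hJ0_4 : IsJ R 0 4 J0_4 := IsJ.succ (hJ0_3 R)
theorem hF0_4 : IsF R 0 4 F0_4 := IsF.succ (hA3 R) (hF0_3 R)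
theorem hE4 : IsF0 R 4 F0_4 := IsF0.succ (hA3 R) (hE3 R)
theorem hJ0_5 : IsJ R 0 5 J0_5 := IsJ.succ (hJ0_4 R)
theorem hF0_5 : IsF R 0 5 F0_5 := IsF.succ (hA4 R) (hF0_4 R)
theorem hE5 : IsF0 R 5 F0_5 := IsF0.succ (hA4 R) (hE4 R)
theorem hJ0_6 : IsJ R 0 6 J0_6 := IsJ.succ (hJ0_5 R)
theorem hF0_6 : IsF R 0 6 F0_6 := IsF.succ (hA5 R) (hF0_5 R)
theorem hE6 : IsF0 R 6 F0_6 := IsF0.succ (hA5 R) (hE5 R)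
theorem hJ0_7 : IsJ R 0 7 J0_7 := IsJ.succ (hJ0_6 R)
theorem hF0_7 : IsF R 0 7 F0_7 := IsF.succ (hA6 R) (hF0_6 R)
theorem hE7 : IsF0 R 7 F0_7 := IsF0.succ (hA6 R) (hE6 R)
theorem hJ0_8 : IsJ R 0 8 J0_8 := IsJ.succ (hJ0_7 R)
theorem hF0_8 : IsF R 0 8 F0_8 := IsF.succ (hA7 R) (hF0_7 R)
theorem hE8 : IsF0 R 8 F0_8 := IsF0.succ (hA7 R) (hE7 R)
theorem hJ0_9 : IsJ R 0 9 J0_9 := IsJ.succ (hJ0_8 R)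
theorem hF0_9 : IsF R 0 9 F0_9 := IsF.succ (hA8 R) (hF0_8 R)
theorem hE9 : IsF0 R 9 F0_9 := IsF0.succ (hA8 R) (hE8 R)
theorem hJ0_10 : IsJ R 0 10 J0_10 := IsJ.succ (hJ0_9 R)
theorem hF0_10 : IsF R 0 10 F0_10 := IsF.succ (hA9 R) (hF0_9 R)
theorem hE10 : IsF0 R 10 F0_10 := IsF0.succ (hA9 R) (hE9 R)
theorem hJ1_0 : IsJ R 1 0 J1_0 := IsJ.zero
theorem hF1_0 : IsF R 1 0 F1_0 := IsF.zero
theorem hJ1_1 : IsJ R 1 1 J1_1 := IsJ.succ (hJ1_0 R)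
theorem hF1_1 : IsF R 1 1 F1_1 := IsF.succ (hA1 R) (hF1_0 R)
theorem hJ1_2 : IsJ R 1 2 J1_2 := IsJ.succ (hJ1_1 R)
theorem hF1_2 : IsF R 1 2 F1_2 := IsF.succ (hA2 R) (hF1_1 R)
theorem hJ1_3 : IsJ R 1 3 J1_3 := IsJ.succ (hJ1_2 R)
theorem hF1_3 : IsF R 1 3 F1_3 := IsF.succ (hA3 R) (hF1_2 R)
theorem hJ1_4 : IsJ R 1 4 J1_4 := IsJ.succ (hJ1_3 R)
theorem hF1_4 : IsF R 1 4 F1_4 := IsF.succ (hA4 R) (hF1_3 R)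
theorem hJ1_5 : IsJ R 1 5 J1_5 := IsJ.succ (hJ1_4 R)
theorem hF1_5 : IsF R 1 5 F1_5 := IsF.succ (hA5 R) (hF1_4 R)
theorem hJ1_6 : IsJ R 1 6 J1_6 := IsJ.succ (hJ1_5 R)
theorem hF1_6 : IsF R 1 6 F1_6 := IsF.succ (hA6 R) (hF1_5 R)
theorem hJ1_7 : IsJ R 1 7 J1_7 := IsJ.succ (hJ1_6 R)
theorem hF1_7 : IsF R 1 7 F1_7 := IsF.succ (hA7 R) (hF1_6 R)
theorem hJ1_8 : IsJ R 1 8 J1_8 := IsJ.succ (hJ1_7 R)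
theorem hF1_8 : IsF R 1 8 F1_8 := IsF.succ (hA8 R) (hF1_7 R)
theorem hJ1_9 : IsJ R 1 9 J1_9 := IsJ.succ (hJ1_8 R)
theorem hF1_9 : IsF R 1 9 F1_9 := IsF.succ (hA9 R) (hF1_8 R)
theorem hJ2_0 : IsJ R 2 0 J2_0 := IsJ.zero
theorem hF2_0 : IsF R 2 0 F2_0 := IsF.zero
theorem hJ2_1 : IsJ R 2 1 J2_1 := IsJ.succ (hJ2_0 R)
theorem hF2_1 : IsF R 2 1 F2_1 := IsF.succ (hA2 R) (hF2_0 R)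
theorem hJ2_2 : IsJ R 2 2 J2_2 := IsJ.succ (hJ2_1 R)
theorem hF2_2 : IsF R 2 2 F2_2 := IsF.succ (hA3 R) (hF2_1 R)
theorem hJ2_3 : IsJ R 2 3 J2_3 := IsJ.succ (hJ2_2 R)
theorem hF2_3 : IsF R 2 3 F2_3 := IsF.succ (hA4 R) (hF2_2 R)
theorem hJ2_4 : IsJ R 2 4 J2_4 := IsJ.succ (hJ2_3 R)
theorem hF2_4 : IsF R 2 4 F2_4 := IsF.succ (hA5 R) (hF2_3 R)
theorem hJ2_5 : IsJ R 2 5 J2_5 := IsJ.succ (hJ2_4 R)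
theorem hF2_5 : IsF R 2 5 F2_5 := IsF.succ (hA6 R) (hF2_4 R)
theorem hJ2_6 : IsJ R 2 6 J2_6 := IsJ.succ (hJ2_5 R)
theorem hF2_6 : IsF R 2 6 F2_6 := IsF.succ (hA7 R) (hF2_5 R)
theorem hJ2_7 : IsJ R 2 7 J2_7 := IsJ.succ (hJ2_6 R)
theorem hF2_7 : IsF R 2 7 F2_7 := IsF.succ (hA8 R) (hF2_6 R)
theorem hJ2_8 : IsJ R 2 8 J2_8 := IsJ.succ (hJ2_7 R)
theorem hF2_8 : IsF R 2 8 F2_8 := IsF.succ (hA9 R) (hF2_7 R)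
theorem hJ3_0 : IsJ R 3 0 J3_0 := IsJ.zero
theorem hF3_0 : IsF R 3 0 F3_0 := IsF.zero
theorem hJ3_1 : IsJ R 3 1 J3_1 := IsJ.succ (hJ3_0 R)
theorem hF3_1 : IsF R 3 1 F3_1 := IsF.succ (hA3 R) (hF3_0 R)
theorem hJ3_2 : IsJ R 3 2 J3_2 := IsJ.succ (hJ3_1 R)
theorem hF3_2 : IsF R 3 2 F3_2 := IsF.succ (hA4 R) (hF3_1 R)
theorem hJ3_3 : IsJ R 3 3 J3_3 := IsJ.succ (hJ3_2 R)
theorem hF3_3 : IsF R 3 3 F3_3 := IsF.succ (hA5 R) (hF3_2 R)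
theorem hJ3_4 : IsJ R 3 4 J3_4 := IsJ.succ (hJ3_3 R)
theorem hF3_4 : IsF R 3 4 F3_4 := IsF.succ (hA6 R) (hF3_3 R)
theorem hJ3_5 : IsJ R 3 5 J3_5 := IsJ.succ (hJ3_4 R)
theorem hF3_5 : IsF R 3 5 F3_5 := IsF.succ (hA7 R) (hF3_4 R)
theorem hJ3_6 : IsJ R 3 6 J3_6 := IsJ.succ (hJ3_5 R)
theorem hF3_6 : IsF R 3 6 F3_6 := IsF.succ (hA8 R) (hF3_5 R)
theorem hJ3_7 : IsJ R 3 7 J3_7 := IsJ.succ (hJ3_6 R)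
theorem hF3_7 : IsF R 3 7 F3_7 := IsF.succ (hA9 R) (hF3_6 R)
theorem hJ4_0 : IsJ R 4 0 J4_0 := IsJ.zero
theorem hF4_0 : IsF R 4 0 F4_0 := IsF.zero
theorem hJ4_1 : IsJ R 4 1 J4_1 := IsJ.succ (hJ4_0 R)
theorem hF4_1 : IsF R 4 1 F4_1 := IsF.succ (hA4 R) (hF4_0 R)
theorem hJ4_2 : IsJ R 4 2 J4_2 := IsJ.succ (hJ4_1 R)
theorem hF4_2 : IsF R 4 2 F4_2 := IsF.succ (hA5 R) (hF4_1 R)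
theorem hJ4_3 : IsJ R 4 3 J4_3 := IsJ.succ (hJ4_2 R)
theorem hF4_3 : IsF R 4 3 F4_3 := IsF.succ (hA6 R) (hF4_2 R)
theorem hJ4_4 : IsJ R 4 4 J4_4 := IsJ.succ (hJ4_3 R)
theorem hF4_4 : IsF R 4 4 F4_4 := IsF.succ (hA7 R) (hF4_3 R)
theorem hJ4_5 : IsJ R 4 5 J4_5 := IsJ.succ (hJ4_4 R)
theorem hF4_5 : IsF R 4 5 F4_5 := IsF.succ (hA8 R) (hF4_4 R)
theorem hJ4_6 : IsJ R 4 6 J4_6 := IsJ.succ (hJ4_5 R)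
theorem hF4_6 : IsF R 4 6 F4_6 := IsF.succ (hA9 R) (hF4_5 R)
theorem hJ5_0 : IsJ R 5 0 J5_0 := IsJ.zero
theorem hF5_0 : IsF R 5 0 F5_0 := IsF.zero
theorem hJ5_1 : IsJ R 5 1 J5_1 := IsJ.succ (hJ5_0 R)
theorem hF5_1 : IsF R 5 1 F5_1 := IsF.succ (hA5 R) (hF5_0 R)
theorem hJ5_2 : IsJ R 5 2 J5_2 := IsJ.succ (hJ5_1 R)
theorem hF5_2 : IsF R 5 2 F5_2 := IsF.succ (hA6 R) (hF5_1 R)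
theorem hJ5_3 : IsJ R 5 3 J5_3 := IsJ.succ (hJ5_2 R)
theorem hF5_3 : IsF R 5 3 F5_3 := IsF.succ (hA7 R) (hF5_2 R)
theorem hJ5_4 : IsJ R 5 4 J5_4 := IsJ.succ (hJ5_3 R)
theorem hF5_4 : IsF R 5 4 F5_4 := IsF.succ (hA8 R) (hF5_3 R)
theorem hJ5_5 : IsJ R 5 5 J5_5 := IsJ.succ (hJ5_4 R)
theorem hF5_5 : IsF R 5 5 F5_5 := IsF.succ (hA9 R) (hF5_4 R)
theorem hJ6_0 : IsJ R 6 0 J6_0 := IsJ.zero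
theorem hF6_0 : IsF R 6 0 F6_0 := IsF.zero
theorem hJ6_1 : IsJ R 6 1 J6_1 := IsJ.succ (hJ6_0 R)
theorem hF6_1 : IsF R 6 1 F6_1 := IsF.succ (hA6 R) (hF6_0 R)
theorem hJ6_2 : IsJ R 6 2 J6_2 := IsJ.succ (hJ6_1 R)
theorem hF6_2 : IsF R 6 2 F6_2 := IsF.succ (hA7 R) (hF6_1 R)
theorem hJ6_3 : IsJ R 6 3 J6_3 := IsJ.succ (hJ6_2 R)
theorem hF6_3 : IsF R 6 3 F6_3 := IsF.succ (hA8 R) (hF6_2 R)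
theorem hJ6_4 : IsJ R 6 4 J6_4 := IsJ.succ (hJ6_3 R)
theorem hF6_4 : IsF R 6 4 F6_4 := IsF.succ (hA9 R) (hF6_3 R)
theorem hJ7_0 : IsJ R 7 0 J7_0 := IsJ.zero
theorem hF7_0 : IsF R 7 0 F7_0 := IsF.zero
theorem hJ7_1 : IsJ R 7 1 J7_1 := IsJ.succ (hJ7_0 R)
theorem hF7_1 : IsF R 7 1 F7_1 := IsF.succ (hA7 R) (hF7_0 R)
theorem hJ7_2 : IsJ R 7 2 J7_2 := IsJ.succ (hJ7_1 R)
theorem hF7_2 : IsF R 7 2 F7_2 := IsF.succ (hA8 R) (hF7_1 R)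
theorem hJ7_3 : IsJ R 7 3 J7_3 := IsJ.succ (hJ7_2 R)
theorem hF7_3 : IsF R 7 3 F7_3 := IsF.succ (hA9 R) (hF7_2 R)
theorem hJ8_0 : IsJ R 8 0 J8_0 := IsJ.zero
theorem hF8_0 : IsF R 8 0 F8_0 := IsF.zero
theorem hJ8_1 : IsJ R 8 1 J8_1 := IsJ.succ (hJ8_0 R)
theorem hF8_1 : IsF R 8 1 F8_1 := IsF.succ (hA8 R) (hF8_0 R)
theorem hJ8_2 : IsJ R 8 2 J8_2 := IsJ.succ (hJ8_1 R)
theorem hF8_2 : IsF R 8 2 F8_2 := IsF.succ (hA9 R) (hF8_1 R)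
theorem hJ9_0 : IsJ R 9 0 J9_0 := IsJ.zero
theorem hF9_0 : IsF R 9 0 F9_0 := IsF.zero
theorem hJ9_1 : IsJ R 9 1 J9_1 := IsJ.succ (hJ9_0 R)
theorem hF9_1 : IsF R 9 1 F9_1 := IsF.succ (hA9 R) (hF9_0 R)
theorem hJ10_0 : IsJ R 10 0 J10_0 := IsJ.zero
theorem hF10_0 : IsF R 10 0 F10_0 := IsF.zero
theorem hN0_0 : IsN R 0 0 N0_0 := IsN.zero (hE0 R)
theorem hN0_1 : IsN R 0 1 N0_1 := IsN.succ (hN0_0 R)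
theorem hN0_2 : IsN R 0 2 N0_2 := IsN.succ (hN0_1 R)
theorem hN0_3 : IsN R 0 3 N0_3 := IsN.succ (hN0_2 R)
theorem hN0_4 : IsN R 0 4 N0_4 := IsN.succ (hN0_3 R)
theorem hN0_5 : IsN R 0 5 N0_5 := IsN.succ (hN0_4 R)
theorem hN0_6 : IsN R 0 6 N0_6 := IsN.succ (hN0_5 R)
theorem hN0_7 : IsN R 0 7 N0_7 := IsN.succ (hN0_6 R)
theorem hN0_8 : IsN R 0 8 N0_8 := IsN.succ (hN0_7 R)
theorem hN0_9 : IsN R 0 9 N0_9 := IsN.succ (hN0_8 R)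
theorem hN0_10 : IsN R 0 10 N0_10 := IsN.succ (hN0_9 R)
theorem hN1_0 : IsN R 1 0 N1_0 := IsN.zero (hE1 R)
theorem hN1_1 : IsN R 1 1 N1_1 := IsN.succ (hN1_0 R)
theorem hN1_2 : IsN R 1 2 N1_2 := IsN.succ (hN1_1 R)
theorem hN1_3 : IsN R 1 3 N1_3 := IsN.succ (hN1_2 R)
theorem hN1_4 : IsN R 1 4 N1_4 := IsN.succ (hN1_3 R)
theorem hN1_5 : IsN R 1 5 N1_5 := IsN.succ (hN1_4 R)
theorem hN1_6 : IsN R 1 6 N1_6 := IsN.succ (hN1_5 R)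
theorem hN1_7 : IsN R 1 7 N1_7 := IsN.succ (hN1_6 R)
theorem hN1_8 : IsN R 1 8 N1_8 := IsN.succ (hN1_7 R)
theorem hN1_9 : IsN R 1 9 N1_9 := IsN.succ (hN1_8 R)
theorem hN2_0 : IsN R 2 0 N2_0 := IsN.zero (hE2 R)
theorem hN2_1 : IsN R 2 1 N2_1 := IsN.succ (hN2_0 R)
theorem hN2_2 : IsN R 2 2 N2_2 := IsN.succ (hN2_1 R)
theorem hN2_3 : IsN R 2 3 N2_3 := IsN.succ (hN2_2 R)
theorem hN2_4 : IsN R 2 4 N2_4 := IsN.succ (hN2_3 R)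
theorem hN2_5 : IsN R 2 5 N2_5 := IsN.succ (hN2_4 R)
theorem hN2_6 : IsN R 2 6 N2_6 := IsN.succ (hN2_5 R)
theorem hN2_7 : IsN R 2 7 N2_7 := IsN.succ (hN2_6 R)
theorem hN2_8 : IsN R 2 8 N2_8 := IsN.succ (hN2_7 R)
theorem hN3_0 : IsN R 3 0 N3_0 := IsN.zero (hE3 R)
theorem hN3_1 : IsN R 3 1 N3_1 := IsN.succ (hN3_0 R)
theorem hN3_2 : IsN R 3 2 N3_2 := IsN.succ (hN3_1 R)
theorem hN3_3 : IsN R 3 3 N3_3 := IsN.succ (hN3_2 R)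
theorem hN3_4 : IsN R 3 4 N3_4 := IsN.succ (hN3_3 R)
theorem hN3_5 : IsN R 3 5 N3_5 := IsN.succ (hN3_4 R)
theorem hN3_6 : IsN R 3 6 N3_6 := IsN.succ (hN3_5 R)
theorem hN3_7 : IsN R 3 7 N3_7 := IsN.succ (hN3_6 R)
theorem hN4_0 : IsN R 4 0 N4_0 := IsN.zero (hE4 R)
theorem hN4_1 : IsN R 4 1 N4_1 := IsN.succ (hN4_0 R)
theorem hN4_2 : IsN R 4 2 N4_2 := IsN.succ (hN4_1 R)
theorem hN4_3 : IsN R 4 3 N4_3 := IsN.succ (hN4_2 R)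
theorem hN4_4 : IsN R 4 4 N4_4 := IsN.succ (hN4_3 R)
theorem hN4_5 : IsN R 4 5 N4_5 := IsN.succ (hN4_4 R)
theorem hN4_6 : IsN R 4 6 N4_6 := IsN.succ (hN4_5 R)
theorem hN5_0 : IsN R 5 0 N5_0 := IsN.zero (hE5 R)
theorem hN5_1 : IsN R 5 1 N5_1 := IsN.succ (hN5_0 R)
theorem hN5_2 : IsN R 5 2 N5_2 := IsN.succ (hN5_1 R)
theorem hN5_3 : IsN R 5 3 N5_3 := IsN.succ (hN5_2 R)
theorem hN5_4 : IsN R 5 4 N5_4 := IsN.succ (hN5_3 R)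
theorem hN5_5 : IsN R 5 5 N5_5 := IsN.succ (hN5_4 R)
theorem hN6_0 : IsN R 6 0 N6_0 := IsN.zero (hE6 R)
theorem hN6_1 : IsN R 6 1 N6_1 := IsN.succ (hN6_0 R)
theorem hN6_2 : IsN R 6 2 N6_2 := IsN.succ (hN6_1 R)
theorem hN6_3 : IsN R 6 3 N6_3 := IsN.succ (hN6_2 R)
theorem hN6_4 : IsN R 6 4 N6_4 := IsN.succ (hN6_3 R)
theorem hN7_0 : IsN R 7 0 N7_0 := IsN.zero (hE7 R)
theorem hN7_1 : IsN R 7 1 N7_1 := IsN.succ (hN7_0 R)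
theorem hN7_2 : IsN R 7 2 N7_2 := IsN.succ (hN7_1 R)
theorem hN7_3 : IsN R 7 3 N7_3 := IsN.succ (hN7_2 R)
theorem hN8_0 : IsN R 8 0 N8_0 := IsN.zero (hE8 R)
theorem hN8_1 : IsN R 8 1 N8_1 := IsN.succ (hN8_0 R)
theorem hN8_2 : IsN R 8 2 N8_2 := IsN.succ (hN8_1 R)
theorem hN9_0 : IsN R 9 0 N9_0 := IsN.zero (hE9 R)
theorem hN9_1 : IsN R 9 1 N9_1 := IsN.succ (hN9_0 R)
theorem hN10_0 : IsN R 10 0 N10_0 := IsN.zero (hE10 R)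
theorem hS0 : IsS R 10 0 S0 := IsS.zero
theorem hS1 : IsS R 10 1 S1 := IsS.succ (hA9 R) (hF9_0 R) (hN9_0 R) (hJ9_0 R) (hg9 R) (hS0 R)
theorem hS2 : IsS R 10 2 S2 := IsS.succ (hA9 R) (hF8_1 R) (hN8_1 R) (hJ8_1 R) (hg9 R) (hS1 R)
theorem hS3 : IsS R 10 3 S3 := IsS.succ (hA9 R) (hF7_2 R) (hN7_2 R) (hJ7_2 R) (hg9 R) (hS2 R)
theorem hS4 : IsS R 10 4 S4 := IsS.succ (hA9 R) (hF6_3 R) (hN6_3 R) (hJ6_3 R) (hg9 R) (hS3 R)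
theorem hS5 : IsS R 10 5 S5 := IsS.succ (hA9 R) (hF5_4 R) (hN5_4 R) (hJ5_4 R) (hg9 R) (hS4 R)
theorem hS6 : IsS R 10 6 S6 := IsS.succ (hA9 R) (hF4_5 R) (hN4_5 R) (hJ4_5 R) (hg9 R) (hS5 R)
theorem hS7 : IsS R 10 7 S7 := IsS.succ (hA9 R) (hF3_6 R) (hN3_6 R) (hJ3_6 R) (hg9 R) (hS6 R)
theorem hS8 : IsS R 10 8 S8 := IsS.succ (hA9 R) (hF2_7 R) (hN2_7 R) (hJ2_7 R) (hg9 R) (hS7 R)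
theorem hS9 : IsS R 10 9 S9 := IsS.succ (hA9 R) (hF1_8 R) (hN1_8 R) (hJ1_8 R) (hg9 R) (hS8 R)
theorem hS10 : IsS R 10 10 S10 := IsS.succ (hA9 R) (hF0_9 R) (hN0_9 R) (hJ0_9 R) (hg9 R) (hS9 R)
theorem hs0 : IsP R 0 one s0 := IsP.zero1
theorem hu0 : IsP R 0 oned u0 := IsP.zerou
theorem hd0 : IsP R 0 udw d0 := IsP.zerod
theorem hs1 : IsP R 1 one s1 := IsP.succ1 (hs0 R) (hg0 R)
theorem hu1 : IsP R 1 oned u1 := IsP.succu (hu0 R) (hg0 R)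
theorem hd1 : IsP R 1 udw d1 := IsP.succd (hd0 R) (hu0 R)
theorem hs2 : IsP R 2 one s2 := IsP.succ1 (hs1 R) (hg1 R)
theorem hu2 : IsP R 2 oned u2 := IsP.succu (hu1 R) (hg1 R)
theorem hd2 : IsP R 2 udw d2 := IsP.succd (hd1 R) (hu1 R)
theorem hs3 : IsP R 3 one s3 := IsP.succ1 (hs2 R) (hg2 R)
theorem hu3 : IsP R 3 oned u3 := IsP.succu (hu2 R) (hg2 R)
theorem hd3 : IsP R 3 udw d3 := IsP.succd (hd2 R) (hu2 R)
theorem hs4 : IsP R 4 one s4 := IsP.succ1 (hs3 R) (hg3 R)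
theorem hu4 : IsP R 4 oned u4 := IsP.succu (hu3 R) (hg3 R)
theorem hd4 : IsP R 4 udw d4 := IsP.succd (hd3 R) (hu3 R)
theorem hs5 : IsP R 5 one s5 := IsP.succ1 (hs4 R) (hg4 R)
theorem hu5 : IsP R 5 oned u5 := IsP.succu (hu4 R) (hg4 R)
theorem hd5 : IsP R 5 udw d5 := IsP.succd (hd4 R) (hu4 R)
theorem hs6 : IsP R 6 one s6 := IsP.succ1 (hs5 R) (hg5 R)
theorem hu6 : IsP R 6 oned u6 := IsP.succu (hu5 R) (hg5 R)
theorem hd6 : IsP R 6 udw d6 := IsP.succd (hd5 R) (hu5 R)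
theorem hs7 : IsP R 7 one s7 := IsP.succ1 (hs6 R) (hg6 R)
theorem hu7 : IsP R 7 oned u7 := IsP.succu (hu6 R) (hg6 R)
theorem hd7 : IsP R 7 udw d7 := IsP.succd (hd6 R) (hu6 R)
theorem hs8 : IsP R 8 one s8 := IsP.succ1 (hs7 R) (hg7 R)
theorem hu8 : IsP R 8 oned u8 := IsP.succu (hu7 R) (hg7 R)
theorem hd8 : IsP R 8 udw d8 := IsP.succd (hd7 R) (hu7 R)
theorem hs9 : IsP R 9 one s9 := IsP.succ1 (hs8 R) (hg8 R)
theorem hu9 : IsP R 9 oned u9 := IsP.succu (hu8 R) (hg8 R)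
theorem hd9 : IsP R 9 udw d9 := IsP.succd (hd8 R) (hu8 R)
theorem hs10 : IsP R 10 one s10 := IsP.succ1 (hs9 R) (hg9 R)
theorem hu10 : IsP R 10 oned u10 := IsP.succu (hu9 R) (hg9 R)
theorem hd10 : IsP R 10 udw d10 := IsP.succd (hd9 R) (hu9 R)
theorem hs11 : IsP R 11 one s11 := IsP.succ1 (hs10 R) (hg10 R)
theorem hu11 : IsP R 11 oned u11 := IsP.succu (hu10 R) (hg10 R)
theorem hd11 : IsP R 11 udw d11 := IsP.succd (hd10 R) (hu10 R)
theorem hR0 (h : (MM : R) = 0) : IsR R 11 (GR (X : R) 0 false) R0 := IsR.zero (hs11 R) (hd11 R)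
theorem hR1 (h : (MM : R) = 0) : IsR R 11 (GR (X : R) 1 true) R1 := IsR.succN (hS10 R) (hA11 R) (hWC11 R) (hWN11 R h) (hR0 R h)
theorem hR2 (h : (MM : R) = 0) : IsR R 11 (GR (X : R) 2 false) R2 := IsR.succM (hS10 R) (hA10 R) (hWE11 R) (hWM11 R h) (hR1 R h)
theorem hR3 (h : (MM : R) = 0) : IsR R 11 (GR (X : R) 3 true) R3 := IsR.succN (hS10 R) (hA11 R) (hWC11 R) (hWN11 R h) (hR2 R h)
theorem hR4 (h : (MM : R) = 0) : IsR R 11 (GR (X : R) 4 false) R4 := IsR.succM (hS10 R) (hA10 R) (hWE11 R) (hWM11 R h) (hR3 R h)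
theorem hR5 (h : (MM : R) = 0) : IsR R 11 (GR (X : R) 5 true) R5 := IsR.succN (hS10 R) (hA11 R) (hWC11 R) (hWN11 R h) (hR4 R h)
theorem hR6 (h : (MM : R) = 0) : IsR R 11 (GR (X : R) 6 false) R6 := IsR.succM (hS10 R) (hA10 R) (hWE11 R) (hWM11 R h) (hR5 R h)
theorem hR7 (h : (MM : R) = 0) : IsR R 11 (GR (X : R) 7 true) R7 := IsR.succN (hS10 R) (hA11 R) (hWC11 R) (hWN11 R h) (hR6 R h)
theorem hR8 (h : (MM : R) = 0) : IsR R 11 (GR (X : R) 8 false) R8 := IsR.succM (hS10 R) (hA10 R) (hWE11 R) (hWM11 R h) (hR7 R h)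
theorem hR9 (h : (MM : R) = 0) : IsR R 11 (GR (X : R) 9 true) R9 := IsR.succN (hS10 R) (hA11 R) (hWC11 R) (hWN11 R h) (hR8 R h)
theorem hR10 (h : (MM : R) = 0) : IsR R 11 (GR (X : R) 10 false) R10 := IsR.succM (hS10 R) (hA10 R) (hWE11 R) (hWM11 R h) (hR9 R h)
theorem hR11 (h : (MM : R) = 0) : IsR R 11 (GR (X : R) 11 true) R11 := IsR.succN (hS10 R) (hA11 R) (hWC11 R) (hWN11 R h) (hR10 R h)
end inst
end G
end

set_option linter.all false
noncomputable section
namespace G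
open Sy
def It : (n : ℕ) → Tt n
  | 0 => L.v 1
  | n + 1 => O.s (It n) (Zt n) (Zt n)
def Dt : (n : ℕ) → Tt n
  | 0 => L.v 2
  | n + 1 => O.s (Dt n) (Zt n) (Zt n)
def Kt : (n : ℕ) → Tt n
  | 0 => L.n
  | n + 1 => O.s (Kt n) (Dt n) (Zt n)
section ini
variable {R : Type} [CommSemiring R]
/-- rule for the first row, after its first cell (which is black) -/
def ini : List Bool → (List Sy → R) → R
  | [], f => f []
  | true :: r, f => ini r (fun w => f (e :: w))
  | false :: r, f => cond (r.all (fun x => !x)) (2 * f (u :: List.replicate r.length e)) 0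
theorem pr_It (n : ℕ) (F : List Sy → R) : pr n F (It n) = F (List.replicate n e) := by
  induction n generalizing F with
  | zero => simp [pr, It, lg]
  | succ n ih => rw [It, pr_s, pr_Z, pr_Z, ih]; simp [List.replicate_succ]
theorem pr_Dt (n : ℕ) (F : List Sy → R) : pr n F (Dt n) = 2 * F (List.replicate n e) := by
  induction n generalizing F with
  | zero => simp [pr, Dt, lg, mul_comm]
  | succ n ih => rw [Dt, pr_s, pr_Z, pr_Z, ih]; simp [List.replicate_succ]
theorem blk_rep (n : ℕ) : blk false (List.replicate n e) = 0 := by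
  induction n with
  | zero => rfl
  | succ n ih => simpa [List.replicate_succ, blk] using ih
theorem bsum_allF (n : ℕ) (F : List Bool → R) :
    bsum n (fun r => cond (r.all (fun x => !x)) (F r) 0) = F (List.replicate n false) := by
  induction n generalizing F with
  | zero => rfl
  | succ n ih =>
    simp only [bsum, List.all_cons, Bool.not_true, Bool.false_and, cond_false, bsum_zero, Bool.not_false, Bool.true_and, zero_add]
    rw [ih (fun r => F (false :: r))]; rfl
theorem cnt1_F (n : ℕ) : cnt1 (List.replicate n false) = 0 := by
  induction n with
  | zero => rfl
  | succ n ih => simpa [List.replicate_succ, cnt1] using ih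
theorem ini_sum (X : R) (n m : ℕ) (f : List Sy → R) :
    bsum n (fun r => ini r f * X ^ (m + 1 + cnt1 r)) = pr n (fun w => f w * wtM X true m w) (It n)
      + pr n (fun w => f w * wtM X true m w) (Kt n) := by
  induction n generalizing m f with
  | zero => simp [bsum, ini, pr, It, Kt, lg, wtM, blk, cnt1]
  | succ n ih =>
    have h := ih (m+1) (fun w => f (e :: w))
    have h2 : bsum n (fun r => ini (false :: r) f * X ^ (m + 1 + cnt1 (false :: r))) = 2 * f (u :: List.replicate n e) * X ^ (m + 1) := by
      have := bsum_allF n (fun r => 2 * f (u :: List.replicate r.length e) * X ^ (m + 1 + cnt1 r))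
      rw [cnt1_F, List.length_replicate, add_zero] at this
      rw [← this]
      congr 1; funext r
      simp only [ini]
      cases r.all (fun x => !x) <;> simp [cnt1]
    simp only [bsum]
    rw [h2, Kt, It, pr_s, pr_s, pr_Z, pr_Z, pr_Dt]
    have e1 : ∀ r, ini (true :: r) f * X ^ (m + 1 + cnt1 (true :: r)) = ini r (fun w => f (e :: w)) * X ^ (m + 1 + 1 + cnt1 r) := by
      intro r; simp only [ini, cnt1, List.map_cons, List.sum_cons, Bool.toNat_true]; rw [show m + 1 + (1 + (List.map Bool.toNat r).sum) = m + 1 + 1 + (List.map Bool.toNat r).sum by ring]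
    simp only [e1, h]
    simp only [wtM, blk, blk_rep, Bool.not_true, Bool.toNat, cond_true, add_zero, add_assoc]
    ring
theorem ini_hom {R' : Type} [CommSemiring R'] (φ : R → R') (h0 : φ 0 = 0) (h2 : ∀ x, φ (2 * x) = 2 * φ x) (r : List Bool) (f : List Sy → R) :
    φ (ini r f) = ini r (fun w => φ (f w)) := by
  induction r generalizing f with
  | nil => rfl
  | cons a r ih =>
    cases a with
    | true => exact ih _
    | false => simp only [ini]; cases r.all (fun x => !x) <;> simp [h0, h2]
theorem ini_add (r : List Bool) (f g : List Sy → R) : ini r (fun w => f w + g w) = ini r f + ini r g := by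
  induction r generalizing f g with
  | nil => rfl
  | cons a r ih =>
    cases a with
    | true => exact ih _ _
    | false => simp only [ini]; cases r.all (fun x => !x) <;> simp [mul_add]
theorem ini_congr (r : List Bool) (f g : List Sy → R) (h : ∀ w, w.length = r.length → f w = g w) : ini r f = ini r g := by
  induction r generalizing f g with
  | nil => exact h [] rfl
  | cons a r ih =>
    cases a with
    | true => exact ih _ _ fun w hw => h _ (by simp [hw])
    | false => simp only [ini]; rw [h]; simp
theorem ini_tsum (k : ℕ) (r : List Bool) (f : List (List Bool) → List Sy → R) :
    tsum k (fun rs => ini r (f rs)) = ini r (fun w => tsum k (fun rs => f rs w)) := by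
  rw [← tsum_hom (M := List Sy → R) (fun x => ini r x) (fun x y => ini_add r x y)]
  congr 1
  funext w
  exact tsum_hom (M := List Sy → R) (fun x => x w) (fun x y => rfl) k f
end ini
/-- deterministic total weight -/
def DT : List (List Bool) → ℕ
  | (true :: r) :: rs => ini r (DD true rs)
  | _ => 0
theorem DT_sum {R : Type} [CommSemiring R] (X : R) :
    tsum 12 (fun rs => (DT rs : R) * X ^ cntc rs) = bsum 11 (fun r => ini r (GR X 11 true) * X ^ (0 + 1 + cnt1 r)) := by
  change bsum 11 _ + bsum 11 _ = _
  have h1 : ∀ r rs, DT ((false :: r) :: rs) = 0 := fun _ _ => rfl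
  simp only [h1, Nat.cast_zero, zero_mul, tsum_zero, bsum_zero, add_zero]
  apply bsum_congr
  intro r hr
  have h2 : ∀ rs, (DT ((true :: r) :: rs) : R) * X ^ cntc ((true :: r) :: rs) =
     ini r (fun w => (DD true rs w : R) * X ^ cntc rs) * X ^ (0 + 1 + cnt1 r) := by
    intro rs
    have e1 := ini_hom (R := ℕ) (fun x : ℕ => (x : R) * X ^ cntc rs) (by simp) (by intro x; push_cast; ring) r (DD true rs)
    rw [← e1]
    simp only [DT, cntc, List.map_cons, List.sum_cons, cnt1]
    rw [mul_assoc, ← pow_add]; congr 2; simp [cnt1]; ring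
  simp only [h2]
  rw [← tsum_hom (fun x : R => x * X ^ (0 + 1 + cnt1 r)) (fun x y => by ring), ini_tsum]
  congr 1
  apply ini_congr
  intro w hw
  exact GR_eq X 11 true w (by simp [hw, hr])
theorem val_cast (R : Type) [CommSemiring R] (h : (MM : R) = 0) :
    (val : R) = tsum 12 (fun rs => (DT rs : R) * (X : R) ^ cntc rs) := by
  rw [DT_sum, ini_sum]
  have h1 : (val : R) = ((0 : ℕ) : R) + pr 11 (GR (X : R) 11 true) (WM11 true 0 (A11 I11 K11)) := hR11 R h _ _
  have h2 : pr 11 (GR (X : R) 11 true) (WM11 true 0 (A11 I11 K11))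
      = pr 11 (fun w => GR (X : R) 11 true w * wtM (X : R) true 0 w) (A11 I11 K11) := hWM11 R h _ _ _ _
  have h3 : pr 11 (fun w => GR (X : R) 11 true w * wtM (X : R) true 0 w) (A11 I11 K11)
      = pr 11 (fun w => GR (X : R) 11 true w * wtM (X : R) true 0 w) (It 11)
      + pr 11 (fun w => GR (X : R) 11 true w * wtM (X : R) true 0 w) (Kt 11) := hA11 R _ _ _
  rw [h1, h2, h3, Nat.cast_zero, zero_add]
theorem bsum_le (k : ℕ) (f g : List Bool → ℕ) (h : ∀ r, f r ≤ g r) : bsum k f ≤ bsum k g := by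
  induction k generalizing f g with
  | zero => exact h _
  | succ k ih => exact Nat.add_le_add (ih _ _ fun r => h _) (ih _ _ fun r => h _)
theorem cnt1_le (r : List Bool) : cnt1 r ≤ r.length := by
  induction r with
  | nil => simp [cnt1]
  | cons a r ih => cases a <;> simp [cnt1] at * <;> omega
theorem cntc_le (rs : List (List Bool)) (h : ∀ r ∈ rs, r.length = 12) : cntc rs ≤ 12 * rs.length := by
  induction rs with
  | nil => simp [cntc]
  | cons r rs ih =>
    have h1 := ih (fun r hr => h r (by simp [hr]))
    have h2 := cnt1_le r
    have h3 := h r (by simp)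
    simp only [cntc, List.map_cons, List.sum_cons, List.length_cons] at *
    omega
theorem digits_lt (x : ℕ) (w : ℕ → ℕ) (n : ℕ) (h : ∀ a, w a < x) : ∑ a ∈ Finset.range n, w a * x ^ a < x ^ n := by
  induction n with
  | zero => simp
  | succ n ih =>
    rw [Finset.sum_range_succ, pow_succ]
    have := h n
    have h1 : (w n + 1) * x ^ n ≤ x * x ^ n := Nat.mul_le_mul_right _ this
    nlinarith
theorem tsum_fsum (k n : ℕ) (f : ℕ → List (List Bool) → ℕ) :
    tsum k (fun rs => ∑ a ∈ Finset.range n, f a rs) = ∑ a ∈ Finset.range n, tsum k (f a) := by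
  induction n with
  | zero => simp [tsum_zero]
  | succ n ih =>
    simp only [Finset.sum_range_succ, ← ih]
    have hadd : ∀ f g : List (List Bool) → ℕ, tsum k (fun rs => f rs + g rs) = tsum k f + tsum k g := by
      intro f g
      have h0 := tsum_hom (M := ℕ × ℕ) (fun x => x.1 + x.2) (fun x y => by simp; ring) k (fun rs => (f rs, g rs))
      have h1 := tsum_hom (M := ℕ × ℕ) (fun x => x.1) (fun x y => by simp) k (fun rs => (f rs, g rs))
      have h2 := tsum_hom (M := ℕ × ℕ) (fun x => x.2) (fun x y => by simp) k (fun rs => (f rs, g rs))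
      simp only at h0 h1 h2
      rw [← h0, h1, h2]
    exact hadd _ _
theorem digit_extract (x v n k : ℕ) (w : ℕ → ℕ) (h : ∀ a, w a < x)
    (hv : (v : ZMod (x ^ (n + 1))) = ((∑ a ∈ Finset.range (n + 1 + k), w a * x ^ a : ℕ) : ZMod (x ^ (n + 1)))) : v / x ^ n % x = w n := by
  have hx : 0 < x := by have := h 0; omega
  rw [ZMod.natCast_eq_natCast_iff'] at hv
  rw [← Nat.mod_mul_right_div_self, ← pow_succ, hv]
  have e1 : ∑ a ∈ Finset.range (n + 1 + k), w a * x ^ a = ∑ a ∈ Finset.range (n + 1), w a * x ^ a + x ^ (n + 1) * ∑ a ∈ Finset.range k, w (n + 1 + a) * x ^ a := by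
    rw [Finset.sum_range_add, Finset.mul_sum]
    congr 1
    apply Finset.sum_congr rfl
    intro a _; rw [pow_add x (n + 1)]; ring
  rw [e1, Nat.add_mul_mod_self_left, Nat.mod_eq_of_lt (digits_lt x w (n + 1) h), Finset.sum_range_succ,
    Nat.add_mul_div_right _ _ (by positivity), Nat.div_eq_of_lt (digits_lt x w n h), zero_add]
/-- weight of the colourings with `a` black cells, for `k` rows -/
def WK (k a : ℕ) : ℕ := tsum k (fun rs => if cntc rs = a then DT rs else 0)
theorem WK_sum (k x N : ℕ) (hN : 12 * k < N) {R : Type} [CommSemiring R] :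
    tsum k (fun rs => (DT rs : R) * (x : R) ^ cntc rs) = ((∑ a ∈ Finset.range N, WK k a * x ^ a : ℕ) : R) := by
  have e1 : ∑ a ∈ Finset.range N, WK k a * x ^ a = tsum k (fun rs => DT rs * x ^ cntc rs) := by
    have e2 : ∀ a, WK k a * x ^ a = tsum k (fun rs => (if cntc rs = a then DT rs else 0) * x ^ a) := by
      intro a
      rw [WK, tsum_hom (fun y : ℕ => y * x ^ a) (fun y z => by ring)]
    simp only [e2]
    rw [← tsum_fsum]
    apply tsum_congr
    intro rs hl hr
    have := cntc_le rs hr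
    rw [Finset.sum_eq_single (cntc rs)]
    · simp
    · intro b _ hb
      rw [if_neg (Ne.symm hb)]; simp
    · intro hn
      simp at hn; subst hl; omega
  rw [e1, tsum_hom (fun y : ℕ => (y : R)) (fun y z => by push_cast; ring)]
  congr 1; funext rs; push_cast; rfl
theorem cnt_def (v x : ℕ) : Nat.mod (Nat.div v (Nat.pow x 72)) x = v / x ^ 72 % x := rfl
theorem MM_zero (x : ℕ) : ((Nat.pow x 73 : ℕ) : ZMod (x ^ (72 + 1))) = 0 := ZMod.natCast_self (x ^ (72 + 1))
theorem cnt_core (x v : ℕ) (h : ∀ a, WK 12 a < x) (h3 : ∀ (R : Type) [CommSemiring R], ((Nat.pow x 73 : ℕ) : R) = 0 →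
    (v : R) = tsum 12 (fun rs => (DT rs : R) * (x : R) ^ cntc rs)) : cntf x v = WK 12 72 := by
  have h3 := h3 (ZMod (x ^ (72 + 1))) (MM_zero x)
  rw [WK_sum 12 x (72 + 1 + 72) (by norm_num)] at h3
  rw [cntf, cnt_def]
  exact digit_extract x v 72 72 (WK 12) h h3
theorem cnt_eq (h : ∀ a, WK 12 a < X) : cntf X val = WK 12 72 := cnt_core X val h val_cast
end G
end

set_option linter.all false
noncomputable section
namespace G
/-- positions at the same height joined without going below -/
def Cn (H : ℕ → ℤ) (i j : ℕ) : Prop := H i = H j ∧ ∀ k, (i ≤ k ∧ k ≤ j ∨ j ≤ k ∧ k ≤ i) → H i ≤ H k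
theorem Cn.refl (H : ℕ → ℤ) (i : ℕ) : Cn H i i := ⟨rfl, fun k hk => by rw [show k = i by omega]⟩
theorem Cn.symm {H : ℕ → ℤ} {i j : ℕ} (h : Cn H i j) : Cn H j i := ⟨h.1.symm, fun k hk => h.1 ▸ h.2 k hk.symm⟩
theorem Cn.trans {H : ℕ → ℤ} {i j k : ℕ} (h : Cn H i j) (h' : Cn H j k) : Cn H i k := by
  refine ⟨h.1.trans h'.1, fun m hm => ?_⟩
  by_cases hc : (i ≤ m ∧ m ≤ j ∨ j ≤ m ∧ m ≤ i)
  · exact h.2 m hc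
  · rw [h.1]; exact h'.2 m (by omega)
theorem Cn_comm {H : ℕ → ℤ} {i j : ℕ} : Cn H i j ↔ Cn H j i := ⟨Cn.symm, Cn.symm⟩
theorem SU1 (H H' : ℕ → ℤ) (g : ℕ) (hne : ∀ k, k ≠ g + 1 → H' k = H k) (h1 : min (H g) (H (g+2)) ≤ H (g+1))
    (h2 : min (H g) (H (g+2)) ≤ H' (g+1)) (i j : ℕ) (hi : i ≠ g + 1) (hj : j ≠ g + 1) : Cn H' i j ↔ Cn H i j := by
  unfold Cn
  rw [hne i hi, hne j hj]
  refine and_congr_right fun e1 => ⟨fun h k hk => ?_, fun h k hk => ?_⟩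
  · by_cases hkf : k = g + 1
    · subst hkf
      have h3 := h g (by omega)
      have h4 := h (g+2) (by omega)
      rw [hne _ (by omega)] at h3 h4
      rcases min_le_iff.1 h1 with h | h <;> omega
    · rw [← hne k hkf]; exact h k hk
  · by_cases hkf : k = g + 1
    · subst hkf
      have h3 := h g (by omega)
      have h4 := h (g+2) (by omega)
      rcases min_le_iff.1 h2 with h | h <;> omega
    · rw [hne k hkf]; exact h k hk
theorem S2l (H H' : ℕ → ℤ) (g : ℕ) (hne : ∀ k, k ≠ g + 1 → H' k = H k) (h1 : min (H g) (H (g+2)) ≤ H (g+1))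
    (h2 : H' (g+1) = H g) (j : ℕ) (hj : j ≠ g + 1) : Cn H' (g+1) j ↔ Cn H g j := by
  unfold Cn
  rw [h2, hne j hj]
  refine and_congr_right fun e1 => ⟨fun h k hk => ?_, fun h k hk => ?_⟩
  · by_cases hkf : k = g + 1
    · subst hkf
      have h4 := h (g+2) (by omega)
      rw [hne _ (by omega)] at h4
      rcases min_le_iff.1 h1 with h | h <;> omega
    · by_cases hkg : k = g
      · rw [hkg]
      · rw [← hne k hkf]; exact h k (by omega)
  · by_cases hkf : k = g + 1
    · rw [hkf, h2]
    · rw [hne k hkf]; exact h k (by omega)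
theorem S2r (H H' : ℕ → ℤ) (g : ℕ) (hne : ∀ k, k ≠ g + 1 → H' k = H k) (h1 : min (H g) (H (g+2)) ≤ H (g+1))
    (h2 : H' (g+1) = H (g+2)) (j : ℕ) (hj : j ≠ g + 1) : Cn H' (g+1) j ↔ Cn H (g+2) j := by
  unfold Cn
  rw [h2, hne j hj]
  refine and_congr_right fun e1 => ⟨fun h k hk => ?_, fun h k hk => ?_⟩
  · by_cases hkf : k = g + 1
    · subst hkf
      have h4 := h g (by omega)
      rw [hne _ (by omega)] at h4
      rcases min_le_iff.1 h1 with h | h <;> omega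
    · by_cases hkg : k = g + 2
      · rw [hkg]
      · rw [← hne k hkf]; exact h k (by omega)
  · by_cases hkf : k = g + 1
    · rw [hkf, h2]
    · rw [hne k hkf]; exact h k (by omega)
/-- closing a valley -/
theorem U1 (H H' : ℕ → ℤ) (g : ℕ) (hne : ∀ k, k ≠ g + 1 → H' k = H k) (hl : H g = H (g+1) + 1) (hr : H (g+2) = H (g+1) + 1)
    (hz : H' (g+1) = H (g+1) + 1) (i j : ℕ) (hi : i ≠ g + 1) (hj : j ≠ g + 1) :
    Cn H' i j ↔ Cn H i j ∨ (Cn H i g ∧ Cn H (g+2) j) ∨ (Cn H i (g+2) ∧ Cn H g j) := by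
  unfold Cn
  rw [hne i hi, hne j hj]
  constructor
  · rintro ⟨e1, h⟩
    have h0 : ∀ k, k ≠ g + 1 → (i ≤ k ∧ k ≤ j ∨ j ≤ k ∧ k ≤ i) → H i ≤ H k := fun k h1 h2 => by rw [← hne k h1]; exact h k h2
    by_cases hc : (i ≤ g + 1 ∧ g + 1 ≤ j ∨ j ≤ g + 1 ∧ g + 1 ≤ i)
    · have h3 := h0 g (by omega) (by omega)
      by_cases hx : H i = H g
      · rcases hc with hc | hc
        · refine Or.inr (Or.inl ⟨⟨hx, fun k hk => h0 k (by omega) (by omega)⟩, by omega, fun k hk => ?_⟩)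
          have := h0 k (by omega) (by omega); omega
        · refine Or.inr (Or.inr ⟨⟨by omega, fun k hk => h0 k (by omega) (by omega)⟩, by omega, fun k hk => ?_⟩)
          have := h0 k (by omega) (by omega); omega
      · refine Or.inl ⟨e1, fun k hk => ?_⟩
        by_cases hkf : k = g + 1
        · subst hkf; omega
        · exact h0 k hkf hk
    · exact Or.inl ⟨e1, fun k hk => h0 k (by rintro rfl; exact hc hk) hk⟩
  · have key : ∀ k, H k ≤ H' k := by
      intro k
      by_cases hkf : k = g + 1
      · subst hkf; omega
      · rw [hne k hkf]
    rintro (⟨e1, h⟩ | ⟨⟨e1, h1⟩, e2, h2⟩ | ⟨⟨e1, h1⟩, e2, h2⟩)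
    · exact ⟨e1, fun k hk => (h k hk).trans (key k)⟩
    · refine ⟨by omega, fun k hk => ?_⟩
      have k1 := key k
      by_cases hkf : k = g + 1
      · subst hkf; omega
      · by_cases hc : (i ≤ k ∧ k ≤ g ∨ g ≤ k ∧ k ≤ i)
        · have := h1 k hc; omega
        · have := h2 k (by omega); omega
    · refine ⟨by omega, fun k hk => ?_⟩
      have k1 := key k
      by_cases hkf : k = g + 1
      · subst hkf; omega
      · by_cases hc : (i ≤ k ∧ k ≤ g + 2 ∨ g + 2 ≤ k ∧ k ≤ i)
        · have := h1 k hc; omega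
        · have := h2 k (by omega); omega
theorem U2 (H H' : ℕ → ℤ) (g : ℕ) (hne : ∀ k, k ≠ g + 1 → H' k = H k) (hl : H g = H (g+1) + 1) (hr : H (g+2) = H (g+1) + 1)
    (hz : H' (g+1) = H (g+1) + 1) (j : ℕ) (hj : j ≠ g + 1) :
    Cn H' (g+1) j ↔ Cn H g j ∨ Cn H (g+2) j := by
  unfold Cn
  rw [hz, hne j hj]
  constructor
  · rintro ⟨e1, h⟩
    by_cases hc : j ≤ g
    · refine Or.inl ⟨by omega, fun k hk => ?_⟩
      have := h k (by omega); rw [hne k (by omega)] at this; omega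
    · refine Or.inr ⟨by omega, fun k hk => ?_⟩
      have := h k (by omega); rw [hne k (by omega)] at this; omega
  · have key : ∀ k, H k ≤ H' k := by
      intro k
      by_cases hkf : k = g + 1
      · subst hkf; omega
      · rw [hne k hkf]
    rintro (⟨e1, h⟩ | ⟨e1, h⟩)
    · refine ⟨by omega, fun k hk => ?_⟩
      by_cases hkf : k = g + 1
      · subst hkf; omega
      · have := key k; 
        by_cases hc : g + 1 ≤ j
        · have := h (g+1) (by omega); omega
        · have := h k (by omega); omega
    · refine ⟨by omega, fun k hk => ?_⟩
      by_cases hkf : k = g + 1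
      · subst hkf; omega
      · have := key k; 
        by_cases hc : j ≤ g + 1
        · have := h (g+1) (by omega); omega
        · have := h k (by omega); omega
/-- joining with a flip on the right -/
theorem W1lt (H H' : ℕ → ℤ) (g q : ℕ) (hq : g + 2 < q) (hl : H g = H (g+1) - 1) (hr : H (g+2) = H (g+1) + 1)
    (hq1 : H q = H (g+1)) (hq2 : ∀ k, g + 2 ≤ k → k < q → H (g+1) + 1 ≤ H k) (hq3 : H (q - 1) = H (g+1) + 1)
    (h1 : ∀ k, k < g + 1 ∨ q ≤ k → H' k = H k) (h2 : ∀ k, g + 2 ≤ k → k < q → H' k = H k - 2) (h3 : H' (g+1) = H g)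
    (i j : ℕ) (hij : i ≤ j) (hi : i ≠ g + 1) (hj : j ≠ g + 1) :
    Cn H' i j ↔ Cn H i j ∨ (Cn H i g ∧ Cn H (g+2) j) ∨ (Cn H i (g+2) ∧ Cn H g j) := by
  unfold Cn
  have tri : ∀ k, (k ≤ g ∧ H' k = H k) ∨ (k = g + 1 ∧ H' k = H (g+1) - 1 ∧ H k = H (g+1)) ∨ (g + 2 ≤ k ∧ k < q ∧ H' k = H k - 2 ∧ H (g+1) + 1 ≤ H k)
      ∨ (q ≤ k ∧ H' k = H k) := by
    intro k
    rcases lt_trichotomy k (g+1) with h | h | h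
    · exact Or.inl ⟨by omega, h1 k (by omega)⟩
    · subst h; exact Or.inr (Or.inl ⟨rfl, by omega, rfl⟩)
    · by_cases h' : k < q
      · exact Or.inr (Or.inr (Or.inl ⟨by omega, h', h2 k (by omega) h', hq2 k (by omega) h'⟩))
      · exact Or.inr (Or.inr (Or.inr ⟨by omega, h1 k (by omega)⟩))
  have ti := tri i
  have tj := tri j
  constructor
  · rintro ⟨e1, h⟩
    by_cases ca : i ≤ g
    · by_cases cb : g + 2 ≤ j ∧ j < q
      · have k1 := h (g+1) (by omega)
        refine Or.inr (Or.inl ⟨⟨by omega, fun k hk => ?_⟩, by omega, fun k hk => ?_⟩)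
        · have := h k (by omega); have := tri k; omega
        · have := h k (by omega); have := tri k; omega
      · refine Or.inl ⟨by omega, fun k hk => ?_⟩
        have := h k (by omega); have := tri k
        by_cases cc : j ≤ g
        · omega
        · have := h (g+1) (by omega); omega
    · by_cases cb : i < q ∧ q ≤ j
      · have k1 := h (q-1) (by omega)
        have k2 := h q (by omega)
        have t1 := tri (q-1)
        have t2 := tri q
        refine Or.inr (Or.inr ⟨⟨by omega, fun k hk => ?_⟩, by omega, fun k hk => ?_⟩)
        · have := tri k; omega
        · by_cases cd : k ≤ i
          · have := tri k
            by_cases ce : k = g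
            · subst ce; omega
            · omega
          · have := tri k; have := h k (by omega); omega
      · refine Or.inl ⟨by omega, fun k hk => ?_⟩
        have := h k (by omega); have := tri k
        omega
  · rintro (⟨e1, h⟩ | ⟨⟨e1, k1⟩, e2, k2⟩ | ⟨⟨e1, k1⟩, e2, k2⟩)
    · by_cases ca : i ≤ g
      · by_cases cc : j ≤ g
        · exact ⟨by omega, fun k hk => by have := tri k; have := h k hk; omega⟩
        · have := h g (by omega)
          exact ⟨by omega, fun k hk => by have := tri k; have := h k hk; omega⟩
      · by_cases cb : i < q ∧ q ≤ j
        · have := h q (by omega); omega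
        · exact ⟨by omega, fun k hk => by have := tri k; have := h k hk; omega⟩
    · have tg := k2 g
      have tq := k2 q
      by_cases ca : j ≤ g
      · have := tg (by omega); omega
      · by_cases cb : q ≤ j
        · have := tq (by omega); omega
        · by_cases cc : i ≤ g
          · refine ⟨by omega, fun k hk => ?_⟩
            have := tri k
            by_cases cd : k ≤ g
            · have := k1 k (by omega); omega
            · omega
          · have := k1 g; omega
    · have tg := k1 g
      have tq := k1 q
      by_cases ca : i ≤ g
      · have := tg (by omega); omega
      · by_cases cb : q ≤ i
        · have := tq (by omega); omega
        · by_cases cc : q ≤ j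
          · refine ⟨by omega, fun k hk => ?_⟩
            have := tri k
            have := k2 k (by omega); omega
          · omega
theorem W1 (H H' : ℕ → ℤ) (g q : ℕ) (hq : g + 2 < q) (hl : H g = H (g+1) - 1) (hr : H (g+2) = H (g+1) + 1)
    (hq1 : H q = H (g+1)) (hq2 : ∀ k, g + 2 ≤ k → k < q → H (g+1) + 1 ≤ H k) (hq3 : H (q - 1) = H (g+1) + 1)
    (h1 : ∀ k, k < g + 1 ∨ q ≤ k → H' k = H k) (h2 : ∀ k, g + 2 ≤ k → k < q → H' k = H k - 2) (h3 : H' (g+1) = H g)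
    (i j : ℕ) (hi : i ≠ g + 1) (hj : j ≠ g + 1) :
    Cn H' i j ↔ Cn H i j ∨ (Cn H i g ∧ Cn H (g+2) j) ∨ (Cn H i (g+2) ∧ Cn H g j) := by
  rcases le_total i j with h | h
  · exact W1lt H H' g q hq hl hr hq1 hq2 hq3 h1 h2 h3 i j h hi hj
  · have := W1lt H H' g q hq hl hr hq1 hq2 hq3 h1 h2 h3 j i h hj hi
    rw [Cn_comm, this, Cn_comm (i := j), Cn_comm (i := j), Cn_comm (i := j), Cn_comm (j := i), Cn_comm (j := i)]
    tauto
theorem W2 (H H' : ℕ → ℤ) (g q : ℕ) (hq : g + 2 < q) (hl : H g = H (g+1) - 1) (hr : H (g+2) = H (g+1) + 1)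
    (hq1 : H q = H (g+1)) (hq2 : ∀ k, g + 2 ≤ k → k < q → H (g+1) + 1 ≤ H k)
    (h1 : ∀ k, k < g + 1 ∨ q ≤ k → H' k = H k) (h2 : ∀ k, g + 2 ≤ k → k < q → H' k = H k - 2) (h3 : H' (g+1) = H g)
    (j : ℕ) (hj : j ≠ g + 1) : Cn H' (g+1) j ↔ Cn H g j ∨ Cn H (g+2) j := by
  unfold Cn
  have tri : ∀ k, (k ≤ g ∧ H' k = H k) ∨ (k = g + 1 ∧ H' k = H (g+1) - 1 ∧ H k = H (g+1)) ∨ (g + 2 ≤ k ∧ k < q ∧ H' k = H k - 2 ∧ H (g+1) + 1 ≤ H k)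
      ∨ (q ≤ k ∧ H' k = H k) := by
    intro k
    rcases lt_trichotomy k (g+1) with h | h | h
    · exact Or.inl ⟨by omega, h1 k (by omega)⟩
    · subst h; exact Or.inr (Or.inl ⟨rfl, by omega, rfl⟩)
    · by_cases h' : k < q
      · exact Or.inr (Or.inr (Or.inl ⟨by omega, h', h2 k (by omega) h', hq2 k (by omega) h'⟩))
      · exact Or.inr (Or.inr (Or.inr ⟨by omega, h1 k (by omega)⟩))
  have tj := tri j
  constructor
  · rintro ⟨e1, h⟩
    by_cases ca : g + 2 ≤ j ∧ j < q
    · refine Or.inr ⟨by omega, fun k hk => ?_⟩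
      have := tri k; omega
    · refine Or.inl ⟨by omega, fun k hk => ?_⟩
      have := tri k
      by_cases cb : k = g
      · rw [cb]
      · have := h k (by omega); omega
  · rintro (⟨e1, h⟩ | ⟨e1, h⟩)
    · refine ⟨by omega, fun k hk => ?_⟩
      have := tri k
      by_cases cb : k = g + 1
      · rw [cb]
      · have := h k (by omega); omega
    · have tg := h g
      have tq := h q
      refine ⟨by omega, fun k hk => ?_⟩
      have := tri k; omega
end G
end

set_option linter.all false
noncomputable section
namespace G
open Sy
theorem Cn_rev (H : ℕ → ℤ) (N i j : ℕ) (hi : i ≤ N) (hj : j ≤ N) : Cn (fun k => H (N - k)) (N - i) (N - j) ↔ Cn H i j := by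
  unfold Cn
  have e1 : N - (N - i) = i := by omega
  have e2 : N - (N - j) = j := by omega
  simp only [e1, e2]
  refine and_congr_right fun _ => ⟨fun h k hk => ?_, fun h k hk => h _ (by omega)⟩
  have := h (N - k) (by omega)
  rwa [show N - (N - k) = k by omega] at this
theorem W1' (H H' : ℕ → ℤ) (g q : ℕ) (hq : q < g) (hl : H g = H (g+1) + 1) (hr : H (g+2) = H (g+1) - 1)
    (hq1 : H q = H (g+1)) (hq2 : ∀ k, q < k → k ≤ g → H (g+1) + 1 ≤ H k) (hq3 : H (q + 1) = H (g+1) + 1)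
    (h1 : ∀ k, k ≤ q ∨ g + 1 < k → H' k = H k) (h2 : ∀ k, q < k → k ≤ g → H' k = H k - 2) (h3 : H' (g+1) = H (g+2))
    (i j : ℕ) (hi : i ≠ g + 1) (hj : j ≠ g + 1) :
    Cn H' i j ↔ Cn H i j ∨ (Cn H i g ∧ Cn H (g+2) j) ∨ (Cn H i (g+2) ∧ Cn H g j) := by
  obtain ⟨N, hN⟩ : ∃ N, N = i + j + g + 2 := ⟨_, rfl⟩
  have e0 : N - (N - (g + 2)) = g + 2 := by omega
  have e1 : N - (N - (g + 2) + 1) = g + 1 := by omega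
  have e2 : N - (N - (g + 2) + 2) = g := by omega
  have e3 : N - (N - q) = q := by omega
  have e4 : N - (N - q - 1) = q + 1 := by omega
  have := W1 (fun k => H (N - k)) (fun k => H' (N - k)) (N - (g + 2)) (N - q) (by omega) (by simp only [e0, e1]; omega)
    (by simp only [e1, e2]; omega) (by simp only [e3, e1]; omega) (fun k hk hk' => by simp only [e1]; exact hq2 _ (by omega) (by omega))
    (by simp only [e4, e1]; omega) (fun k hk => h1 _ (by omega)) (fun k hk hk' => h2 _ (by omega) (by omega))
    (by simp only [e1, e0]; exact h3) (N - i) (N - j) (by omega) (by omega)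
  rw [show N - (g + 2) + 2 = N - g by omega] at this
  simp only [Cn_rev H N _ _ (show i ≤ N by omega) (show j ≤ N by omega), Cn_rev H' N _ _ (show i ≤ N by omega) (show j ≤ N by omega),
    Cn_rev H N _ _ (show i ≤ N by omega) (show g + 2 ≤ N by omega), Cn_rev H N _ _ (show i ≤ N by omega) (show g ≤ N by omega),
    Cn_rev H N _ _ (show g + 2 ≤ N by omega) (show j ≤ N by omega), Cn_rev H N _ _ (show g ≤ N by omega) (show j ≤ N by omega)] at this
  rw [this]; tauto
theorem W2' (H H' : ℕ → ℤ) (g q : ℕ) (hq : q < g) (hl : H g = H (g+1) + 1) (hr : H (g+2) = H (g+1) - 1)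
    (hq1 : H q = H (g+1)) (hq2 : ∀ k, q < k → k ≤ g → H (g+1) + 1 ≤ H k)
    (h1 : ∀ k, k ≤ q ∨ g + 1 < k → H' k = H k) (h2 : ∀ k, q < k → k ≤ g → H' k = H k - 2) (h3 : H' (g+1) = H (g+2))
    (j : ℕ) (hj : j ≠ g + 1) :
    Cn H' (g+1) j ↔ Cn H g j ∨ Cn H (g+2) j := by
  obtain ⟨N, hN⟩ : ∃ N, N = j + g + 2 := ⟨_, rfl⟩
  have e0 : N - (N - (g + 2)) = g + 2 := by omega
  have e1 : N - (N - (g + 2) + 1) = g + 1 := by omega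
  have e2 : N - (N - (g + 2) + 2) = g := by omega
  have e3 : N - (N - q) = q := by omega
  have := W2 (fun k => H (N - k)) (fun k => H' (N - k)) (N - (g + 2)) (N - q) (by omega) (by simp only [e0, e1]; omega)
    (by simp only [e1, e2]; omega) (by simp only [e3, e1]; omega) (fun k hk hk' => by simp only [e1]; exact hq2 _ (by omega) (by omega))
    (fun k hk => h1 _ (by omega)) (fun k hk hk' => h2 _ (by omega) (by omega))
    (by simp only [e1, e0]; exact h3) (N - j) (by omega)
  rw [show N - (g + 2) + 2 = N - g by omega, show N - (g + 2) + 1 = N - (g + 1) by omega] at this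
  simp only [Cn_rev H' N _ _ (show g + 1 ≤ N by omega) (show j ≤ N by omega),
    Cn_rev H N _ _ (show g + 2 ≤ N by omega) (show j ≤ N by omega), Cn_rev H N _ _ (show g ≤ N by omega) (show j ≤ N by omega)] at this
  rw [this]; tauto
/-- value of a symbol -/
def sv : Sy → ℤ
  | e => 0
  | u => 1
  | d => -1
/-- word read outwards to the left of a position -/
def LWd (H : ℕ → ℤ) (f : ℕ) (w : List Sy) : Prop :=
  match w with
  | [] => f = 0
  | a :: w => match f with
    | 0 => False
    | f + 1 => H f = H (f + 1) + sv a ∧ LWd H f w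
termination_by structural w
/-- word read outwards to the right of a position, up to position `n` -/
def RWd (n : ℕ) (H : ℕ → ℤ) : ℕ → List Sy → Prop
  | f, [] => f = n
  | f, a :: w => H (f + 1) = H f + sv a ∧ RWd n H (f + 1) w
theorem LWd_congr {H H' : ℕ → ℤ} {f : ℕ} {w : List Sy} (c : ℤ) (h : LWd H f w) (hh : ∀ k, k ≤ f → H' k = H k) : LWd H' f w := by
  induction w generalizing f with
  | nil => exact h
  | cons a w ih =>
    cases f with
    | zero => exact h
    | succ f => exact ⟨by rw [hh _ (by omega), hh _ le_rfl]; exact h.1, ih h.2 fun k hk => hh k (by omega)⟩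
theorem RWd_congr {n : ℕ} {H H' : ℕ → ℤ} {f : ℕ} {w : List Sy} (h : RWd n H f w) (hh : ∀ k, f ≤ k → H' k = H k) : RWd n H' f w := by
  induction w generalizing f with
  | nil => exact h
  | cons a w ih => exact ⟨by rw [hh _ (by omega), hh _ le_rfl]; exact h.1, ih h.2 fun k hk => hh k (by omega)⟩
theorem LWd_len {H : ℕ → ℤ} {f : ℕ} {w : List Sy} (h : LWd H f w) : w.length = f := by
  induction w generalizing f with
  | nil => exact h.symm
  | cons a w ih =>
    cases f with
    | zero => exact h.elim
    | succ f => simp [ih h.2]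
theorem RWd_len {n : ℕ} {H : ℕ → ℤ} {f : ℕ} {w : List Sy} (h : RWd n H f w) : f + w.length = n := by
  induction w generalizing f with
  | nil => exact h
  | cons a w ih => have := ih h.2; simp; omega
theorem fl_right {n : ℕ} {H : ℕ → ℤ} {f : ℕ} {s : List Sy} (j : ℕ) (h : RWd n H f s) (hn : H n < H f - j) :
    ∃ s' q, fl j s = some s' ∧ f < q ∧ q ≤ n ∧ H q = H f - j - 1 ∧ H (q - 1) = H f - j ∧ (∀ k, f ≤ k → k < q → H f - j ≤ H k) ∧
      ∀ H' : ℕ → ℤ, (∀ k, q ≤ k → H' k = H k) → (∀ k, f ≤ k → k < q → H' k = H k - 2) → RWd n H' f s' := by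
  induction s generalizing f j with
  | nil => exact absurd hn (by rw [show n = f from h.symm]; omega)
  | cons a s ih =>
    obtain ⟨h1, h2⟩ := h
    have hln := RWd_len h2
    have step : ∀ (j' : ℕ), H (f+1) - j' = H f - j → ∃ s' q, fl j' s = some s' ∧ f + 1 < q ∧ q ≤ n ∧ H q = H f - j - 1 ∧ H (q - 1) = H f - j ∧ (∀ k, f ≤ k → k < q → H f - j ≤ H k) ∧
      ∀ H' : ℕ → ℤ, (∀ k, q ≤ k → H' k = H k) → (∀ k, f ≤ k → k < q → H' k = H k - 2) → RWd n H' f (a :: s') := by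
      intro j' hj'
      obtain ⟨s', q, k1, k2, k3, k4, k5, k6, k7⟩ := ih j' h2 (by omega)
      refine ⟨s', q, k1, k2, k3, by omega, by omega, ?_, ?_⟩
      · intro k hk hk'
        rcases Nat.lt_or_ge f k with hh | hh
        · have := k6 k hh hk'; omega
        · rw [show k = f by omega]; omega
      · intro H' hH1 hH2
        refine ⟨by rw [hH2 _ (by omega) k2, hH2 f le_rfl (by omega), h1]; ring, k7 H' hH1 fun k hk hk' => hH2 k (by omega) hk'⟩
    cases a with
    | e =>
      obtain ⟨s', q, k1, k⟩ := step j (by simp [h1, sv])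
      exact ⟨e :: s', q, by simp [fl, k1], by omega, k.2⟩
    | u =>
      obtain ⟨s', q, k1, k⟩ := step (j+1) (by simp [h1, sv])
      exact ⟨u :: s', q, by simp [fl, k1], by omega, k.2⟩
    | d =>
      cases j with
      | zero =>
        refine ⟨u :: s, f + 1, rfl, by omega, by omega, by rw [h1]; simp [sv]; ring, by simp, ?_, ?_⟩
        · intro k hk hk'
          rw [show k = f by omega]; simp
        · intro H' hH1 hH2
          refine ⟨by rw [hH1 _ le_rfl, hH2 f le_rfl (by omega), h1]; simp [sv]; ring, RWd_congr h2 hH1⟩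
      | succ j =>
        obtain ⟨s', q, k1, k⟩ := step j (by rw [h1]; push_cast; simp [sv]; ring)
        exact ⟨d :: s', q, by simp [fl, k1], by omega, k.2⟩
theorem fl_left {H : ℕ → ℤ} {f : ℕ} {s : List Sy} (j : ℕ) (h : LWd H f s) (hn : H 0 < H f - j) :
    ∃ s' q, fl j s = some s' ∧ q < f ∧ H q = H f - j - 1 ∧ H (q + 1) = H f - j ∧ (∀ k, q < k → k ≤ f → H f - j ≤ H k) ∧
      ∀ H' : ℕ → ℤ, (∀ k, k ≤ q → H' k = H k) → (∀ k, q < k → k ≤ f → H' k = H k - 2) → LWd H' f s' := by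
  induction s generalizing f j with
  | nil => exact absurd hn (by rw [show f = 0 from h]; omega)
  | cons a s ih =>
    cases f with
    | zero => exact h.elim
    | succ f =>
    obtain ⟨h1, h2⟩ := h
    have step : ∀ (j' : ℕ), H f - j' = H (f+1) - j → ∃ s' q, fl j' s = some s' ∧ q < f ∧ H q = H (f+1) - j - 1 ∧ H (q + 1) = H (f+1) - j ∧ (∀ k, q < k → k ≤ f + 1 → H (f+1) - j ≤ H k) ∧
      ∀ H' : ℕ → ℤ, (∀ k, k ≤ q → H' k = H k) → (∀ k, q < k → k ≤ f + 1 → H' k = H k - 2) → LWd H' (f+1) (a :: s') := by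
      intro j' hj'
      obtain ⟨s', q, k1, k2, k4, k5, k6, k7⟩ := ih j' h2 (by omega)
      refine ⟨s', q, k1, k2, by omega, by omega, ?_, ?_⟩
      · intro k hk hk'
        rcases Nat.lt_or_ge f k with hh | hh
        · rw [show k = f + 1 by omega]; omega
        · have := k6 k hk hh; omega
      · intro H' hH1 hH2
        refine ⟨by rw [hH2 _ (by omega) (by omega), hH2 (f+1) (by omega) (by omega), h1]; ring, k7 H' hH1 fun k hk hk' => hH2 k (by omega) (by omega)⟩
    cases a with
    | e =>
      obtain ⟨s', q, k1, k⟩ := step j (by simp [h1, sv])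
      exact ⟨e :: s', q, by simp [fl, k1], by omega, k.2⟩
    | u =>
      obtain ⟨s', q, k1, k⟩ := step (j+1) (by simp [h1, sv])
      exact ⟨u :: s', q, by simp [fl, k1], by omega, k.2⟩
    | d =>
      cases j with
      | zero =>
        refine ⟨u :: s, f, rfl, by omega, by rw [h1]; simp [sv]; ring, by simp, ?_, ?_⟩
        · intro k hk hk'
          rw [show k = f + 1 by omega]; simp
        · intro H' hH1 hH2
          refine ⟨by rw [hH1 _ le_rfl, hH2 (f+1) (by omega) (by omega), h1]; simp [sv]; ring, LWd_congr 0 h2 hH1⟩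
      | succ j =>
        obtain ⟨s', q, k1, k⟩ := step j (by rw [h1]; push_cast; simp [sv]; ring)
        exact ⟨d :: s', q, by simp [fl, k1], by omega, k.2⟩
/-- a position of the same height is found before descending -/
theorem find_left {H : ℕ → ℤ} {f : ℕ} {w : List Sy} (x : ℤ) (h : LWd H f w) (hx : x < H f) (h0 : H 0 ≤ x) :
    ∃ q, q < f ∧ H q = x ∧ ∀ k, q < k → k ≤ f → x < H k := by
  induction w generalizing f with
  | nil => rw [show f = 0 from h] at hx; omega
  | cons a w ih =>
    cases f with
    | zero => exact h.elim
    | succ f =>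
      obtain ⟨h1, h2⟩ := h
      by_cases hc : x < H f
      · obtain ⟨q, k1, k2, k3⟩ := ih h2 hc
        refine ⟨q, by omega, k2, fun k hk hk' => ?_⟩
        rcases Nat.lt_or_ge f k with hh | hh
        · rwa [show k = f + 1 by omega]
        · exact k3 k hk hh
      · refine ⟨f, by omega, ?_, fun k hk hk' => by rwa [show k = f + 1 by omega]⟩
        cases a <;> simp [sv] at h1 <;> omega
theorem find_right {n : ℕ} {H : ℕ → ℤ} {f : ℕ} {w : List Sy} (x : ℤ) (h : RWd n H f w) (hx : x < H f) (h0 : H n ≤ x) :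
    ∃ q, f < q ∧ q ≤ n ∧ H q = x ∧ ∀ k, f ≤ k → k < q → x < H k := by
  induction w generalizing f with
  | nil => rw [show n = f from h.symm] at h0; omega
  | cons a w ih =>
      obtain ⟨h1, h2⟩ := h
      have hln := RWd_len h2
      by_cases hc : x < H (f+1)
      · obtain ⟨q, k1, k1', k2, k3⟩ := ih h2 hc
        refine ⟨q, by omega, k1', k2, fun k hk hk' => ?_⟩
        rcases Nat.lt_or_ge f k with hh | hh
        · exact k3 k hh hk'
        · rwa [show k = f by omega]
      · refine ⟨f + 1, by omega, by omega, ?_, fun k hk hk' => by rwa [show k = f by omega]⟩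
        cases a <;> simp [sv] at h1 <;> omega
end G
end

set_option linter.all false
noncomputable section
namespace G
open Sy
section conn
variable {V : Type}
/-- connection inside `P` by cells of one colour -/
def Co (ad : V → V → Prop) (c : V → Bool) (P : Set V) : V → V → Prop :=
  Relation.ReflTransGen (fun u v => ad u v ∧ u ∈ P ∧ v ∈ P ∧ c u = c v)
variable {ad : V → V → Prop} {c : V → Bool} {P : Set V}
theorem Co.refl (u : V) : Co ad c P u u := Relation.ReflTransGen.refl
theorem Co.trans {u v w : V} (h : Co ad c P u v) (h' : Co ad c P v w) : Co ad c P u w := Relation.ReflTransGen.trans h h'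
theorem Co.symm (hs : ∀ u v, ad u v → ad v u) {u v : V} (h : Co ad c P u v) : Co ad c P v u := by
  induction h with
  | refl => exact Co.refl _
  | tail _ h ih => exact Relation.ReflTransGen.head ⟨hs _ _ h.1, h.2.2.1, h.2.1, h.2.2.2.symm⟩ ih
theorem Co.col {u v : V} (h : Co ad c P u v) : c u = c v := by
  induction h with
  | refl => rfl
  | tail _ h ih => exact ih.trans h.2.2.2
theorem Co.mono {P' : Set V} (hP : P ⊆ P') {u v : V} (h : Co ad c P u v) : Co ad c P' u v :=
  Relation.ReflTransGen.mono (fun a b h => ⟨h.1, hP h.2.1, hP h.2.2.1, h.2.2.2⟩) _ _ h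
theorem Co.mem {u v : V} (h : Co ad c P u v) (hu : u ∈ P) : v ∈ P := by
  induction h with
  | refl => exact hu
  | tail _ h ih => exact h.2.2.1
theorem Co.single {u v : V} (h : ad u v) (hu : u ∈ P) (hv : v ∈ P) (hc : c u = c v) : Co ad c P u v :=
  Relation.ReflTransGen.single ⟨h, hu, hv, hc⟩
theorem addz (hs : ∀ u v, ad u v → ad v u) (hir : ∀ u, ¬ ad u u) (z : V) (hz : z ∉ P) (u v : V) (hu : u ≠ z) (hv : v ≠ z) :
    Co ad c (insert z P) u v ↔ Co ad c P u v ∨ ∃ a b, (a ∈ P ∧ ad a z ∧ c a = c z) ∧ (b ∈ P ∧ ad b z ∧ c b = c z) ∧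
      Co ad c P u a ∧ Co ad c P b v := by
  constructor
  · intro h
    have key : ∀ w, Co ad c (insert z P) u w → (w = z → ∃ a, (a ∈ P ∧ ad a z ∧ c a = c z) ∧ Co ad c P u a) ∧
        (w ≠ z → Co ad c P u w ∨ ∃ a b, (a ∈ P ∧ ad a z ∧ c a = c z) ∧ (b ∈ P ∧ ad b z ∧ c b = c z) ∧ Co ad c P u a ∧ Co ad c P b w) := by
      intro w hw
      induction hw with
      | refl => exact ⟨fun h => absurd h hu, fun _ => Or.inl (Co.refl _)⟩
      | @tail x y hx hxy ih =>
        obtain ⟨h1, h2, h3, h4⟩ := hxy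
        by_cases hxz : x = z
        · subst hxz
          obtain ⟨a, ha, ha'⟩ := ih.1 rfl
          refine ⟨fun h => ?_, fun h => ?_⟩
          · subst h; exact absurd h1 (hir _)
          · refine Or.inr ⟨a, y, ha, ⟨?_, hs _ _ h1, h4.symm⟩, ha', Co.refl _⟩
            rcases h3 with h3 | h3
            · exact absurd h3 h
            · exact h3
        · have hxP : x ∈ P := by
            rcases h2 with h2 | h2
            · exact absurd h2 hxz
            · exact h2
          refine ⟨fun h => ?_, fun h => ?_⟩
          · subst h
            rcases ih.2 hxz with k | ⟨a, b, ha, hb, k1, k2⟩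
            · exact ⟨x, ⟨hxP, h1, h4⟩, k⟩
            · exact ⟨a, ha, k1⟩
          · have hyP : y ∈ P := by
              rcases h3 with h3 | h3
              · exact absurd h3 h
              · exact h3
            rcases ih.2 hxz with k | ⟨a, b, ha, hb, k1, k2⟩
            · exact Or.inl (k.trans (Co.single h1 hxP hyP h4))
            · exact Or.inr ⟨a, b, ha, hb, k1, k2.trans (Co.single h1 hxP hyP h4)⟩
    exact (key v h).2 hv
  · have hsub : P ⊆ insert z P := Set.subset_insert z P
    rintro (h | ⟨a, b, ha, hb, k1, k2⟩)
    · exact h.mono hsub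
    · have e1 : Co ad c (insert z P) a z := Co.single ha.2.1 (hsub ha.1) (Set.mem_insert _ _) ha.2.2
      have e2 : Co ad c (insert z P) z b := Co.single (hs _ _ hb.2.1) (Set.mem_insert _ _) (hsub hb.1) hb.2.2.symm
      exact ((k1.mono hsub).trans e1).trans (e2.trans (k2.mono hsub))
theorem addz' (hs : ∀ u v, ad u v → ad v u) (hir : ∀ u, ¬ ad u u) (z : V) (hz : z ∉ P) (v : V) (hv : v ≠ z) :
    Co ad c (insert z P) z v ↔ ∃ b, (b ∈ P ∧ ad b z ∧ c b = c z) ∧ Co ad c P b v := by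
  have hsub : P ⊆ insert z P := Set.subset_insert z P
  constructor
  · intro h
    rcases Relation.ReflTransGen.cases_head h with h | ⟨w, h1, h2⟩
    · exact absurd h.symm hv
    · have hwz : w ≠ z := by rintro rfl; exact hir _ h1.1
      have hwP : w ∈ P := by
        rcases h1.2.2.1 with h3 | h3
        · exact absurd h3 hwz
        · exact h3
      rcases (addz hs hir z hz w v hwz hv).1 h2 with k | ⟨a, b, ha, hb, k1, k2⟩
      · exact ⟨w, ⟨hwP, hs _ _ h1.1, h1.2.2.2.symm⟩, k⟩
      · exact ⟨b, hb, k2⟩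
  · rintro ⟨b, hb, k⟩
    exact (Co.single (hs _ _ hb.2.1) (Set.mem_insert _ _) (hsub hb.1) hb.2.2.symm).trans (k.mono hsub)
/-- frontier invariant -/
structure Inv (ad : V → V → Prop) (c : V → Bool) (P : Set V) (n : ℕ) (φ : ℕ → V) (H : ℕ → ℤ) : Prop where
  mem : ∀ k, k ≤ n → φ k ∈ P
  con : ∀ j k, j ≤ n → k ≤ n → (Co ad c P (φ j) (φ k) ↔ Cn H j k)
  cov : ∀ v ∈ P, ∃ k, k ≤ n ∧ Co ad c P v (φ k)
  col : ∀ k, k ≤ n → (c (φ k) = true ↔ Even (H k))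
  nn : ∀ k, k ≤ n → 0 ≤ H k
  b0 : H 0 ≤ 1
  bn : H n ≤ 1
  bb : H 0 = 0 ∨ H n = 0
theorem step_mk {n : ℕ} {φ φ' : ℕ → V} {H H' : ℕ → ℤ} (hs : ∀ u v, ad u v → ad v u) (hir : ∀ u, ¬ ad u u)
    (J : Inv ad c P n φ H) (z : V) (hz : z ∉ P) (g : ℕ) (hg : g + 2 ≤ n) (hN : ∀ v ∈ P, ad v z ↔ v = φ g ∨ v = φ (g + 2))
    (hp1 : φ' (g + 1) = z) (hp2 : ∀ k, k ≠ g + 1 → φ' k = φ k)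
    (h1 : ∀ i j, i ≠ g + 1 → j ≠ g + 1 → (Cn H' i j ↔ Cn H i j ∨ (c (φ g) = c z ∧ c (φ (g + 2)) = c z) ∧
      (Cn H i g ∧ Cn H (g + 2) j ∨ Cn H i (g + 2) ∧ Cn H g j)))
    (h2 : ∀ j, j ≠ g + 1 → (Cn H' (g + 1) j ↔ c (φ g) = c z ∧ Cn H g j ∨ c (φ (g + 2)) = c z ∧ Cn H (g + 2) j))
    (hcov : ∃ k, k ≤ n ∧ k ≠ g + 1 ∧ Cn H (g + 1) k)
    (hcol : c z = true ↔ Even (H' (g + 1))) (hcol' : ∀ k, k ≤ n → k ≠ g + 1 → (Even (H' k) ↔ Even (H k)))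
    (hnn : ∀ k, k ≤ n → 0 ≤ H' k) (h0 : H' 0 = H 0) (hn : H' n = H n) : Inv ad c (insert z P) n φ' H' := by
  have hne : ∀ k, k ≤ n → φ k ≠ z := fun k hk h => hz (h ▸ J.mem k hk)
  have hg0 := J.mem g (by omega)
  have hg2 := J.mem (g + 2) hg
  have nb : ∀ b, (b ∈ P ∧ ad b z ∧ c b = c z) ↔ (b = φ g ∧ c (φ g) = c z) ∨ (b = φ (g + 2) ∧ c (φ (g + 2)) = c z) := by
    intro b
    constructor
    · rintro ⟨k1, k2, k3⟩
      rcases (hN b k1).1 k2 with rfl | rfl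
      · exact Or.inl ⟨rfl, k3⟩
      · exact Or.inr ⟨rfl, k3⟩
    · rintro (⟨rfl, k⟩ | ⟨rfl, k⟩)
      · exact ⟨hg0, (hN _ hg0).2 (Or.inl rfl), k⟩
      · exact ⟨hg2, (hN _ hg2).2 (Or.inr rfl), k⟩
  have hz1 : ∀ j, j ≤ n → j ≠ g + 1 → (Co ad c (insert z P) z (φ j) ↔ Cn H' (g + 1) j) := by
    intro j hj hj'
    rw [addz' hs hir z hz _ (hne j hj), h2 j hj', ← J.con g j (by omega) hj, ← J.con (g + 2) j hg hj]
    simp only [nb]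
    constructor
    · rintro ⟨b, ⟨rfl, k1⟩ | ⟨rfl, k1⟩, k2⟩
      · exact Or.inl ⟨k1, k2⟩
      · exact Or.inr ⟨k1, k2⟩
    · rintro (⟨k1, k2⟩ | ⟨k1, k2⟩)
      · exact ⟨_, Or.inl ⟨rfl, k1⟩, k2⟩
      · exact ⟨_, Or.inr ⟨rfl, k1⟩, k2⟩
  refine ⟨?_, ?_, ?_, ?_, hnn, h0 ▸ J.b0, hn ▸ J.bn, by rw [h0, hn]; exact J.bb⟩
  · intro k hk
    by_cases hk' : k = g + 1
    · subst hk'; rw [hp1]; exact Set.mem_insert _ _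
    · rw [hp2 k hk']; exact Set.mem_insert_of_mem _ (J.mem k hk)
  · intro i j hi hj
    by_cases hi' : i = g + 1
    · subst hi'
      by_cases hj' : j = g + 1
      · subst hj'; exact ⟨fun _ => Cn.refl _ _, fun _ => Co.refl _⟩
      · rw [hp1, hp2 j hj']; exact hz1 j hj hj'
    · by_cases hj' : j = g + 1
      · subst hj'
        rw [hp1, hp2 i hi', Cn_comm, ← hz1 i hi hi']
        exact ⟨Co.symm hs, Co.symm hs⟩
      · rw [hp2 i hi', hp2 j hj', addz hs hir z hz _ _ (hne i hi) (hne j hj), h1 i j hi' hj']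
        simp only [nb]
        rw [← J.con i j hi hj, ← J.con i g hi (by omega), ← J.con i (g+2) hi hg, ← J.con g j (by omega) hj, ← J.con (g + 2) j hg hj]
        constructor
        · rintro (k | ⟨a, b, ⟨rfl, k1⟩ | ⟨rfl, k1⟩, ⟨rfl, k2⟩ | ⟨rfl, k2⟩, k3, k4⟩)
          · exact Or.inl k
          · exact Or.inl (k3.trans k4)
          · exact Or.inr ⟨⟨k1, k2⟩, Or.inl ⟨k3, k4⟩⟩
          · exact Or.inr ⟨⟨k2, k1⟩, Or.inr ⟨k3, k4⟩⟩
          · exact Or.inl (k3.trans k4)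
        · rintro (k | ⟨⟨k1, k2⟩, ⟨k3, k4⟩ | ⟨k3, k4⟩⟩)
          · exact Or.inl k
          · exact Or.inr ⟨_, _, Or.inl ⟨rfl, k1⟩, Or.inr ⟨rfl, k2⟩, k3, k4⟩
          · exact Or.inr ⟨_, _, Or.inr ⟨rfl, k2⟩, Or.inl ⟨rfl, k1⟩, k3, k4⟩
  · intro v hv
    rcases hv with hv | hv
    · exact ⟨g + 1, by omega, by rw [hp1, hv]; exact Co.refl _⟩
    · obtain ⟨k, hk, hvk⟩ := J.cov v hv
      have hvk' : Co ad c (insert z P) v (φ k) := hvk.mono (Set.subset_insert z P)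
      by_cases hkg : k = g + 1
      · subst hkg
        obtain ⟨k, k1, k2, k3⟩ := hcov
        refine ⟨k, k1, hvk'.trans ?_⟩
        rw [hp2 k k2]
        exact ((J.con _ _ hk k1).2 k3).mono (Set.subset_insert z P)
      · exact ⟨k, hk, by rw [hp2 k hkg]; exact hvk'⟩
  · intro k hk
    by_cases hk' : k = g + 1
    · subst hk'; rw [hp1]; exact hcol
    · rw [hp2 k hk', J.col k hk, hcol' k hk hk']
theorem step {n : ℕ} {φ φ' : ℕ → V} {H : ℕ → ℤ} (hs : ∀ u v, ad u v → ad v u) (hir : ∀ u, ¬ ad u u)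
    (J : Inv ad c P n φ H) (z : V) (hz : z ∉ P) (g : ℕ) (hg : g + 2 ≤ n) (hN : ∀ v ∈ P, ad v z ↔ v = φ g ∨ v = φ (g + 2))
    (hp1 : φ' (g + 1) = z) (hp2 : ∀ k, k ≠ g + 1 → φ' k = φ k) (p : List Sy) (l a : Sy) (s : List Sy)
    (hL : LWd H (g + 1) (l :: p)) (hR : RWd n H (g + 1) (a :: s)) :
    (∃ p' l' s' H', tr p l a s (c z != c (φ g)) = .nx p' l' s' ∧ Inv ad c (insert z P) n φ' H' ∧ LWd H' (g + 2) (l' :: p') ∧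
      RWd n H' (g + 2) s') ∨
    (l ≠ e ∧ a ≠ e ∧ c z ≠ c (φ g) ∧ tr p l a s (c z != c (φ g)) = .dead) ∨ (l = d ∧ a = d ∧ c z = c (φ g)) := by
  obtain ⟨hl, hL⟩ := hL
  obtain ⟨ha, hR⟩ := hR
  replace ha : H (g + 2) = H (g + 1) + sv a := ha
  replace hR : RWd n H (g + 2) s := hR
  have mk := fun H' => step_mk (H' := H') hs hir J z hz g hg hN hp1 hp2
  have cg := J.col g (by omega)
  have cg1 := J.col (g + 1) (by omega)
  have cg2 := J.col (g + 2) hg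
  -- a simple update
  have upd : ∀ x : ℤ, 0 ≤ x → min (H g) (H (g+2)) ≤ H (g+1) → min (H g) (H (g+2)) ≤ x → (c z = true ↔ Even x) →
      (Cn H (g+1) g ∨ Cn H (g+1) (g+2)) → ((c (φ g) = c z ∧ c (φ (g + 2)) = c z) → Cn H g (g+2)) →
      (∀ j, j ≠ g + 1 → (Cn (Function.update H (g+1) x) (g + 1) j ↔ c (φ g) = c z ∧ Cn H g j ∨ c (φ (g + 2)) = c z ∧ Cn H (g + 2) j)) →
      Inv ad c (insert z P) n φ' (Function.update H (g+1) x) := by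
    intro x k1 k2 k3 k4 k5 k6 k7
    have hne : ∀ k, k ≠ g + 1 → Function.update H (g+1) x k = H k := fun k hk => Function.update_of_ne hk _ _
    have hsf : Function.update H (g+1) x (g+1) = x := Function.update_self _ _ _
    refine mk _ ?_ k7 ?_ (by rw [hsf]; exact k4) (fun k hk hk' => by rw [hne k hk']) ?_ (hne _ (by omega)) (hne _ (by omega))
    · intro i j hi hj
      rw [SU1 H _ g hne k2 (by rw [hsf]; exact k3) i j hi hj]
      constructor
      · exact Or.inl
      · rintro (h | ⟨h, ⟨h1, h2⟩ | ⟨h1, h2⟩⟩)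
        · exact h
        · exact (h1.trans (k6 h)).trans h2
        · exact (h1.trans (k6 h).symm).trans h2
    · rcases k5 with k | k
      · exact ⟨g, by omega, by omega, k⟩
      · exact ⟨g + 2, by omega, by omega, k⟩
    · intro k hk
      by_cases hk' : k = g + 1
      · rw [hk', hsf]; exact k1
      · rw [hne k hk']; exact J.nn k hk
  have words : ∀ (x : ℤ) (l' a1 : Sy), x = H (g+2) + sv l' → H g = x + sv a1 → LWd (Function.update H (g+1) x) (g + 2) (l' :: a1 :: p) ∧
      RWd n (Function.update H (g+1) x) (g + 2) s := by
    intro x l' a1 k1 k2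
    have hne : ∀ k, k ≠ g + 1 → Function.update H (g+1) x k = H k := fun k hk => Function.update_of_ne hk _ _
    have hsf : Function.update H (g+1) x (g+1) = x := Function.update_self _ _ _
    refine ⟨⟨?_, ?_, ?_⟩, ?_⟩
    · rw [hsf, hne _ (by omega)]; exact k1
    · rw [hsf, hne _ (by omega)]; exact k2
    · exact LWd_congr 0 hL fun k hk => hne k (by omega)
    · exact RWd_congr hR fun k hk => hne k (by omega)
  have adj : ∀ i, H i = H (i + 1) → Cn H i (i + 1) := by
    intro i hi
    refine ⟨hi, fun k hk => ?_⟩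
    rcases (show k = i ∨ k = i + 1 by omega) with rfl | rfl
    · exact le_rfl
    · exact hi.le
  have parne : ∀ i j, i ≤ n → j ≤ n → (H i = H j + 1 ∨ H j = H i + 1) → c (φ i) ≠ c (φ j) := by
    intro i j hi hj h h'
    have k1 := J.col i hi
    rw [h', J.col j hj, Int.even_iff, Int.even_iff] at k1
    omega
  have pareq : ∀ i j, i ≤ n → j ≤ n → (H i = H j) → c (φ i) = c (φ j) := by
    intro i j hi hj h
    have k1 := J.col i hi
    rw [h, ← J.col j hj] at k1
    exact Bool.eq_iff_iff.2 k1
  have bne : ∀ {x y w : Bool}, x ≠ y → w ≠ y → x = w := by decide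
  have n0 := J.nn g (by omega)
  have n1 := J.nn (g + 1) (by omega)
  have n2 := J.nn (g + 2) hg
  have hsf : ∀ x, Function.update H (g+1) x (g+1) = x := fun x => Function.update_self _ _ _
  have hne : ∀ x k, k ≠ g + 1 → Function.update H (g+1) x k = H k := fun x k hk => Function.update_of_ne hk _ _
  -- z joins only its left neighbour
  have caseL : c z = c (φ g) → (H g = H (g+2) + 1 ∨ H (g+2) = H g + 1) → (H g = H (g+1) ∨ H (g+1) = H (g+2)) →
      Inv ad c (insert z P) n φ' (Function.update H (g+1) (H g)) := by
    intro k1 k2 k3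
    have k4 := parne g (g+2) (by omega) hg k2
    have k5 : min (H g) (H (g+2)) ≤ H (g+1) := by rcases k3 with k | k <;> simp [k]
    refine upd _ n0 k5 (min_le_left _ _) (by rw [k1]; exact cg) ?_ ?_ ?_
    · rcases k3 with k | k
      · exact Or.inl (adj g k).symm
      · exact Or.inr (adj _ k)
    · rintro ⟨h1, h2⟩; exact absurd (h1.trans h2.symm) k4
    · intro j hj
      rw [S2l H _ g (hne _) k5 (hsf _) j hj, k1]
      simp [Ne.symm k4]
  have caseR : c z = c (φ (g+2)) → (H g = H (g+2) + 1 ∨ H (g+2) = H g + 1) → (H g = H (g+1) ∨ H (g+1) = H (g+2)) →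
      Inv ad c (insert z P) n φ' (Function.update H (g+1) (H (g+2))) := by
    intro k1 k2 k3
    have k4 := parne g (g+2) (by omega) hg k2
    have k5 : min (H g) (H (g+2)) ≤ H (g+1) := by rcases k3 with k | k <;> simp [k]
    refine upd _ n2 k5 (min_le_right _ _) (by rw [k1]; exact cg2) ?_ ?_ ?_
    · rcases k3 with k | k
      · exact Or.inl (adj g k).symm
      · exact Or.inr (adj _ k)
    · rintro ⟨h1, h2⟩; exact absurd (h1.trans h2.symm) k4
    · intro j hj
      rw [S2r H _ g (hne _) k5 (hsf _) j hj, k1]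
      simp [k4]
  by_cases hb : c z = c (φ g)
  · have hb' : (c z != c (φ g)) = false := by simp [hb]
    rw [hb']
    have simpleL : ∀ l' a1, tr p l a s false = .nx (a1 :: p) l' s → H g = H (g+2) + sv l' → H g = H g + sv a1 →
      (H g = H (g+2) + 1 ∨ H (g+2) = H g + 1) → (H g = H (g+1) ∨ H (g+1) = H (g+2)) → (∃ p' l' s' H', tr p l a s false = .nx p' l' s' ∧ Inv ad c (insert z P) n φ' H' ∧ LWd H' (g + 2) (l' :: p') ∧
      RWd n H' (g + 2) s') := fun l' a1 k1 k2 k3 k4 k5 =>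
      ⟨a1 :: p, l', s, _, k1, caseL hb k4 k5, words _ _ _ k2 k3⟩
    cases l <;> cases a <;> simp only [sv, add_zero] at hl ha
    · -- e e
      refine Or.inl ⟨_, _, _, _, rfl, ?_, words (H g) _ _ (by simp only [sv]; omega) (by simp [sv])⟩
      have k5 : min (H g) (H (g+2)) ≤ H (g+1) := by simp [hl]
      have k6 : Cn H g (g+2) := (adj g (by omega)).trans (adj (g+1) (show H (g+1) = H (g+2) by omega))
      refine upd _ n0 k5 (min_le_left _ _) (by rw [hb]; exact cg) (Or.inl (adj g (by omega)).symm) (fun _ => k6) ?_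
      intro j hj
      rw [S2l H _ g (hne _) k5 (hsf _) j hj, hb, pareq g (g+2) (by omega) hg (by omega)]
      simp only [true_and]
      exact ⟨Or.inl, fun h => h.elim id k6.trans⟩
    · refine Or.inl (simpleL _ _ rfl (by simp only [sv]; omega) (by simp [sv]) (by omega) (by omega))
    · refine Or.inl (simpleL _ _ rfl (by simp only [sv]; omega) (by simp [sv]) (by omega) (by omega))
    · refine Or.inl (simpleL _ _ rfl (by simp only [sv]; omega) (by simp [sv]) (by omega) (by omega))
    · -- u u
      have hLR : c (φ (g + 2)) = c z := by rw [hb]; exact pareq _ _ hg (by omega) (by omega)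
      refine Or.inl ⟨_, _, _, _, rfl, ?_, words (H g) _ _ (by simp only [sv]; omega) (by simp [sv])⟩
      refine mk _ ?_ ?_ ?_ (by rw [hsf, hb]; exact cg) (fun k hk hk' => by rw [hne _ k hk']) ?_ (hne _ _ (by omega)) (hne _ _ (by omega))
      · intro i j hi hj
        rw [U1 H _ g (hne _) (by omega) (by omega) (by rw [hsf]; omega) i j hi hj, hb, hLR]
        simp [hb]
      · intro j hj
        rw [U2 H _ g (hne _) (by omega) (by omega) (by rw [hsf]; omega) j hj, hb, hLR]
        simp [hb]
      · rcases J.bb with h0 | h0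
        · obtain ⟨q, k1, k2, k3⟩ := find_left (H (g+1)) hL (by omega) (by omega)
          refine ⟨q, by omega, by omega, k2.symm, fun k hk => ?_⟩
          rcases (show k = g + 1 ∨ k = q ∨ (q < k ∧ k ≤ g) by omega) with rfl | rfl | h
          · exact le_rfl
          · exact k2.ge
          · exact (k3 k h.1 h.2).le
        · obtain ⟨q, k1, k1', k2, k3⟩ := find_right (H (g+1)) hR (by omega) (by omega)
          refine ⟨q, by omega, by omega, k2.symm, fun k hk => ?_⟩
          rcases (show k = g + 1 ∨ k = q ∨ (g + 2 ≤ k ∧ k < q) by omega) with rfl | rfl | h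
          · exact le_rfl
          · exact k2.ge
          · exact (k3 k h.1 h.2).le
      · intro k hk
        by_cases hk' : k = g + 1
        · rw [hk', hsf]; exact n0
        · rw [hne _ k hk']; exact J.nn k hk
    · -- u d : flip left
      obtain ⟨p', q, f1, f2, f3, f4, f5, f6⟩ := fl_left 0 hL (by have := J.b0; push_cast; omega)
      simp only [Nat.cast_zero, sub_zero] at f3 f4 f5
      have hLR : c (φ (g + 2)) = c z := by
        rw [hb]
        have k1 := J.col g (by omega)
        have k2 := J.col (g+2) (by omega)
        rw [Int.even_iff] at k1 k2
        apply Bool.eq_iff_iff.2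
        rw [k1, k2]; omega
      obtain ⟨H', hH'⟩ : ∃ H' : ℕ → ℤ, H' = fun k => if k = g + 1 then H (g+2) else if q < k ∧ k ≤ g then H k - 2 else H k := ⟨_, rfl⟩
      have w1 : ∀ k, k ≤ q ∨ g + 1 < k → H' k = H k := by
        intro k hk; rw [hH']; simp only; rw [if_neg (by omega), if_neg (by omega)]
      have w2 : ∀ k, q < k → k ≤ g → H' k = H k - 2 := by
        intro k hk hk'; rw [hH']; simp only; rw [if_neg (by omega), if_pos (by omega)]
      have w3 : H' (g+1) = H (g+2) := by rw [hH']; simp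
      refine Or.inl ⟨e :: p', e, s, H', by simp [tr, f1], ?_, ⟨?_, ?_, ?_⟩, ?_⟩
      · refine mk _ ?_ ?_ ⟨q, by omega, by omega, by omega, fun k hk => ?_⟩ ?_ ?_ ?_ (w1 _ (by omega)) (w1 _ (by omega))
        · intro i j hi hj
          rw [W1' H H' g q f2 (by omega) (by omega) (by omega) (fun k h1 h2 => by have := f5 k h1 h2; omega) (by omega) w1 w2 w3 i j hi hj, hb, hLR]
          simp [hb]
        · intro j hj
          rw [W2' H H' g q f2 (by omega) (by omega) (by omega) (fun k h1 h2 => by have := f5 k h1 h2; omega) w1 w2 w3 j hj, hb, hLR]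
          simp [hb]
        · rcases (show k = g + 1 ∨ k = q ∨ (q < k ∧ k ≤ g) by omega) with rfl | rfl | h
          · exact le_rfl
          · omega
          · have := f5 k h.1 h.2; omega
        · rw [w3, ← hLR]; exact cg2
        · intro k hk hk'
          by_cases hw : q < k ∧ k ≤ g
          · rw [w2 k hw.1 hw.2, Int.even_iff, Int.even_iff]; omega
          · rw [w1 k (by omega)]
        · intro k hk
          by_cases hk' : k = g + 1
          · rw [hk', w3]; exact n2
          · by_cases hw : q < k ∧ k ≤ g
            · rw [w2 k hw.1 hw.2]; have := f5 k hw.1 hw.2; omega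
            · rw [w1 k (by omega)]; exact J.nn k hk
      · rw [w3, w1 (g+1+1) (by omega)]; simp [sv]
      · rw [w2 g f2 le_rfl, w3]; simp [sv]; omega
      · exact f6 H' (fun k hk => w1 k (by omega)) w2
      · exact RWd_congr hR fun k hk => w1 k (by omega)
    · refine Or.inl (simpleL _ _ rfl (by simp only [sv]; omega) (by simp [sv]) (by omega) (by omega))
    · -- d u : flip right
      obtain ⟨s', q, f1, f2, f2', f3, f4, f5, f6⟩ := fl_right 0 hR (by have := J.bn; push_cast; omega)
      simp only [Nat.cast_zero, sub_zero] at f3 f4 f5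
      have hLR : c (φ (g + 2)) = c z := by
        rw [hb]
        have k1 := J.col g (by omega)
        have k2 := J.col (g+2) (by omega)
        rw [Int.even_iff] at k1 k2
        apply Bool.eq_iff_iff.2
        rw [k1, k2]; omega
      obtain ⟨H', hH'⟩ : ∃ H' : ℕ → ℤ, H' = fun k => if k = g + 1 then H g else if g + 2 ≤ k ∧ k < q then H k - 2 else H k := ⟨_, rfl⟩
      have w1 : ∀ k, k < g + 1 ∨ q ≤ k → H' k = H k := by
        intro k hk; rw [hH']; simp only; rw [if_neg (by omega), if_neg (by omega)]
      have w2 : ∀ k, g + 2 ≤ k → k < q → H' k = H k - 2 := by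
        intro k hk hk'; rw [hH']; simp only; rw [if_neg (by omega), if_pos (by omega)]
      have w3 : H' (g+1) = H g := by rw [hH']; simp
      have ha' : H (g+2) = H (g+1) + 1 := ha
      have f3' : H q = H (g+2) - 1 := f3
      have f4' : H (q-1) = H (g+2) := f4
      have f5' : ∀ k, g + 2 ≤ k → k < q → H (g+2) ≤ H k := f5
      refine Or.inl ⟨e :: p, e, s', H', by simp [tr, f1], ?_, ⟨?_, ?_, ?_⟩, ?_⟩
      · refine mk _ ?_ ?_ ⟨q, by omega, by omega, by omega, fun k hk => ?_⟩ ?_ ?_ ?_ (w1 _ (by omega)) (w1 _ (by omega))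
        · intro i j hi hj
          rw [W1 H H' g q f2 (by omega) (by omega) (by omega) (fun k h1 h2 => by have := f5' k h1 h2; omega) (by omega) w1 w2 w3 i j hi hj, hb, hLR]
          simp [hb]
        · intro j hj
          rw [W2 H H' g q f2 (by omega) (by omega) (by omega) (fun k h1 h2 => by have := f5' k h1 h2; omega) w1 w2 w3 j hj, hb, hLR]
          simp [hb]
        · rcases (show k = g + 1 ∨ k = q ∨ (g + 2 ≤ k ∧ k < q) by omega) with rfl | rfl | h
          · exact le_rfl
          · omega
          · have := f5' k h.1 h.2; omega
        · rw [w3, hb]; exact cg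
        · intro k hk hk'
          by_cases hw : g + 2 ≤ k ∧ k < q
          · rw [w2 k hw.1 hw.2, Int.even_iff, Int.even_iff]; omega
          · rw [w1 k (by omega)]
        · intro k hk
          by_cases hk' : k = g + 1
          · rw [hk', w3]; exact n0
          · by_cases hw : g + 2 ≤ k ∧ k < q
            · rw [w2 k hw.1 hw.2]; have := f5' k hw.1 hw.2; omega
            · rw [w1 k (by omega)]; exact J.nn k hk
      · rw [w2 (g+1+1) (by omega) (by omega), w3, show H (g+1+1) = H (g+2) from rfl]; simp only [sv]; omega
      · rw [w1 g (by omega), w3]; simp [sv]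
      · exact LWd_congr 0 hL fun k hk => w1 k (by omega)
      · exact f6 H' (fun k hk => w1 k (by omega)) w2
    · exact Or.inr (Or.inr ⟨rfl, rfl, hb⟩)
  · have hb' : (c z != c (φ g)) = true := by simp [hb]
    rw [hb']
    have simpleR : ∀ l' a1, tr p l a s true = .nx (a1 :: p) l' s → H (g+2) = H (g+2) + sv l' → H g = H (g+2) + sv a1 →
      (H g = H (g+2) + 1 ∨ H (g+2) = H g + 1) → (H g = H (g+1) ∨ H (g+1) = H (g+2)) → (∃ p' l' s' H', tr p l a s true = .nx p' l' s' ∧ Inv ad c (insert z P) n φ' H' ∧ LWd H' (g + 2) (l' :: p') ∧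
      RWd n H' (g + 2) s') := fun l' a1 k1 k2 k3 k4 k5 =>
      ⟨a1 :: p, l', s, _, k1, caseR (bne hb (parne g (g+2) (by omega) hg k4).symm) k4 k5, words _ _ _ k2 k3⟩
    cases l <;> cases a <;> simp only [sv, add_zero] at hl ha
    · refine Or.inl ⟨_, _, _, _, rfl, ?_, words (H (g+1) + 1) _ _ (by simp only [sv]; omega) (by simp only [sv]; omega)⟩
      have k5 : min (H g) (H (g+2)) ≤ H (g+1) := by simp [hl]
      have ha' : H (g+2) = H (g+1) := by omega
      have hb2 : ¬ c z = c (φ (g+2)) := by rw [← pareq g (g+2) (by omega) hg (by omega)]; exact hb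
      refine upd _ (by omega) k5 (by omega) ?_ (Or.inl (adj g (by omega)).symm) (fun h => absurd h.1.symm hb) ?_
      · have : c z = true ↔ ¬ (c (φ g) = true) := by
          revert hb; cases c z <;> cases c (φ g) <;> simp
        rw [this, cg, Int.even_iff, Int.even_iff]; omega
      · intro j hj
        constructor
        · intro h
          have h3 := h.2 g
          have h4 := h.2 (g+2)
          rw [hsf, hne _ _ (by omega)] at h3 h4
          omega
        · rintro (h | h)
          · exact absurd h.1.symm hb
          · exact absurd h.1.symm hb2
    · refine Or.inl (simpleR _ _ rfl (by simp [sv]) (by simp only [sv]; omega) (by omega) (by omega))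
    · refine Or.inl (simpleR _ _ rfl (by simp [sv]) (by simp only [sv]; omega) (by omega) (by omega))
    · refine Or.inl (simpleR _ _ rfl (by simp [sv]) (by simp only [sv]; omega) (by omega) (by omega))
    · exact Or.inr (Or.inl ⟨by simp, by simp, hb, rfl⟩)
    · exact Or.inr (Or.inl ⟨by simp, by simp, hb, rfl⟩)
    · refine Or.inl (simpleR _ _ rfl (by simp [sv]) (by simp only [sv]; omega) (by omega) (by omega))
    · exact Or.inr (Or.inl ⟨by simp, by simp, hb, rfl⟩)
    · exact Or.inr (Or.inl ⟨by simp, by simp, hb, rfl⟩)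
end conn
end G
end

set_option linter.all false
noncomputable section
namespace G
open Sy
/-- adjacency of cells -/
def ad (u v : ℕ × ℕ) : Prop :=
  (u.1 = v.1 ∧ (u.2 + 1 = v.2 ∨ v.2 + 1 = u.2)) ∨ (u.2 = v.2 ∧ (u.1 + 1 = v.1 ∨ v.1 + 1 = u.1))
theorem ad_symm (u v : ℕ × ℕ) (h : ad u v) : ad v u := by unfold ad at *; omega
theorem ad_irr (u : ℕ × ℕ) : ¬ ad u u := by unfold ad; omega
def Bd : Set (ℕ × ℕ) := {v | v.1 < 12 ∧ v.2 < 12}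
def Valid (c : ℕ × ℕ → Bool) : Prop :=
  (∃ u ∈ Bd, c u = true) ∧ (∃ u ∈ Bd, c u = false) ∧ ∀ u ∈ Bd, ∀ v ∈ Bd, c u = c v → Co ad c Bd u v
/-- no checkerboard square -/
def NC (c : ℕ × ℕ → Bool) : Prop := ∀ r j j', r + 1 < 12 → j < 12 → j' < 12 → (j + 1 = j' ∨ j' + 1 = j) →
  ¬ (c (r, j) ≠ c (r, j') ∧ c (r + 1, j) ≠ c (r + 1, j') ∧ c (r, j) ≠ c (r + 1, j))
/-- scanning direction -/
def sg (b : Bool) (k : ℕ) : ℕ := cond b k (11 - k)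
/-- processed cells -/
def Pr (b : Bool) (r i : ℕ) : Set (ℕ × ℕ) := {v | v.2 < 12 ∧ (v.1 < r ∨ v.1 = r ∧ sg b v.2 ≤ i)}
/-- frontier -/
def fr (b : Bool) (r i k : ℕ) : ℕ × ℕ := if k ≤ i then (r + 1, sg b k) else (r, sg b (k - 1))
theorem Co_path {c : ℕ × ℕ → Bool} {P : Set (ℕ × ℕ)} (γ : ℕ → ℕ × ℕ) (m n : ℕ) (hmn : m ≤ n)
    (h1 : ∀ k, m ≤ k → k < n → ad (γ k) (γ (k + 1))) (h2 : ∀ k, m ≤ k → k ≤ n → γ k ∈ P) (b : Bool) (h3 : ∀ k, m ≤ k → k ≤ n → c (γ k) = b) :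
    Co ad c P (γ m) (γ n) := by
  induction n, hmn using Nat.le_induction with
  | base => exact Co.refl _
  | succ n hn ih =>
    refine (ih (fun k h h' => h1 k h (by omega)) (fun k h h' => h2 k h (by omega)) (fun k h h' => h3 k h (by omega))).trans ?_
    exact Co.single (h1 n hn (by omega)) (h2 n hn (by omega)) (h2 _ (by omega) le_rfl) ((h3 n hn (by omega)).trans (h3 _ (by omega) le_rfl).symm)
theorem closed {V : Type} {ad : V → V → Prop} {c : V → Bool} {P B : Set V} {n : ℕ} {φ : ℕ → V} {H : ℕ → ℤ} (J : Inv ad c P n φ H)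
    (f : ℕ) (hf : f ≤ n) (hcl : ∀ v ∈ P, ∀ w ∈ B, ad v w → w ∉ P → ∃ k, k ≤ n ∧ k ≠ f ∧ v = φ k)
    (hC : ∀ k, k ≤ n → k ≠ f → ¬ Cn H f k) (v : V) (h : Co ad c B (φ f) v) : Co ad c P (φ f) v := by
  induction h with
  | refl => exact Co.refl _
  | @tail w v hw h ih =>
    have hwP := ih.mem (J.mem f hf)
    refine ih.trans (Co.single h.1 hwP ?_ h.2.2.2)
    by_contra hv
    obtain ⟨k, k1, k2, rfl⟩ := hcl w hwP v h.2.2.1 h.1 hv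
    exact hC k k1 k2 ((J.con f k hf k1).1 ih)
theorem alle_L {H : ℕ → ℤ} {f : ℕ} {w : List Sy} (h : LWd H f w) (hh : ∀ k, k < f → (Even (H k) ↔ Even (H f))) : alle w = true := by
  induction w generalizing f with
  | nil => rfl
  | cons a w ih =>
    cases f with
    | zero => exact h.elim
    | succ f =>
      obtain ⟨h1, h2⟩ := h
      have h3 := hh f (by omega)
      rw [Int.even_iff, Int.even_iff] at h3
      cases a with
      | e => exact ih h2 fun k hk => by rw [hh k (by omega), ← hh f (by omega)]
      | u => simp only [sv] at h1; omega
      | d => simp only [sv] at h1; omega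
theorem alle_R {n : ℕ} {H : ℕ → ℤ} {f : ℕ} {w : List Sy} (h : RWd n H f w) (hh : ∀ k, f ≤ k → k ≤ n → (Even (H k) ↔ Even (H f))) : alle w = true := by
  induction w generalizing f with
  | nil => rfl
  | cons a w ih =>
      have h0 := RWd_len h
      simp at h0
      obtain ⟨h1, h2⟩ := h
      have h3 := hh (f + 1) (by omega) (by omega)
      rw [Int.even_iff, Int.even_iff] at h3
      cases a with
      | e => exact ih h2 fun k hk hk' => by rw [hh k (by omega) hk', ← hh (f+1) (by omega) (by omega)]
      | u => simp only [sv] at h1; omega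
      | d => simp only [sv] at h1; omega
theorem L_alle {H : ℕ → ℤ} {f : ℕ} {w : List Sy} (h : LWd H f w) (hw : alle w = true) : ∀ k, k ≤ f → H k = H f := by
  induction w generalizing f with
  | nil => intro k hk; have : f = 0 := h; subst this; rw [show k = 0 by omega]
  | cons a w ih =>
    cases f with
    | zero => exact h.elim
    | succ f =>
      obtain ⟨h1, h2⟩ := h
      cases a with
      | e =>
        intro k hk
        simp only [sv, add_zero] at h1
        rcases (show k = f + 1 ∨ k ≤ f by omega) with rfl | hk
        · rfl
        · rw [ih h2 hw k hk, h1]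
      | u => simp [alle] at hw
      | d => simp [alle] at hw
theorem R_alle {n : ℕ} {H : ℕ → ℤ} {f : ℕ} {w : List Sy} (h : RWd n H f w) (hw : alle w = true) : ∀ k, f ≤ k → k ≤ n → H k = H f := by
  induction w generalizing f with
  | nil => intro k hk hk'; have : f = n := h; subst this; rw [show k = f by omega]
  | cons a w ih =>
      obtain ⟨h1, h2⟩ := h
      cases a with
      | e =>
        intro k hk hk'
        simp only [sv, add_zero] at h1
        rcases (show k = f ∨ f + 1 ≤ k by omega) with rfl | hk
        · rfl
        · rw [ih h2 hw k hk hk', h1]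
      | u => simp [alle] at hw
      | d => simp [alle] at hw
theorem sg_lt (b : Bool) (k : ℕ) (h : k < 12) : sg b k < 12 := by cases b <;> simp [sg] <;> omega
theorem sg_sg (b : Bool) (k : ℕ) (h : k < 12) : sg b (sg b k) = k := by cases b <;> simp [sg]; omega
theorem sg_inj (b : Bool) (j k : ℕ) (hj : j < 12) (hk : k < 12) (h : sg b j = sg b k) : j = k := by cases b <;> simp [sg] at h <;> omega
theorem sg_ad (b : Bool) (k : ℕ) (h : k < 11) : (sg b k + 1 = sg b (k + 1) ∨ sg b (k + 1) + 1 = sg b k) := by cases b <;> simp [sg] <;> omega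
theorem Pr_ins (b : Bool) (r i : ℕ) (hi : i < 11) : insert (r + 1, sg b (i + 1)) (Pr b (r + 1) i) = Pr b (r + 1) (i + 1) := by
  ext ⟨x, y⟩
  cases b <;> simp [Pr, sg] <;> omega
theorem fr_z (b : Bool) (r i : ℕ) (hi : i < 11) (v : ℕ × ℕ) (hv : v ∈ Pr b (r + 1) i) :
    ad v (r + 1, sg b (i + 1)) ↔ v = fr b r i i ∨ v = fr b r i (i + 2) := by
  obtain ⟨x, y⟩ := v
  have h1 : fr b r i i = (r + 1, sg b i) := by simp [fr]
  have h2 : fr b r i (i + 2) = (r, sg b (i + 1)) := by simp [fr]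
  rw [h1, h2]
  cases b <;> simp [Pr, sg, ad] at * <;> omega
theorem fr_cl (b : Bool) (r i : ℕ) (hi : i < 11) (v : ℕ × ℕ) (hv : v ∈ Pr b (r + 1) i) (w : ℕ × ℕ) (hw : w ∈ Bd) (h : ad v w) (hn : w ∉ Pr b (r + 1) i) :
    ∃ k, k ≤ 12 ∧ k ≠ i + 1 ∧ v = fr b r i k := by
  obtain ⟨x, y⟩ := v
  obtain ⟨x', y'⟩ := w
  rcases (show x = r + 1 ∨ x ≠ r + 1 by omega) with hx | hx
  · have h1 : sg b y ≤ i := by simp only [Pr, Set.mem_setOf_eq] at hv; omega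
    have h2 : fr b r i (sg b y) = (r + 1, sg b (sg b y)) := by simp [fr, h1]
    refine ⟨sg b y, by omega, by omega, ?_⟩
    rw [h2, sg_sg b y hv.1, hx]
  · have h1 : x = r ∧ i < sg b y := by cases b <;> simp [Pr, sg, ad, Bd] at * <;> omega
    have h2 : fr b r i (sg b y + 1) = (r, sg b (sg b y)) := by simp [fr]; omega
    have := sg_lt b y hv.1
    refine ⟨sg b y + 1, by omega, by omega, ?_⟩
    rw [h2, sg_sg b y hv.1, h1.1]
end G
end

set_option linter.all false
noncomputable section
namespace G
open Sy
theorem fin_case {c : ℕ × ℕ → Bool} {b : Bool} {r i : ℕ} {H : ℕ → ℤ} {p s : List Sy} (hi : i < 11) (hr : r + 1 < 12)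
    (J : Inv ad c (Pr b (r + 1) i) 12 (fr b r i) H) (hL : LWd H (i + 1) (d :: p)) (hR : RWd 12 H (i + 1) (d :: s))
    (hz : c (r + 1, sg b (i + 1)) = c (fr b r i i)) :
    (Valid c ↔ (alle p = true ∧ alle s = true) ∧ ∀ v ∈ Bd, v ∉ Pr b (r + 1) i → c v = true) ∧
    (alle p = true → alle s = true → ∀ k, k ≤ 12 → k ≠ i + 1 → c (fr b r i k) = true) := by
  obtain ⟨hl, hL⟩ := hL
  obtain ⟨ha, hR⟩ := hR
  replace ha : H (i + 2) = H (i + 1) + -1 := ha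
  replace hl : H i = H (i + 1) + -1 := hl
  replace hR : RWd 12 H (i + 2) s := hR
  have hC : ∀ k, k ≤ 12 → k ≠ i + 1 → ¬ Cn H (i + 1) k := by
    intro k hk hk' h
    have h1 := h.2 i
    have h2 := h.2 (i + 2)
    omega
  have cl := closed (B := Bd) J (i + 1) (by omega) (fr_cl b r i hi) hC
  have hPB : Pr b (r + 1) i ⊆ Bd := by
    intro v hv
    simp only [Pr, Bd, Set.mem_setOf_eq] at *; omega
  have hx := J.mem (i + 1) (by omega)
  have col := fun k hk => J.col k hk
  have cx : ∀ k, k ≤ 12 → (c (fr b r i k) = c (fr b r i (i + 1)) ↔ (Even (H k) ↔ Even (H (i + 1)))) := by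
    intro k hk
    rw [← col k hk, ← col (i + 1) (by omega), Bool.eq_iff_iff]
  have flat : alle p = true → alle s = true → ∀ k, k ≤ 12 → k ≠ i + 1 → H k = 0 := by
    intro h1 h2
    have k1 := L_alle hL h1
    have k2 := R_alle hR h2
    have : H i = 0 := by
      rcases J.bb with h | h
      · rw [← k1 0 (by omega)]; exact h
      · rw [k2 12 (by omega) le_rfl] at h; omega
    intro k hk hk'
    rcases (show k ≤ i ∨ i + 2 ≤ k by omega) with h | h
    · rw [k1 k h, this]
    · rw [k2 k h hk]; omega
  refine ⟨⟨?_, ?_⟩, ?_⟩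
  · rintro ⟨_, _, hV⟩
    have ne : ∀ v ∈ Bd, (∀ k, k ≤ 12 → k ≠ i + 1 → v = fr b r i k ∨ v ∉ Pr b (r + 1) i → c v ≠ c (fr b r i (i + 1))) := by
      intro v hv k hk hk' h hc
      have h1 := cl v (hV _ (hPB hx) v hv hc.symm)
      rcases h with rfl | h
      · exact hC k hk hk' ((J.con _ _ (by omega) hk).1 h1)
      · exact h (h1.mem hx)
    have ne1 : ∀ k, k ≤ 12 → k ≠ i + 1 → ¬ (Even (H k) ↔ Even (H (i + 1))) := by
      intro k hk hk'
      rw [← cx k hk]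
      exact ne _ (hPB (J.mem k hk)) k hk hk' (Or.inl rfl)
    have e1 : alle p = true := alle_L hL fun k hk => by
      have := ne1 k (by omega) (by omega)
      have := ne1 i (by omega) (by omega)
      tauto
    have e2 : alle s = true := alle_R hR fun k hk hk' => by
      have := ne1 k (by omega) (by omega)
      have := ne1 (i + 2) (by omega) (by omega)
      tauto
    refine ⟨⟨e1, e2⟩, fun v hv hv' => ?_⟩
    have h1 := ne v hv i (by omega) (by omega) (Or.inr hv')
    have h2 := flat e1 e2 i (by omega) (by omega)
    have h3 : ¬ c (fr b r i (i + 1)) = true := by rw [col _ (by omega), Int.even_iff]; omega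
    revert h1 h3
    cases c v <;> cases c (fr b r i (i + 1)) <;> simp
  · rintro ⟨⟨e1, e2⟩, hrest⟩
    have fl := flat e1 e2
    have h2 := fl i (by omega) (by omega)
    have hxw : c (fr b r i (i + 1)) = false := by
      have : ¬ c (fr b r i (i + 1)) = true := by rw [col _ (by omega), Int.even_iff]; omega
      simpa using this
    have hib : c (fr b r i i) = true := by rw [col _ (by omega), h2]; simp
    have hib2 : c (fr b r i (i + 2)) = true := by rw [col _ (by omega), fl (i+2) (by omega) (by omega)]; simp
    have hzb : (r + 1, sg b (i + 1)) ∈ Bd := ⟨hr, sg_lt b _ (by omega)⟩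
    have hzP : (r + 1, sg b (i + 1)) ∉ Pr b (r + 1) i := by
      simp only [Pr, Set.mem_setOf_eq, sg_sg b (i+1) (by omega)]; omega
    have z1 : Co ad c Bd (fr b r i i) (r + 1, sg b (i + 1)) :=
      Co.single ((fr_z b r i hi _ (J.mem i (by omega))).2 (Or.inl rfl)) (hPB (J.mem i (by omega))) hzb hz.symm
    have z2 : Co ad c Bd (fr b r i (i + 2)) (r + 1, sg b (i + 1)) :=
      Co.single ((fr_z b r i hi _ (J.mem (i + 2) (by omega))).2 (Or.inr rfl)) (hPB (J.mem (i + 2) (by omega))) hzb (by rw [hz, hib, hib2])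
    have w : ∀ v ∈ Bd, c v = false → Co ad c Bd v (fr b r i (i + 1)) := by
      intro v hv hcv
      have hvP : v ∈ Pr b (r + 1) i := by
        by_contra h
        rw [hrest v hv h] at hcv; simp at hcv
      obtain ⟨k, hk, h⟩ := J.cov v hvP
      have : k = i + 1 := by
        by_contra hne
        have h1 := h.col
        rw [hcv] at h1
        have h3 := (col k hk).2 (by rw [fl k hk hne]; simp)
        rw [← h1] at h3; simp at h3
      subst this
      exact h.mono hPB
    have bl : ∀ v ∈ Bd, c v = true → Co ad c Bd v (r + 1, sg b (i + 1)) := by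
      intro v hv hcv
      by_cases hvP : v ∈ Pr b (r + 1) i
      · obtain ⟨k, hk, h⟩ := J.cov v hvP
        have hne : k ≠ i + 1 := by
          rintro rfl
          have h1 := h.col
          rw [hcv, hxw] at h1; simp at h1
        refine (h.mono hPB).trans ?_
        rcases (show k ≤ i ∨ i + 2 ≤ k by omega) with hki | hki
        · have : Cn H k i := ⟨by rw [fl k hk hne, h2], fun j hj => by rw [fl k hk hne, fl j (by omega) (by omega)]⟩
          exact (((J.con k i hk (by omega)).2 this).mono hPB).trans z1
        · have : Cn H k (i + 2) := ⟨by rw [fl k hk hne, fl (i+2) (by omega) (by omega)], fun j hj => by rw [fl k hk hne, fl j (by omega) (by omega)]⟩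
          exact (((J.con k (i + 2) hk (by omega)).2 this).mono hPB).trans z2
      · obtain ⟨x, y⟩ := v
        have hv' : x < 12 ∧ y < 12 := hv
        have hn : r + 1 < x ∨ x = r + 1 ∧ i + 1 ≤ sg b y := by
          simp only [Pr, Set.mem_setOf_eq] at hvP; omega
        have hsy := sg_lt b y hv'.2
        have hsi := sg_lt b (i + 1) (by omega)
        -- horizontally, then vertically
        have hor : ∀ m n, m ≤ n → n < 12 → (r + 1 < x ∨ i + 1 ≤ m) → Co ad c Bd (x, sg b m) (x, sg b n) := by
          intro m n hmn hn12 hh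
          refine Co_path (fun k => (x, sg b k)) m n hmn ?_ ?_ true ?_
          · intro k _ _
            have := sg_ad b k (by omega)
            show ad (x, sg b k) (x, sg b (k + 1))
            unfold ad; exact Or.inl ⟨rfl, this⟩
          · intro k _ _; exact ⟨hv'.1, sg_lt b k (by omega)⟩
          · intro k _ _
            refine hrest _ ⟨hv'.1, sg_lt b k (by omega)⟩ ?_
            simp only [Pr, Set.mem_setOf_eq, sg_sg b k (by omega)]; omega
        have ver : ∀ n, r + 1 ≤ n → n < 12 → Co ad c Bd (r + 1, sg b (i + 1)) (n, sg b (i + 1)) := by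
          intro n hn hn12
          refine Co_path (fun k => (k, sg b (i + 1))) (r + 1) n hn ?_ ?_ true ?_
          · intro k _ _
            show ad (k, sg b (i + 1)) (k + 1, sg b (i + 1))
            unfold ad; exact Or.inr ⟨rfl, Or.inl rfl⟩
          · intro k _ _; exact ⟨by simp only; omega, sg_lt b _ (by omega)⟩
          · intro k _ _
            refine hrest _ ⟨by simp only; omega, sg_lt b _ (by omega)⟩ ?_
            simp only [Pr, Set.mem_setOf_eq, sg_sg b (i+1) (by omega)]; omega
        have e3 : (x, y) = (x, sg b (sg b y)) := by rw [sg_sg b y hv'.2]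
        rw [e3]
        refine Co.trans ?_ ((ver x (by omega) hv'.1).symm ad_symm)
        rcases le_total (sg b y) (i + 1) with h | h
        · exact hor _ _ h (by omega) (by omega)
        · exact (hor _ _ h hsy (by omega)).symm ad_symm
    refine ⟨⟨_, hPB (J.mem i (by omega)), hib⟩, ⟨_, hPB hx, hxw⟩, ?_⟩
    intro u hu v hv hc
    cases hcu : c u
    · exact (w u hu hcu).trans ((w v hv (hc ▸ hcu)).symm ad_symm)
    · exact (bl u hu hcu).trans ((bl v hv (hc ▸ hcu)).symm ad_symm)
  · intro e1 e2
    have fl := flat e1 e2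
    exact fun k hk hk' => (col k hk).2 (by rw [fl k hk hk']; simp)
/-- processing of one row -/
theorem row {c : ℕ × ℕ → Bool} {b : Bool} {r : ℕ} (hr : r + 1 < 12) (hNC : Valid c → NC c) (t : ℕ) (ht : ¬ Valid c → t = 0)
    (K : List Sy → Sy → ℕ) (Z : ℕ) (hK : ∀ H p l, Inv ad c (Pr b (r + 1) 11) 12 (fr b r 11) H → LWd H 12 (l :: p) → K p l = t)
    (hZ : (∀ x y, r + 1 < x → x < 12 → y < 12 → c (x, y) = true) → Z = 1)
    (hZ' : ¬ (∀ x y, r + 1 < x → x < 12 → y < 12 → c (x, y) = true) → Z = 0)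
    (hω : Valid c → c (r, sg b 11) = true → (∀ k, k < 12 → c (r + 1, sg b k) = true) →
      (∀ x y, r + 1 < x → x < 12 → y < 12 → c (x, y) = true) → t = 1)
    (m : ℕ) : ∀ i p l s H, i + m = 11 → Inv ad c (Pr b (r + 1) i) 12 (fr b r i) H → LWd H (i + 1) (l :: p) → RWd 12 H (i + 1) s →
      RW K Z (c (r + 1, sg b i)) ((List.range' (i + 1) m).map (fun k => c (r + 1, sg b k))) p l s = t := by
  induction m with
  | zero =>
    intro i p l s H him J hL hR
    obtain rfl : i = 11 := by omega
    simp only [List.range'_zero, List.map_nil, RW]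
    exact hK H p l J hL
  | succ m ih =>
    intro i p l s H him J hL hR
    have hlen := RWd_len hR
    obtain _ | ⟨a, s⟩ := s
    · simp at hlen; omega
    have hi : i < 11 := by omega
    have fi : fr b r i i = (r + 1, sg b i) := by simp [fr]
    have fi1 : fr b r i (i + 1) = (r, sg b i) := by simp [fr]
    have fi2 : fr b r i (i + 2) = (r, sg b (i + 1)) := by simp [fr]
    have hzP : (r + 1, sg b (i + 1)) ∉ Pr b (r + 1) i := by
      simp only [Pr, Set.mem_setOf_eq, sg_sg b (i+1) (by omega)]; omega
    have hp1 : fr b r (i + 1) (i + 1) = (r + 1, sg b (i + 1)) := by simp [fr]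
    have hp2 : ∀ k, k ≠ i + 1 → fr b r (i + 1) k = fr b r i k := by
      intro k hk
      unfold fr
      rcases (show k ≤ i ∨ ¬ k ≤ i + 1 by omega) with h | h
      · rw [if_pos h, if_pos (by omega)]
      · rw [if_neg h, if_neg (by omega)]
    have st := step ad_symm ad_irr J _ hzP i (by omega) (fr_z b r i hi) hp1 hp2 p l a s hL hR
    rw [Pr_ins b r i hi, fi] at st
    rw [List.range'_succ, List.map_cons, RW]
    rcases st with ⟨p', l', s', H', h1, h2, h3, h4⟩ | ⟨h1, h2, h3, h4⟩ | ⟨rfl, rfl, h3⟩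
    · rw [h1]
      exact ih (i + 1) p' l' s' H' (by omega) h2 h3 h4
    · rw [h4]
      refine (ht fun hV => ?_).symm
      have c0 := J.col i (by omega)
      have c1 := J.col (i + 1) (by omega)
      have c2 := J.col (i + 2) (by omega)
      rw [fi, Int.even_iff] at c0
      rw [fi1, Int.even_iff] at c1
      rw [fi2, Int.even_iff] at c2
      have e1 := hL.1
      have e2 : H (i + 2) = H (i + 1) + sv a := hR.1
      have f1 : c (r, sg b i) ≠ c (r + 1, sg b i) := by
        intro h
        rw [← h, c1] at c0
        cases l <;> simp [sv] at * <;> omega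
      have f2 : c (r, sg b i) ≠ c (r, sg b (i + 1)) := by
        intro h
        rw [← h, c1] at c2
        cases a <;> simp [sv] at * <;> omega
      exact hNC hV r (sg b i) (sg b (i + 1)) hr (sg_lt b _ (by omega)) (sg_lt b _ (by omega)) (sg_ad b i hi) ⟨f2, Ne.symm h3, f1⟩
    · have hb : (c (r + 1, sg b (i + 1)) != c (r + 1, sg b i)) = false := by simp [h3]
      rw [hb]
      obtain ⟨g1, g2⟩ := fin_case hi hr J hL hR (by rw [fi]; exact h3)
      have htr : tr p d d s false = cond (alle p && alle s) .fin .dead := rfl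
      rw [htr]
      have hall : ((c (r + 1, sg b (i + 1)) :: List.map (fun k => c (r + 1, sg b k)) (List.range' (i + 1 + 1) m)).all id = true) ↔
          ∀ k, i + 1 ≤ k → k < 12 → c (r + 1, sg b k) = true := by
        rw [← List.map_cons (f := fun k => c (r + 1, sg b k)), ← List.range'_succ, List.all_map, List.all_eq_true]
        simp only [List.mem_range'_1, Function.comp, id]
        constructor
        · intro h k h1 h2; exact h k (by omega)
        · intro h k hk; exact h k (by omega) (by omega)
      by_cases hpa : alle p = true ∧ alle s = true
      · rw [hpa.1, hpa.2]
        simp only [Bool.and_true, cond_true, rs]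
        have hg2 := g2 hpa.1 hpa.2
        have hg3 := hg2 12 le_rfl (by omega)
        rw [show fr b r i 12 = (r, sg b 11) by simp [fr]; omega] at hg3
        by_cases hrow : ∀ k, i + 1 ≤ k → k < 12 → c (r + 1, sg b k) = true
        · rw [hall.2 hrow, cond_true]
          by_cases hrest : ∀ x y, r + 1 < x → x < 12 → y < 12 → c (x, y) = true
          · rw [hZ hrest]
            refine (hω (g1.2 ⟨hpa, ?_⟩) hg3 (fun k hk => ?_) hrest).symm
            swap
            · by_cases hki : i + 1 ≤ k
              · exact hrow k hki hk
              · have := hg2 k (by omega) (by omega)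
                rwa [show fr b r i k = (r + 1, sg b k) by simp [fr]; omega] at this
            rintro ⟨x, y⟩ hv hv'
            simp only [Bd, Pr, Set.mem_setOf_eq] at hv hv'
            by_cases hx : r + 1 < x
            · exact hrest x y hx hv.1 hv.2
            · have := hrow (sg b y) (by omega) (sg_lt b y hv.2)
              rw [sg_sg b y hv.2] at this
              rw [show x = r + 1 by omega]; exact this
          · rw [hZ' hrest]
            refine (ht fun hV => hrest fun x y h1 h2 h3 => ?_).symm
            exact (g1.1 hV).2 (x, y) ⟨h2, h3⟩ (by simp only [Pr, Set.mem_setOf_eq]; omega)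
        · have : ((c (r + 1, sg b (i + 1)) :: List.map (fun k => c (r + 1, sg b k)) (List.range' (i + 1 + 1) m)).all id) = false := by
            rw [← Bool.not_eq_true, hall]; exact hrow
          rw [this, cond_false]
          refine (ht fun hV => hrow fun k h1 h2 => ?_).symm
          exact (g1.1 hV).2 (r + 1, sg b k) ⟨hr, sg_lt b k h2⟩ (by simp only [Pr, Set.mem_setOf_eq, sg_sg b k h2]; omega)
      · have : (alle p && alle s) = false := by
          rw [← Bool.not_eq_true, Bool.and_eq_true]; exact hpa
        rw [this]
        simp only [cond_false, rs]
        exact (ht fun hV => hpa (g1.1 hV).1).symm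
end G
end

set_option linter.all false
noncomputable section
namespace G
open Sy
/-- number of level changes of a word -/
def nz : List Sy → ℕ
  | [] => 0
  | e :: w => nz w
  | _ :: w => nz w + 1
theorem nz_alle (w : List Sy) : nz w = 0 ↔ alle w = true := by
  induction w with
  | nil => simp [nz, alle]
  | cons a w ih => cases a <;> simp [nz, alle, ih]
theorem nz_one (w : List Sy) : one w = true ↔ nz w = 1 := by
  induction w with
  | nil => simp [nz, one]
  | cons a w ih => cases a <;> simp [nz, one, ih, nz_alle]
theorem nz_oned (w : List Sy) (h : oned w = true) : nz w = 1 := by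
  induction w with
  | nil => simp [oned] at h
  | cons a w ih => cases a <;> simp [nz, oned, nz_alle] at * <;> simp_all
theorem nz_udw (w : List Sy) (h : udw w = true) : nz w = 2 := by
  induction w with
  | nil => simp [udw] at h
  | cons a w ih => cases a <;> simp [nz, udw] at * <;> simp_all [nz_oned]
theorem w_one {n : ℕ} {H : ℕ → ℤ} {f : ℕ} {w : List Sy} (h : RWd n H f w) (hw : nz w = 1) :
    ∃ j, f ≤ j ∧ j < n ∧ (∀ k, f ≤ k → k ≤ j → H k = H f) ∧ (∀ k, j < k → k ≤ n → H k = H n) ∧ (H n = H f + 1 ∨ oned w = true ∧ H n = H f - 1) := by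
  induction w generalizing f with
  | nil => simp [nz] at hw
  | cons a w ih =>
    have hl := RWd_len h
    simp only [List.length_cons] at hl
    obtain ⟨h1, h2⟩ := h
    have base : nz w = 0 → (∀ k, f < k → k ≤ n → H k = H n) := by
      intro hw k h1 h3
      have := R_alle h2 ((nz_alle w).1 hw)
      rw [this k (by omega) h3, this n (by omega) le_rfl]
    cases a with
    | e =>
      simp only [nz, sv, add_zero] at hw h1
      obtain ⟨j, a1, a2, a3, a4, a5⟩ := ih h2 hw
      refine ⟨j, by omega, a2, fun k hk hk' => ?_, a4, ?_⟩
      · rcases hk.eq_or_lt with rfl | hk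
        · rfl
        · rw [a3 k hk hk', h1]
      · rw [h1] at a5; exact a5
    | u =>
      simp only [nz, sv] at hw h1
      have b := base (by omega)
      exact ⟨f, le_rfl, by omega, fun k hk hk' => by rw [show k = f by omega], b, Or.inl (by rw [← b (f + 1) (by omega) (by omega), h1])⟩
    | d =>
      simp only [nz, sv] at hw h1
      have b := base (by omega)
      refine ⟨f, le_rfl, by omega, fun k hk hk' => by rw [show k = f by omega], b, Or.inr ⟨?_, by rw [← b (f + 1) (by omega) (by omega), h1]; ring⟩⟩
      simp only [oned]
      exact (nz_alle w).1 (by omega)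
theorem w_two {n : ℕ} {H : ℕ → ℤ} {f : ℕ} {w : List Sy} (h : RWd n H f w) (hw : nz w = 2) (h1 : H n ≤ H f) (h2 : H f ≤ H n + 1) (h3 : ∀ k, f ≤ k → k ≤ n → H n ≤ H k) :
    udw w = true ∧ ∃ i j, f ≤ i ∧ i < j ∧ j < n ∧ (∀ k, f ≤ k → k ≤ i → H k = H n) ∧ (∀ k, i < k → k ≤ j → H k = H n + 1) ∧ (∀ k, j < k → k ≤ n → H k = H n) := by
  induction w generalizing f with
  | nil => simp [nz] at hw
  | cons a w ih =>
    have hl := RWd_len h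
    simp only [List.length_cons] at hl
    obtain ⟨g1, g2⟩ := h
    cases a with
    | e =>
      simp only [nz, sv, add_zero] at hw g1
      obtain ⟨e1, i, j, a1, a2, a3, a4, a5, a6⟩ := ih g2 hw (by omega) (by omega) (fun k hk hk' => h3 k (by omega) hk')
      refine ⟨e1, i, j, by omega, a2, a3, fun k hk hk' => ?_, a5, a6⟩
      rcases hk.eq_or_lt with rfl | hk
      · rw [← g1, a4 _ le_rfl a1]
      · exact a4 k hk hk'
    | u =>
      simp only [nz, sv] at hw g1
      obtain ⟨j, a1, a2, a3, a4, a5⟩ := w_one g2 (by omega)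
      rcases a5 with a5 | ⟨a5, a6⟩
      · omega
      · refine ⟨a5, f, j, le_rfl, by omega, a2, fun k hk hk' => ?_, fun k hk hk' => ?_, a4⟩
        · rw [show k = f by omega]; omega
        · rw [a3 k hk hk']; omega
    | d =>
      simp only [nz, sv] at hw g1
      obtain ⟨j, a1, a2, a3, a4, a5⟩ := w_one g2 (by omega)
      have := h3 (f + 1) (by omega) (by omega)
      omega
theorem nz_sum {n : ℕ} {H : ℕ → ℤ} {f : ℕ} {w : List Sy} (h : RWd n H f w) :
    nz w = ∑ k ∈ Finset.Ico f n, if (Even (H k) ↔ Even (H (k + 1))) then 0 else 1 := by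
  induction w generalizing f with
  | nil => have : f = n := h; subst this; simp [nz]
  | cons a w ih =>
    have hl := RWd_len h
    simp only [List.length_cons] at hl
    obtain ⟨g1, g2⟩ := h
    rw [Finset.sum_eq_sum_Ico_succ_bot (by omega), ← ih g2]
    cases a
    · simp only [sv, add_zero] at g1; simp [nz, g1]
    · simp only [sv] at g1; rw [if_neg (by rw [Int.even_iff, Int.even_iff]; omega)]; simp [nz]; omega
    · simp only [sv] at g1; rw [if_neg (by rw [Int.even_iff, Int.even_iff]; omega)]; simp [nz]; omega
theorem ec_R {n : ℕ} {H : ℕ → ℤ} {f : ℕ} {w : List Sy} (h : RWd n H f w) (h0 : Even (H n)) : ec true w = true ↔ Even (H f) := by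
  induction w generalizing f with
  | nil => have : f = n := h; subst this; simp [ec, h0]
  | cons a w ih =>
    obtain ⟨g1, g2⟩ := h
    have := ih g2
    rw [g1] at this
    cases a
    · simp only [sv, add_zero] at this; simp [ec, this]
    · simp only [sv] at this; simp only [ec]; rw [ec_not, Bool.not_eq_true', ← Bool.not_eq_true, this]; rw [Int.even_iff, Int.even_iff]; omega
    · simp only [sv] at this; simp only [ec]; rw [ec_not, Bool.not_eq_true', ← Bool.not_eq_true, this]; rw [Int.even_iff, Int.even_iff]; omega
theorem L_to_R {H : ℕ → ℤ} {f : ℕ} {w : List Sy} (h : LWd H f w) (n : ℕ) (hf : f ≤ n) : RWd n (fun k => H (n - k)) (n - f) w := by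
  induction w generalizing f with
  | nil => have : f = 0 := h; subst this; simp [RWd]
  | cons a w ih =>
    cases f with
    | zero => exact h.elim
    | succ f =>
      obtain ⟨h1, h2⟩ := h
      have := ih h2 (by omega)
      refine ⟨?_, ?_⟩
      · simp only
        rw [show n - (n - (f + 1) + 1) = f by omega, show n - (n - (f + 1)) = f + 1 by omega, h1]
      · rw [show n - (f + 1) + 1 = n - f by omega]; exact this
/-- number of colour changes in the bottom row -/
def nb (c : ℕ × ℕ → Bool) : ℕ := ∑ k ∈ Finset.range 11, if c (11, k) = c (11, k + 1) then 0 else 1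
def wb (c : ℕ × ℕ → Bool) : ℕ := if nb c ≤ 1 then 1 else if nb c = 2 then 4 else 0
def rho (x y : Bool) : ℕ := cond (x == y) 1 (cond x 4 0)
/-- weight of the rows after row `r` -/
def rem (c : ℕ × ℕ → Bool) : ℕ → ℕ → ℕ
  | 0, _ => wb c
  | m + 1, r => (c (r + 1, 0)).toNat * (rho (c (r, 11)) (c (r + 1, 11)) * rem c m (r + 1))
def rows (c : ℕ × ℕ → Bool) : Bool → ℕ → ℕ → List (List Bool)
  | _, _, 0 => []
  | b, x, m + 1 => (c (x, sg b 0) :: (List.range' 1 11).map (fun k => c (x, sg b k))) :: rows c (!b) (x + 1) m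
theorem Pr_Bd (b : Bool) : Pr b 11 11 = Bd := by
  ext ⟨x, y⟩
  cases b <;> simp [Pr, Bd, sg] <;> omega
open Classical in
theorem DD_zero {c : ℕ × ℕ → Bool} {H : ℕ → ℤ} {w : List Sy} (J : Inv ad c (Pr false 11 11) 11 (fun k => (11, sg false k)) H)
    (hR : RWd 11 H 0 w) (hl : c (11, 0) = true) : FAn w = if Valid c then wb c else 0 := by
  have hH : H 11 = 0 := by
    have h1 := (J.col 11 le_rfl).1 hl
    have h2 := J.nn 11 le_rfl
    have h3 := J.bn
    rw [Int.even_iff] at h1; omega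
  have hnb : nz w = nb c := by
    rw [nz_sum hR, nb, ← Finset.sum_range_reflect, ← Finset.range_eq_Ico]
    apply Finset.sum_congr rfl
    intro k hk
    rw [Finset.mem_range] at hk
    refine if_congr ?_ rfl rfl
    rw [← J.col k (by omega), ← J.col (k + 1) (by omega), ← Bool.eq_iff_iff]
    simp only [sg, cond_false]
    rw [show 11 - 1 - k = 11 - (k + 1) by omega, show 11 - (k + 1) + 1 = 11 - k by omega]
    exact eq_comm
  rw [Pr_Bd] at J
  have val : (∃ k, k ≤ 11 ∧ H k ≠ 0) → (∀ i j, i ≤ 11 → j ≤ 11 → ¬ Even (H i) → ¬ Even (H j) → Cn H i j) → (∀ k, k ≤ 11 → H k ≤ 1) → Valid c := by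
    rintro ⟨k, hk, hk'⟩ hw hle
    refine ⟨⟨_, J.mem 11 le_rfl, hl⟩, ⟨_, J.mem k hk, ?_⟩, ?_⟩
    · rw [← Bool.not_eq_true, J.col k hk, Int.even_iff]
      have := J.nn k hk
      have := hle k hk
      omega
    · intro u hu v hv huv
      obtain ⟨i, hi, hi'⟩ := J.cov u hu
      obtain ⟨j, hj, hj'⟩ := J.cov v hv
      refine hi'.trans (Co.trans ?_ (hj'.symm ad_symm))
      refine (J.con i j hi hj).2 ?_
      have e1 : Even (H i) ↔ Even (H j) := by
        rw [← J.col i hi, ← J.col j hj, ← hi'.col, ← hj'.col, huv]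
      by_cases h : Even (H i)
      · have h' := e1.1 h
        rw [Int.even_iff] at h h'
        have a1 := J.nn i hi
        have a2 := J.nn j hj
        have a3 := hle i hi
        have a4 := hle j hj
        refine ⟨by omega, fun k hk => ?_⟩
        have := J.nn k (by omega)
        omega
      · exact hw i j hi hj h (by rwa [← e1])
  unfold FAn wb
  rw [← hnb]
  have h0 := J.b0
  have h00 := J.nn 0 (by omega)
  rcases (show nz w = 0 ∨ nz w = 1 ∨ nz w = 2 ∨ 3 ≤ nz w by omega) with hz | hz | hz | hz
  · have o1 : one w = false := by rw [← Bool.not_eq_true, nz_one]; omega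
    have o2 : udw w = false := by rw [← Bool.not_eq_true]; intro h; have := nz_udw w h; omega
    have : ¬ Valid c := by
      rintro ⟨-, ⟨u, hu, hc⟩, -⟩
      obtain ⟨k, hk, h⟩ := J.cov u hu
      have f := R_alle hR ((nz_alle w).1 hz)
      have := h.col
      rw [hc, eq_comm, ← Bool.not_eq_true, J.col k hk, f k (by omega) hk, ← f 11 (by omega) le_rfl, hH] at this
      simp at this
    simp [o1, o2, this]
  · have o1 : one w = true := (nz_one w).2 hz
    have o2 : udw w = false := by rw [← Bool.not_eq_true]; intro h; have := nz_udw w h; omega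
    obtain ⟨j, -, a2, a3, a4, a5⟩ := w_one hR hz
    have h1 : H 0 = 1 := by omega
    have cs : ∀ k, k ≤ 11 → (k ≤ j ∧ H k = 1) ∨ (j < k ∧ H k = 0) := by
      intro k hk
      rcases le_or_gt k j with h | h
      · exact Or.inl ⟨h, by rw [a3 k (by omega) h, h1]⟩
      · exact Or.inr ⟨h, by rw [a4 k h hk, hH]⟩
    have : Valid c := by
      refine val ⟨0, by omega, by omega⟩ ?_ ?_
      · intro i k hi hk h1 h2
        rw [Int.even_iff] at h1 h2
        have c1 := cs i hi
        have c2 := cs k hk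
        refine ⟨by omega, fun m hm => ?_⟩
        have c3 := cs m (by omega)
        omega
      · intro k hk; have := cs k hk; omega
    simp [o1, o2, this, hz]
  · have o1 : one w = false := by rw [← Bool.not_eq_true, nz_one]; omega
    obtain ⟨o2, i, j, -, a1, a2, a3, a4, a5⟩ := w_two hR hz (by omega) (by omega) (fun k _ hk => by rw [hH]; exact J.nn k hk)
    rw [hH] at a3 a4 a5
    have cs : ∀ k, k ≤ 11 → ((k ≤ i ∨ j < k) ∧ H k = 0) ∨ ((i < k ∧ k ≤ j) ∧ H k = 1) := by
      intro k hk
      rcases le_or_gt k i with h | h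
      · exact Or.inl ⟨Or.inl h, a3 k (by omega) h⟩
      · rcases le_or_gt k j with h' | h'
        · exact Or.inr ⟨⟨h, h'⟩, by rw [a4 k h h']; rfl⟩
        · exact Or.inl ⟨Or.inr h', a5 k h' hk⟩
    have : Valid c := by
      refine val ⟨j, by omega, by have := cs j (by omega); omega⟩ ?_ ?_
      · intro i' k hi hk h1 h2
        rw [Int.even_iff] at h1 h2
        have c1 := cs i' hi
        have c2 := cs k hk
        refine ⟨by omega, fun m hm => ?_⟩
        have c3 := cs m (by omega)
        omega
      · intro k hk; have := cs k hk; omega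
    simp [o1, o2, this, hz]
  · have o1 : one w = false := by rw [← Bool.not_eq_true, nz_one]; omega
    have o2 : udw w = false := by rw [← Bool.not_eq_true]; intro h; have := nz_udw w h; omega
    rw [if_neg (show ¬ nz w ≤ 1 by omega), if_neg (show ¬ nz w = 2 by omega)]
    simp [o1, o2]
end G
end

set_option linter.all false
noncomputable section
namespace G
open Sy
def H1 (x : ℤ) (H : ℕ → ℤ) (k : ℕ) : ℤ := if k = 0 then x else H (k - 1)
theorem Cn_shift (x : ℤ) (H : ℕ → ℤ) (i j : ℕ) (hi : i ≠ 0) (hj : j ≠ 0) : Cn (H1 x H) i j ↔ Cn H (i - 1) (j - 1) := by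
  unfold Cn H1
  rw [if_neg hi, if_neg hj]
  refine and_congr Iff.rfl ⟨fun h k hk => ?_, fun h k hk => ?_⟩
  · have := h (k + 1) (by omega); simpa using this
  · rw [if_neg (by omega)]; exact h (k - 1) (by omega)
theorem Pr_insz (b : Bool) (r : ℕ) : insert (r + 1, sg b 0) (Pr b r 11) = Pr b (r + 1) 0 := by
  ext ⟨x, y⟩
  cases b <;> simp [Pr, sg] <;> omega
theorem start_inv {c : ℕ × ℕ → Bool} {b : Bool} {r : ℕ} {H : ℕ → ℤ} (J : Inv ad c (Pr b r 11) 11 (fun k => (r, sg b k)) H) (x : ℤ)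
    (hx : c (r + 1, sg b 0) = c (r, sg b 0) ∧ x = H 0 ∨ c (r + 1, sg b 0) = false ∧ c (r, sg b 0) = true ∧ H 0 = 0 ∧ x = 1 ∧ H 11 = 0) :
    Inv ad c (Pr b (r + 1) 0) 12 (fr b r 0) (H1 x H) := by
  have hzP : (r + 1, sg b 0) ∉ Pr b r 11 := by simp only [Pr, Set.mem_setOf_eq]; omega
  have hN : ∀ v ∈ Pr b r 11, ad v (r + 1, sg b 0) → v = (r, sg b 0) := by
    rintro ⟨x, y⟩ h h'
    cases b <;> simp [Pr, sg, ad] at * <;> omega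
  have hxP : (r, sg b 0) ∈ Pr b r 11 := J.mem 0 (by omega)
  have hadj : ad (r, sg b 0) (r + 1, sg b 0) := Or.inr ⟨rfl, Or.inl rfl⟩
  have f0 : fr b r 0 0 = (r + 1, sg b 0) := rfl
  have f1 : ∀ k, fr b r 0 (k + 1) = (r, sg b k) := fun k => rfl
  have e1 : ∀ u v, u ∈ Pr b r 11 → v ∈ Pr b r 11 → (Co ad c (Pr b (r + 1) 0) u v ↔ Co ad c (Pr b r 11) u v) := by
    intro u v hu hv
    rw [← Pr_insz, addz ad_symm ad_irr _ hzP u v (fun h => hzP (h ▸ hu)) (fun h => hzP (h ▸ hv))]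
    refine ⟨?_, Or.inl⟩
    rintro (h | ⟨a, a', ⟨h1, h2, h3⟩, ⟨h4, h5, h6⟩, h7, h8⟩)
    · exact h
    · rw [hN a h1 h2] at h7; rw [hN a' h4 h5] at h8; exact h7.trans h8
  have e2 : ∀ v ∈ Pr b r 11, (Co ad c (Pr b (r + 1) 0) (r + 1, sg b 0) v ↔ c (r + 1, sg b 0) = c (r, sg b 0) ∧ Co ad c (Pr b r 11) (r, sg b 0) v) := by
    intro v hv
    constructor
    · intro h
      rcases Relation.ReflTransGen.cases_head h with h | ⟨a, ⟨h1, h2, h3, h4⟩, h5⟩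
      · exact absurd (h ▸ hv) hzP
      · rw [← Pr_insz] at h3
        rcases h3 with h3 | h3
        · rw [h3] at h1; exact absurd h1 (ad_irr _)
        · have h6 := hN a h3 (ad_symm _ _ h1)
          subst h6
          exact ⟨h4, (e1 _ _ hxP hv).1 h5⟩
    · rintro ⟨h1, h2⟩
      refine Co.trans (Co.single (ad_symm _ _ hadj) ?_ ?_ h1) ((e1 _ _ hxP hv).2 h2)
      · rw [← Pr_insz]; exact Or.inl rfl
      · rw [← Pr_insz]; exact Or.inr hxP
  have mem1 : ∀ k, k ≤ 11 → (r, sg b k) ∈ Pr b r 11 := fun k hk => J.mem k hk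
  have c0 := J.col 0 (by omega)
  have n0 := J.nn 0 (by omega)
  have g0 : H1 x H 0 = x := rfl
  have g1 : ∀ k, H1 x H (k + 1) = H k := fun k => rfl
  have hcn : ∀ k, k ≤ 11 → (Cn (H1 x H) 0 (k + 1) ↔ c (r + 1, sg b 0) = c (r, sg b 0) ∧ Cn H 0 k) := by
    intro k hk
    rcases hx with ⟨hc, hx⟩ | ⟨h1, h2, h3, h4, h5⟩
    · simp only [hc, true_and]
      rw [show Cn H 0 k ↔ Cn (H1 x H) 1 (k + 1) by rw [Cn_shift _ _ _ _ (by omega) (by omega)]; rfl]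
      have : Cn (H1 x H) 0 1 := by
        refine ⟨by rw [g0, g1 0, hx], fun m hm => ?_⟩
        rcases (show m = 0 ∨ m = 1 by omega) with rfl | rfl
        · exact le_rfl
        · rw [g0, g1 0, hx]
      exact ⟨fun h => this.symm.trans h, fun h => this.trans h⟩
    · rw [h1, h2]
      simp only [Bool.false_eq_true, false_and, iff_false]
      intro h
      have := h.2 1 (by omega)
      rw [g0, g1 0] at this; omega
  refine ⟨?_, ?_, ?_, ?_, ?_, ?_, ?_, ?_⟩
  · intro k hk
    rw [← Pr_insz]
    cases k with
    | zero => exact Or.inl rfl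
    | succ k => exact Or.inr (mem1 k (by omega))
  · intro j k hj hk
    cases j with
    | zero =>
      cases k with
      | zero => exact ⟨fun _ => Cn.refl _ _, fun _ => Co.refl _⟩
      | succ k => rw [f0, f1, e2 _ (mem1 k (by omega)), hcn k (by omega), J.con 0 k (by omega) (by omega)]
    | succ j =>
      cases k with
      | zero =>
        rw [f0, f1, Cn_comm, hcn j (by omega), ← J.con 0 j (by omega) (by omega), ← e2 _ (mem1 j (by omega))]
        exact ⟨fun h => h.symm ad_symm, fun h => h.symm ad_symm⟩
      | succ k =>
        rw [f1, f1, e1 _ _ (mem1 j (by omega)) (mem1 k (by omega)), Cn_shift _ _ _ _ (by omega) (by omega)]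
        exact J.con j k (by omega) (by omega)
  · intro v hv
    rw [← Pr_insz] at hv
    rcases hv with rfl | hv
    · exact ⟨0, by omega, Co.refl _⟩
    · obtain ⟨k, hk, h⟩ := J.cov v hv
      refine ⟨k + 1, by omega, ?_⟩
      rw [f1]
      exact (e1 _ _ hv (mem1 k hk)).2 h
  · intro k hk
    cases k with
    | zero =>
      rw [f0, g0]
      rcases hx with ⟨hc, hx⟩ | ⟨h1, h2, h3, h4, h5⟩
      · rw [hc, hx]; exact c0
      · rw [h1, h4]; simp
    | succ k => rw [f1, g1]; exact J.col k (by omega)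
  · intro k hk
    cases k with
    | zero => rw [g0]; omega
    | succ k => rw [g1]; exact J.nn k (by omega)
  · rw [g0]; have := J.b0; omega
  · exact J.bn
  · rw [g0, g1 11]
    have := J.bb
    omega
theorem sg_not (b : Bool) (k : ℕ) (hk : k ≤ 11) : sg (!b) k = sg b (11 - k) := by
  cases b <;> simp [sg]; omega
theorem Pr_full (b b' : Bool) (r : ℕ) : Pr b r 11 = Pr b' r 11 := by
  ext ⟨x, y⟩
  cases b <;> cases b' <;> simp [Pr, sg] <;> omega
theorem drop_inv {c : ℕ × ℕ → Bool} {b : Bool} {r : ℕ} {H : ℕ → ℤ} (J : Inv ad c (Pr b (r + 1) 11) 12 (fr b r 11) H)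
    (h1 : ∃ k, k ≤ 11 ∧ Cn H 12 k) (h2 : H 11 ≤ 1) (h3 : H 0 = 0 ∨ H 11 = 0) :
    Inv ad c (Pr (!b) (r + 1) 11) 11 (fun k => (r + 1, sg (!b) k)) (fun k => H (11 - k)) := by
  have f : ∀ k, k ≤ 11 → (r + 1, sg (!b) k) = fr b r 11 (11 - k) := by
    intro k hk
    rw [sg_not b k hk, fr, if_pos (by omega)]
  rw [Pr_full (!b) b]
  refine ⟨?_, ?_, ?_, ?_, ?_, ?_, ?_, ?_⟩
  · intro k hk
    rw [f k hk]; exact J.mem _ (by omega)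
  · intro j k hj hk
    rw [f j hj, f k hk, J.con _ _ (by omega) (by omega), ← Cn_rev H 11 (11 - j) (11 - k) (by omega) (by omega),
      show 11 - (11 - j) = j by omega, show 11 - (11 - k) = k by omega]
  · intro v hv
    obtain ⟨k, hk, h⟩ := J.cov v hv
    have : ∃ k, k ≤ 11 ∧ Co ad c (Pr b (r + 1) 11) v (fr b r 11 k) := by
      rcases (show k ≤ 11 ∨ k = 12 by omega) with h' | rfl
      · exact ⟨k, h', h⟩
      · obtain ⟨m, hm, hm'⟩ := h1
        exact ⟨m, hm, h.trans ((J.con 12 m le_rfl (by omega)).2 hm')⟩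
    obtain ⟨k, hk, h⟩ := this
    refine ⟨11 - k, by omega, ?_⟩
    rw [f _ (by omega), show 11 - (11 - k) = k by omega]; exact h
  · intro k hk
    rw [f k hk]; exact J.col _ (by omega)
  · intro k hk; exact J.nn _ (by omega)
  · exact h2
  · exact J.b0
  · exact h3.symm
theorem rem_black (c : ℕ × ℕ → Bool) (m r : ℕ) (hm : r + m = 11) (hr : ∀ k, k < 12 → c (r, k) = true)
    (h : ∀ x y, r < x → x < 12 → y < 12 → c (x, y) = true) : rem c m r = 1 := by
  induction m generalizing r with
  | zero =>
    have : r = 11 := by omega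
    subst this
    have : nb c = 0 := by
      unfold nb
      apply Finset.sum_eq_zero
      intro k hk
      rw [Finset.mem_range] at hk
      rw [hr k (by omega), hr (k + 1) (by omega)]; rfl
    simp [rem, wb, this]
  | succ m ih =>
    rw [rem, h (r + 1) 0 (by omega) (by omega) (by omega), h (r + 1) 11 (by omega) (by omega) (by omega), hr 11 (by omega),
      ih (r + 1) (by omega) (fun k hk => h _ _ (by omega) (by omega) hk) (fun x y h1 h2 h3 => h x y (by omega) h2 h3)]
    rfl
theorem allB_rows (c : ℕ × ℕ → Bool) (b : Bool) (x m : ℕ) : allB (rows c b x m) = true ↔ ∀ k y, x ≤ k → k < x + m → y < 12 → c (k, y) = true := by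
  induction m generalizing b x with
  | zero => simp [rows, allB]; intro k y h1 h2; omega
  | succ m ih =>
    have e0 : allB (rows c b x (m + 1)) = (((c (x, sg b 0) :: (List.range' 1 11).map (fun k => c (x, sg b k)))).all id && allB (rows c (!b) (x + 1) m)) := rfl
    rw [e0, Bool.and_eq_true, ih]
    have e1 : ((c (x, sg b 0) :: (List.range' 1 11).map (fun k => c (x, sg b k)))).all id = true ↔ ∀ y, y < 12 → c (x, y) = true := by
      rw [show (c (x, sg b 0) :: (List.range' 1 11).map (fun k => c (x, sg b k))) = (List.range' 0 12).map (fun k => c (x, sg b k)) from rfl,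
        List.all_map, List.all_eq_true]
      simp only [List.mem_range'_1, Function.comp, id]
      constructor
      · intro h y hy
        have := h (sg b y) (by have := sg_lt b y hy; omega)
        rwa [sg_sg b y hy] at this
      · intro h y hy
        exact h _ (sg_lt b y (by omega))
    rw [e1]
    constructor
    · rintro ⟨h1, h2⟩ k y h3 h4 h5
      rcases h3.eq_or_lt with rfl | h3
      · exact h1 y h5
      · exact h2 k y (by omega) (by omega) h5
    · intro h
      exact ⟨fun y hy => h x y le_rfl (by omega) hy, fun k y h1 h2 h3 => h k y (by omega) (by omega) h3⟩
end G
end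

set_option linter.all false
noncomputable section
namespace G
open Sy
theorem bf {x y : Bool} (h : x ≠ y) (hx : x = true) : y = false := by cases y <;> simp_all
theorem bt {x y : Bool} (h : x ≠ y) (hx : x = false) : y = true := by cases y <;> simp_all
open Classical in
theorem DD_eq {c : ℕ × ℕ → Bool} (hNC : Valid c → NC c) (m : ℕ) : ∀ r b H w, r + m = 11 → b = decide (m % 2 = 1) →
    Inv ad c (Pr b r 11) 11 (fun k => (r, sg b k)) H → RWd 11 H 0 w → c (r, 0) = true →
    DD b (rows c b (r + 1) m) w = if Valid c then rem c m r else 0 := by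
  induction m with
  | zero =>
    intro r b H w hr hb J hR hl
    obtain rfl : r = 11 := by omega
    subst hb
    exact DD_zero J hR hl
  | succ m ih =>
    intro r b H w hrm hb J hR hl
    have hr : r + 1 < 12 := by omega
    have hb' : (!b) = decide (m % 2 = 1) := by
      rw [hb]
      rcases Nat.mod_two_eq_zero_or_one m with h | h
      · rw [show (m + 1) % 2 = 1 by omega, h]; rfl
      · rw [show (m + 1) % 2 = 0 by omega, h]; rfl
    rw [rows, DD, rem]
    have hZ : (∀ x y, r + 1 < x → x < 12 → y < 12 → c (x, y) = true) → (cond (allB (rows c (!b) (r + 1 + 1) m)) 1 0 : ℕ) = 1 := by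
      intro h
      rw [(allB_rows c (!b) (r + 1 + 1) m).2 fun k y h1 h2 h3 => h k y (by omega) (by omega) h3]; rfl
    have hZ' : ¬ (∀ x y, r + 1 < x → x < 12 → y < 12 → c (x, y) = true) → (cond (allB (rows c (!b) (r + 1 + 1) m)) 1 0 : ℕ) = 0 := by
      intro h
      have : allB (rows c (!b) (r + 1 + 1) m) = false := by
        rw [← Bool.not_eq_true, allB_rows]
        intro h'
        exact h fun x y h1 h2 h3 => h' x y (by omega) (by omega) h3
      rw [this]; rfl
    -- the end of the row
    have endl : ∀ {H : ℕ → ℤ} {p : List Sy} {l : Sy}, Inv ad c (Pr b (r + 1) 11) 12 (fr b r 11) H → LWd H 12 (l :: p) →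
        c (r + 1, 0) = true → (∃ k, k ≤ 11 ∧ Cn H 12 k) → H 11 ≤ 1 → (H 0 = 0 ∨ H 11 = 0) →
        DD (!b) (rows c (!b) (r + 1 + 1) m) p = if Valid c then rem c m (r + 1) else 0 := by
      intro H p l J hL hl h1 h2 h3
      have := L_to_R hL.2 11 le_rfl
      exact ih (r + 1) (!b) (fun k => H (11 - k)) p (by omega) hb' (drop_inv J h1 h2 h3) this hl
    have f11 : fr b r 11 11 = (r + 1, sg b 11) := rfl
    have f12 : fr b r 11 12 = (r, sg b 11) := rfl
    have f0 : fr b r 11 0 = (r + 1, sg b 0) := rfl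
    have ende : ∀ {H : ℕ → ℤ} {p : List Sy}, Inv ad c (Pr b (r + 1) 11) 12 (fr b r 11) H → LWd H 12 (e :: p) →
        c (r + 1, 0) = true → DD (!b) (rows c (!b) (r + 1 + 1) m) p = if Valid c then rem c m (r + 1) else 0 := by
      intro H p J hL hl
      have h1 : H 11 = H 12 + sv e := hL.1
      simp only [sv, add_zero] at h1
      have h2 := J.bn
      have h3 := J.bb
      refine endl J hL hl ⟨11, le_rfl, h1.symm, fun k hk => ?_⟩ (by omega) (by omega)
      rcases (show k = 11 ∨ k = 12 by omega) with rfl | rfl <;> omega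
    have cole : ∀ {H : ℕ → ℤ} {p : List Sy}, Inv ad c (Pr b (r + 1) 11) 12 (fr b r 11) H → LWd H 12 (e :: p) → c (r + 1, sg b 11) = c (r, sg b 11) := by
      intro H p J hL
      have h1 : H 11 = H 12 + sv e := hL.1
      simp only [sv, add_zero] at h1
      have h2 := J.col 11 (by omega)
      have h3 := J.col 12 (by omega)
      rw [h1, ← h3, f11, f12] at h2
      exact Bool.eq_iff_iff.2 h2
    have cold : ∀ {H : ℕ → ℤ} {p : List Sy} {l : Sy}, Inv ad c (Pr b (r + 1) 11) 12 (fr b r 11) H → LWd H 12 (l :: p) → l ≠ e → c (r + 1, sg b 11) ≠ c (r, sg b 11) := by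
      intro H p l J hL hle heq
      have h1 : H 11 = H 12 + sv l := hL.1
      have h2 := J.col 11 (by omega)
      have h3 := J.col 12 (by omega)
      rw [f11, heq, ← f12, h3, h1, Int.even_iff, Int.even_iff] at h2
      cases l <;> simp [sv] at h2 hle <;> omega
    have start : ∀ (l : Sy) (t : ℕ), (c (r + 1, sg b 0) = c (r, sg b 0) ∧ l = e ∨ c (r + 1, sg b 0) = false ∧ c (r, sg b 0) = true ∧ H 11 = 0 ∧ l = u) → (¬ Valid c → t = 0) →
        (∀ H p l, Inv ad c (Pr b (r + 1) 11) 12 (fr b r 11) H → LWd H 12 (l :: p) → dK b (DD (!b) (rows c (!b) (r + 1 + 1) m)) p l = t) →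
        (Valid c → c (r, sg b 11) = true → (∀ k, k < 12 → c (r + 1, sg b k) = true) → (∀ x y, r + 1 < x → x < 12 → y < 12 → c (x, y) = true) → t = 1) →
        RW (dK b (DD (!b) (rows c (!b) (r + 1 + 1) m))) (cond (allB (rows c (!b) (r + 1 + 1) m)) 1 0) (c (r + 1, sg b 0))
          ((List.range' 1 11).map (fun k => c (r + 1, sg b k))) [] l w = t := by
      intro l t hl ht hK hω
      have h0 : c (r, sg b 0) = true → H 0 = 0 := by
        intro h
        have h1 := (J.col 0 (by omega)).1 h
        have h2 := J.nn 0 (by omega)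
        have h3 := J.b0
        rw [Int.even_iff] at h1; omega
      have hRs : RWd 12 (H1 (H 0 + sv l) H) 1 w := by
        have : ∀ {n f : ℕ} {w : List Sy} {H : ℕ → ℤ} {x : ℤ}, RWd n H f w → RWd (n + 1) (H1 x H) (f + 1) w := by
          intro n f w H x h
          induction w generalizing f with
          | nil => have : f = n := h; subst this; exact rfl
          | cons a w ih => exact ⟨h.1, ih h.2⟩
        exact this hR
      refine row hr hNC t ht _ _ hK hZ hZ' hω 11 0 [] l w (H1 (H 0 + sv l) H) rfl (start_inv J _ ?_) ⟨rfl, rfl⟩ hRs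
      rcases hl with ⟨h1, rfl⟩ | ⟨h1, h2, h3, rfl⟩
      · exact Or.inl ⟨h1, by simp [sv]⟩
      · exact Or.inr ⟨h1, h2, h0 h2, by rw [h0 h2]; rfl, h3⟩
    have remb : (∀ k, k < 12 → c (r + 1, k) = true) → (∀ x y, r + 1 < x → x < 12 → y < 12 → c (x, y) = true) → rem c m (r + 1) = 1 :=
      fun h1 h2 => rem_black c m (r + 1) (by omega) h1 h2
    have sgall : (∀ k, k < 12 → c (r + 1, sg b k) = true) → ∀ k, k < 12 → c (r + 1, k) = true := by
      intro h k hk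
      have := h (sg b k) (sg_lt b k hk)
      rwa [sg_sg b k hk] at this
    cases b with
    | true =>
      have s0 : sg true 0 = 0 := rfl
      have s11 : sg true 11 = 11 := rfl
      simp only [stR, cond_true]
      simp only [s0, s11] at start cole cold ⊢
      cases hv : c (r + 1, 0) with
      | false => simp
      | true =>
        rw [hv] at start
        simp only [cond_true, Bool.toNat_true, one_mul]
        refine start e _ (Or.inl ⟨hl.symm, rfl⟩) (fun h => if_neg h) ?_ ?_
        · intro H p l J hL
          have h0 : H 0 = 0 := by
            have h1 := (J.col 0 (by omega)).1 hv
            have h2 := J.nn 0 (by omega)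
            have h3 := J.b0
            rw [Int.even_iff] at h1; omega
          have hec : ec true p = true ↔ c (r + 1, 11) = true := by
            rw [ec_R (L_to_R hL.2 11 le_rfl) (by simp [h0])]
            exact (J.col 11 (by omega)).symm
          have e1 : H 11 = H 12 + sv l := hL.1
          have n12 := J.nn 12 (by omega)
          have n11 := J.nn 11 (by omega)
          have b12 := J.bn
          have c12 : c (r, 11) = true ↔ Even (H 12) := J.col 12 (by omega)
          have c11 : c (r + 1, 11) = true ↔ Even (H 11) := J.col 11 (by omega)
          cases l with
          | e =>
            rw [dK, ende J hL hv, cole J hL]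
            simp [rho]
          | u =>
            have hd := cold J hL (by simp)
            simp only [dK, cond_true]
            cases hc : c (r + 1, 11) with
            | true =>
              rw [hec.2 hc]
              have : c (r, 11) = false := bf hd hc
              simp [this, rho]
            | false =>
              have h1 : ec true p = false := by rw [← Bool.not_eq_true, hec, hc]; simp
              have h2 : c (r, 11) = true := bt hd hc
              rw [h1, cond_false, h2]
              have h3 := c12.1 h2
              rw [Int.even_iff] at h3
              simp only [sv] at e1
              rw [endl J hL hv ⟨0, by omega, by omega, fun k hk => by have := J.nn k (by omega); omega⟩ (by omega) (Or.inl h0)]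
              simp only [rho]
              by_cases hV : Valid c
              · simp [hV, mul_comm]
              · simp [hV]
          | d =>
            have hd := cold J hL (by simp)
            simp only [dK]
            simp only [sv] at e1
            have h1 : c (r + 1, 11) = true := by rw [c11, show H 11 = 0 by omega]; simp
            have : c (r, 11) = false := bf hd h1
            rw [h1]
            simp [this, rho]
        · intro hV h1 h2 h3
          rw [if_pos hV, remb (sgall h2) h3, h1, sgall h2 11 (by omega)]; rfl
    | false =>
      have s0 : sg false 0 = 11 := rfl
      have s11 : sg false 11 = 0 := rfl
      simp only [stR, cond_false]
      simp only [s0, s11] at start cole cold ⊢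
      have h11 : H 11 = 0 := by
        have h1 := (J.col 11 (by omega)).1 hl
        have h2 := J.nn 11 (by omega)
        have h3 := J.bn
        rw [Int.even_iff] at h1; omega
      have hec : ec true w = c (r, 11) := by
        rw [Bool.eq_iff_iff, ec_R hR (by simp [h11])]
        exact (J.col 0 (by omega)).symm
      rw [hec]
      have main : ∀ l, (c (r + 1, 11) = c (r, 11) ∧ l = e ∨ c (r + 1, 11) = false ∧ c (r, 11) = true ∧ H 11 = 0 ∧ l = u) →
        RW (dK false (DD (!false) (rows c (!false) (r + 1 + 1) m))) (cond (allB (rows c (!false) (r + 1 + 1) m)) 1 0) (c (r + 1, 11))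
          ((List.range' 1 11).map (fun k => c (r + 1, sg false k))) [] l w = if Valid c then (c (r + 1, 0)).toNat * rem c m (r + 1) else 0 := by
        intro l hs
        refine start l _ hs (fun h => if_neg h) ?_ ?_
        · intro H p l J hL
          have ne0 : l ≠ e → c (r + 1, 0) = false := by
            intro h
            exact bf (cold J hL h).symm hl
          cases l with
          | e =>
            have hv : c (r + 1, 0) = true := (cole J hL).trans hl
            rw [dK, ende J hL hv, hv]; simp
          | u => rw [ne0 (by simp)]; simp [dK]
          | d => rw [ne0 (by simp)]; simp [dK]
        · intro hV h1 h2 h3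
          rw [if_pos hV, remb (sgall h2) h3, sgall h2 0 (by omega)]; rfl
      cases hx : c (r, 11) <;> cases hy : c (r + 1, 11) <;> rw [hx, hy] at main
      · simp only [BEq.rfl, cond_true, rho, one_mul]
        exact main e (Or.inl ⟨rfl, rfl⟩)
      · simp [rho]
      · have := main u (Or.inr ⟨rfl, rfl, h11, rfl⟩)
        show RW _ _ _ _ _ _ _ * 4 = if Valid c then _ * (4 * _) else 0
        rw [this]
        by_cases hV : Valid c
        · simp [hV]; ring
        · simp [hV]
      · simp only [BEq.rfl, cond_true, rho, one_mul]
        exact main e (Or.inl ⟨rfl, rfl⟩)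
end G
end

set_option linter.all false
noncomputable section
namespace G
open Sy
/-- number of changes of a sequence of colours -/
def chF (g : ℕ → Bool) (n : ℕ) : ℕ := ∑ k ∈ Finset.range n, if g k = g (k + 1) then 0 else 1
theorem chF_succ (g : ℕ → Bool) (n : ℕ) : chF g (n + 1) = chF g n + if g n = g (n + 1) then 0 else 1 := Finset.sum_range_succ _ _
theorem chF_zero {g : ℕ → Bool} {n : ℕ} (h : chF g n = 0) : ∀ k, k ≤ n → g k = g 0 := by
  induction n with
  | zero => intro k hk; rw [show k = 0 by omega]
  | succ n ih =>
    rw [chF_succ] at h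
    intro k hk
    rcases (show k ≤ n ∨ k = n + 1 by omega) with hk | rfl
    · exact ih (by omega) k hk
    · by_cases h' : g n = g (n + 1)
      · rw [← h']; exact ih (by omega) n le_rfl
      · rw [if_neg h'] at h; omega
theorem chF_one {g : ℕ → Bool} {n : ℕ} (h : chF g n ≤ 1) (h0 : g 0 = true) : ∃ i, 1 ≤ i ∧ i ≤ n + 1 ∧ ∀ k, k ≤ n → g k = decide (k < i) := by
  induction n with
  | zero => exact ⟨1, le_rfl, by omega, fun k hk => by rw [show k = 0 by omega, h0]; rfl⟩
  | succ n ih =>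
    rw [chF_succ] at h
    by_cases h' : g n = g (n + 1)
    · obtain ⟨i, h1, h2, h3⟩ := ih (by omega)
      rcases (show i = n + 1 ∨ i ≤ n by omega) with hi | hi
      · refine ⟨n + 2, by omega, by omega, fun k hk => ?_⟩
        rcases (show k ≤ n ∨ k = n + 1 by omega) with hk | rfl
        · rw [h3 k hk]; simp; omega
        · rw [← h', h3 n le_rfl]; simp; omega
      · refine ⟨i, by omega, by omega, fun k hk => ?_⟩
        rcases (show k ≤ n ∨ k = n + 1 by omega) with hk | rfl
        · exact h3 k hk
        · rw [← h', h3 n le_rfl]; simp; omega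
    · rw [if_neg h'] at h
      have := chF_zero (show chF g n = 0 by omega)
      refine ⟨n + 1, by omega, by omega, fun k hk => ?_⟩
      rcases (show k ≤ n ∨ k = n + 1 by omega) with hk | rfl
      · rw [this k hk, h0]; simp; omega
      · rw [this n le_rfl, h0] at h'
        simp at h' ⊢; exact h'
theorem chF_step {g : ℕ → Bool} {n i : ℕ} (hi : 1 ≤ i) (h : ∀ k, k ≤ n → g k = decide (k < i)) : chF g n = if i ≤ n then 1 else 0 := by
  have : chF g n = ∑ k ∈ Finset.range n, if k = i - 1 then 1 else 0 := by
    apply Finset.sum_congr rfl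
    intro k hk
    rw [Finset.mem_range] at hk
    rw [h k (by omega), h (k + 1) (by omega)]
    by_cases h1 : k = i - 1
    · rw [if_pos h1, if_neg]; simp; omega
    · rw [if_neg h1, if_pos]; simp; omega
  rw [this, Finset.sum_ite_eq']
  simp only [Finset.mem_range]
  refine if_congr ?_ rfl rfl
  omega
def wt (n : ℕ) : ℕ := if n = 0 then 1 else if n = 1 then 2 else 0
theorem ini_all (g : ℕ → Bool) (n s : ℕ) (f : List Sy → ℕ) (h : ∀ k, s ≤ k → k < s + n → g k = true) :
    ini ((List.range' s n).map g) f = f (List.replicate n e) := by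
  induction n generalizing s f with
  | zero => rfl
  | succ n ih =>
    rw [List.range'_succ, List.map_cons, h s le_rfl (by omega), ini, ih _ _ (fun k h1 h2 => h k (by omega) (by omega))]
    rfl
theorem ini_step (g : ℕ → Bool) (n s i : ℕ) (f : List Sy → ℕ) (h1 : s ≤ i) (h2 : i < s + n) (h : ∀ k, s ≤ k → k < s + n → g k = decide (k < i)) :
    ini ((List.range' s n).map g) f = 2 * f (List.replicate (i - s) e ++ u :: List.replicate (s + n - i - 1) e) := by
  induction n generalizing s f with
  | zero => omega
  | succ n ih =>
    rw [List.range'_succ, List.map_cons, h s le_rfl (by omega)]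
    rcases h1.eq_or_lt with rfl | h1
    · have : ((List.range' (s + 1) n).map g).all (fun x => !x) = true := by
        rw [List.all_map, List.all_eq_true]
        simp only [List.mem_range'_1, Function.comp]
        intro k hk
        rw [h k (by omega) (by omega)]; simp; omega
      rw [show decide (s < s) = false by simp, ini, this]
      simp
    · rw [show decide (s < i) = true by simpa using h1, ini, ih (s + 1) _ h1 (by omega) (fun k h1 h2 => h k (by omega) (by omega))]
      rw [show i - s = (i - (s + 1)) + 1 by omega, List.replicate_succ, show s + (n + 1) - i - 1 = s + 1 + n - i - 1 by omega]
      rfl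
theorem ini_none (g : ℕ → Bool) (n s : ℕ) (f : List Sy → ℕ) (h : ini ((List.range' s n).map g) f ≠ 0) :
    ∃ i, s ≤ i ∧ ∀ k, s ≤ k → k < s + n → g k = decide (k < i) := by
  induction n generalizing s f with
  | zero => exact ⟨s, le_rfl, fun k h1 h2 => by omega⟩
  | succ n ih =>
    rw [List.range'_succ, List.map_cons] at h
    cases hs : g s with
    | true =>
      rw [hs, ini] at h
      obtain ⟨i, h1, h2⟩ := ih _ _ h
      refine ⟨i, by omega, fun k h3 h4 => ?_⟩
      rcases h3.eq_or_lt with rfl | h3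
      · rw [hs]; simp; omega
      · exact h2 k h3 (by omega)
    | false =>
      rw [hs, ini] at h
      have : ((List.range' (s + 1) n).map g).all (fun x => !x) = true := by
        by_contra h'
        rw [Bool.not_eq_true] at h'
        rw [h'] at h; simp at h
      rw [List.all_map, List.all_eq_true] at this
      simp only [List.mem_range'_1, Function.comp] at this
      refine ⟨s, le_rfl, fun k h3 h4 => ?_⟩
      rcases h3.eq_or_lt with rfl | h3
      · rw [hs]; simp
      · have := this k (by omega)
        simp at this
        rw [this]; simp; omega
theorem top_inv {c : ℕ × ℕ → Bool} (i : ℕ) (hi : 1 ≤ i) (h : ∀ k, k ≤ 11 → c (0, k) = decide (k < i)) :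
    Inv ad c (Pr true 0 11) 11 (fun k => (0, sg true k)) (fun k => if k < i then 0 else 1) := by
  have hP : ∀ k, k ≤ 11 → (0, k) ∈ Pr true 0 11 := fun k hk => by simp [Pr, sg]; omega
  have path : ∀ j k, j ≤ k → k ≤ 11 → c (0, j) = c (0, k) → Co ad c (Pr true 0 11) (0, j) (0, k) := by
    intro j k hjk hk hc
    refine Co_path (fun k => (0, k)) j k hjk (fun m _ _ => Or.inl ⟨rfl, Or.inl rfl⟩) (fun m _ _ => hP m (by omega)) (c (0, j)) ?_
    intro m h1 h2
    rw [h j (by omega), h k (by omega)] at hc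
    simp only [h m (by omega), h j (by omega)]
    simp at hc ⊢; omega
  refine ⟨fun k hk => hP k hk, ?_, ?_, ?_, ?_, ?_, ?_, ?_⟩
  · intro j k hj hk
    constructor
    · intro hC
      have hc := hC.col
      simp only [sg, cond_true] at hc
      rw [h j hj, h k hk] at hc
      simp at hc
      refine ⟨by simp only; split_ifs <;> omega, fun m hm => ?_⟩
      simp only
      split_ifs <;> omega
    · intro hC
      have hc := hC.1
      have hc' : c (0, j) = c (0, k) := by
        rw [h j hj, h k hk]
        simp only at hc
        simp
        split_ifs at hc <;> omega
      rcases le_total j k with hjk | hjk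
      · exact path j k hjk hk hc'
      · exact (path k j hjk hj hc'.symm).symm ad_symm
  · rintro ⟨x, y⟩ hv
    simp only [Pr, Set.mem_setOf_eq] at hv
    refine ⟨y, by omega, ?_⟩
    rw [show x = 0 by omega]; exact Co.refl _
  · intro k hk
    simp only [sg, cond_true]
    rw [h k hk]
    by_cases hki : k < i <;> simp [hki]
  · intro k hk; split_ifs <;> omega
  · split_ifs <;> omega
  · split_ifs <;> omega
  · left; rw [if_pos (by omega)]
/-- colouring to list of rows -/
def full (c : ℕ × ℕ → Bool) : List (List Bool) := (c (0, 0) :: (List.range' 1 11).map (fun k => c (0, k))) :: rows c true 1 11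
def om (c : ℕ × ℕ → Bool) : ℕ := (c (0, 0)).toNat * (wt (chF (fun k => c (0, k)) 11) * rem c 11 0)
theorem RW_e {n : ℕ} {H : ℕ → ℤ} (m f : ℕ) (hf : f + m = n) (h : ∀ k, f ≤ k → k < n → H (k + 1) = H k) : RWd n H f (List.replicate m e) := by
  induction m generalizing f with
  | zero => exact hf
  | succ m ih => exact ⟨by simp [sv]; exact h f le_rfl (by omega), ih (f + 1) (by omega) (fun k h1 h2 => h k (by omega) h2)⟩
theorem RW_eu {n : ℕ} {H : ℕ → ℤ} (m m' f : ℕ) (hf : f + m + 1 + m' = n) (h : ∀ k, f ≤ k → k < n → k ≠ f + m → H (k + 1) = H k) (h' : H (f + m + 1) = H (f + m) + 1) :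
    RWd n H f (List.replicate m e ++ u :: List.replicate m' e) := by
  induction m generalizing f with
  | zero => exact ⟨h', RW_e m' (f + 1) (by omega) (fun k h1 h2 => h k (by omega) h2 (by omega))⟩
  | succ m ih =>
    refine ⟨by simp [sv]; exact h f le_rfl (by omega) (by omega), ih (f + 1) (by omega) (fun k h1 h2 h3 => h k (by omega) h2 (by omega)) ?_⟩
    rw [show f + 1 + m = f + (m + 1) by omega]; exact h'
open Classical in
theorem DT_eq {c : ℕ × ℕ → Bool} (hNC : Valid c → NC c) : DT (full c) = if Valid c then om c else 0 := by
  unfold full om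
  cases h0 : c (0, 0) with
  | false => simp [DT]
  | true =>
    rw [DT]
    simp only [Bool.toNat_true, one_mul]
    have key : ∀ i, 1 ≤ i → (∀ k, k ≤ 11 → c (0, k) = decide (k < i)) → ∀ w, RWd 11 (fun k => if k < i then 0 else 1) 0 w →
        DD true (rows c true 1 11) w = if Valid c then rem c 11 0 else 0 := by
      intro i hi h w hw
      exact DD_eq hNC 11 0 true _ w rfl rfl (top_inv i hi h) hw h0
    by_cases hz : ini ((List.range' 1 11).map (fun k => c (0, k))) (DD true (rows c true 1 11)) = 0
    · rw [hz]
      by_cases hc : chF (fun k => c (0, k)) 11 ≤ 1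
      · obtain ⟨i, h1, h2, h3⟩ := chF_one hc h0
        by_cases hi : i = 12
        · subst hi
          rw [ini_all (fun k => c (0, k)) 11 1 _ (fun k h1 h2 => by simp only [h3 k (by omega)]; simp; omega)] at hz
          rw [key 12 (by omega) h3 _ (RW_e 11 0 rfl (fun k h1 h2 => by rw [if_pos (by omega), if_pos (by omega)]))] at hz
          by_cases hV : Valid c
          · rw [if_pos hV] at hz ⊢; rw [hz, mul_zero]
          · rw [if_neg hV]
        · rw [ini_step (fun k => c (0, k)) 11 1 i _ h1 (by omega) (fun k h1 h2 => h3 k (by omega))] at hz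
          rw [key i (by omega) h3 _ (RW_eu (i - 1) _ 0 (by omega) (fun k h1 h2 h3 => by split_ifs <;> omega) (by rw [if_neg (by omega), if_pos (by omega)]; rfl))] at hz
          by_cases hV : Valid c
          · rw [if_pos hV] at hz ⊢; rw [show rem c 11 0 = 0 by omega, mul_zero]
          · rw [if_neg hV]
      · rw [wt, if_neg (show ¬ chF (fun k => c (0, k)) 11 = 0 by omega), if_neg (show ¬ chF (fun k => c (0, k)) 11 = 1 by omega)]; simp
    · obtain ⟨i, h1, h2⟩ := ini_none _ _ _ _ hz
      have h3 : ∀ k, k ≤ 11 → c (0, k) = decide (k < i) := by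
        intro k hk
        rcases (show k = 0 ∨ 1 ≤ k by omega) with rfl | hk'
        · rw [h0]; simp; omega
        · exact h2 k hk' (by omega)
      by_cases hi : 12 ≤ i
      · rw [ini_all (fun k => c (0, k)) 11 1 _ (fun k h1 h2 => by simp only [h3 k (by omega)]; simp; omega),
          key i (by omega) h3 _ (RW_e 11 0 rfl (fun k h1 h2 => by rw [if_pos (by omega), if_pos (by omega)])),
          chF_step (g := fun k => c (0, k)) h1 h3, if_neg (show ¬ i ≤ 11 by omega)]
        simp [wt]
      · rw [ini_step (fun k => c (0, k)) 11 1 i _ h1 (by omega) (fun k h1 h2 => h3 k (by omega)),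
          key i (by omega) h3 _ (RW_eu (i - 1) _ 0 (by omega) (fun k h1 h2 h3 => by split_ifs <;> omega) (by rw [if_neg (by omega), if_pos (by omega)]; rfl)),
          chF_step (g := fun k => c (0, k)) h1 h3, if_pos (show i ≤ 11 by omega)]
        simp [wt]
end G
end

set_option linter.all false
noncomputable section
namespace G
open Finset in
theorem tree_bound (B : Finset (ℕ × ℕ)) (E : Finset ((ℕ × ℕ) × (ℕ × ℕ))) (hE : ∀ p ∈ E, p.1 ∈ B ∧ p.2 ∈ B) (hB : B.Nonempty)
    (h : ∀ u ∈ B, ∀ v ∈ B, Relation.EqvGen (fun a b => (a, b) ∈ E) u v) : B.card ≤ E.card + 1 := by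
  classical
  let G : SimpleGraph B := SimpleGraph.fromRel (fun a b => (a.1, b.1) ∈ E)
  have hr : ∀ u v, Relation.EqvGen (fun a b => (a, b) ∈ E) u v → (u ∈ B ↔ v ∈ B) ∧ ∀ hu hv, G.Reachable ⟨u, hu⟩ ⟨v, hv⟩ := by
    intro u v huv
    induction huv with
    | rel a b hab =>
      refine ⟨⟨fun _ => (hE _ hab).2, fun _ => (hE _ hab).1⟩, fun hu hv => ?_⟩
      by_cases hne : a = b
      · subst hne; exact SimpleGraph.Reachable.refl _
      · apply SimpleGraph.Adj.reachable
        rw [SimpleGraph.fromRel_adj]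
        exact ⟨fun h => hne (congrArg Subtype.val h), Or.inl hab⟩
    | refl a => exact ⟨Iff.rfl, fun _ _ => SimpleGraph.Reachable.refl _⟩
    | symm a b _ ih => exact ⟨ih.1.symm, fun hu hv => (ih.2 hv hu).symm⟩
    | trans a b c _ _ ih1 ih2 => exact ⟨ih1.1.trans ih2.1, fun hu hv => (ih1.2 hu (ih1.1.1 hu)).trans (ih2.2 _ hv)⟩
  have hc : G.Connected := by
    haveI : Nonempty B := ⟨⟨hB.choose, hB.choose_spec⟩⟩
    refine ⟨fun u v => (hr u v (h u u.2 v v.2)).2 u.2 v.2⟩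
  have h1 := hc.card_vert_le_card_edgeSet_add_one
  have h2 : Nat.card G.edgeSet ≤ E.card := by
    have : G.edgeSet ⊆ ((E.attach.image (fun p => s((⟨p.1.1, (hE _ p.2).1⟩ : B), (⟨p.1.2, (hE _ p.2).2⟩ : B))) : Finset (Sym2 B)) : Set (Sym2 B)) := by
      intro x hx
      induction x with | _ a b
      rw [SimpleGraph.mem_edgeSet, SimpleGraph.fromRel_adj] at hx
      rw [Finset.mem_coe, Finset.mem_image]
      rcases hx.2 with hx | hx
      · exact ⟨⟨(a.1, b.1), hx⟩, Finset.mem_attach _ _, rfl⟩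
      · exact ⟨⟨(b.1, a.1), hx⟩, Finset.mem_attach _ _, Sym2.eq_swap⟩
    have h3 := Set.ncard_le_ncard this (Finset.finite_toSet _)
    rw [Set.ncard_coe_finset] at h3
    refine (le_of_eq (Nat.card_coe_set_eq _)).trans (h3.trans (Finset.card_image_le.trans ?_))
    rw [Finset.card_attach]
  rw [Nat.card_eq_fintype_card, Fintype.card_coe] at h1
  omega
def EV (c : ℕ × ℕ → Bool) : Finset ((ℕ × ℕ) × (ℕ × ℕ)) :=
  ((Finset.range 11 ×ˢ Finset.range 12).filter (fun p => c (p.1, p.2) = c (p.1 + 1, p.2))).image (fun p => ((p.1, p.2), (p.1 + 1, p.2)))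
def EH0 (c : ℕ × ℕ → Bool) (j : ℕ) : Finset ((ℕ × ℕ) × (ℕ × ℕ)) :=
  ((Finset.range 11).filter (fun k => c (0, k) = c (0, k + 1) ∧ k ≠ j)).image (fun k => ((0, k), (0, k + 1)))
def EH1 (c : ℕ × ℕ → Bool) : Finset ((ℕ × ℕ) × (ℕ × ℕ)) :=
  ((Finset.range 11 ×ˢ Finset.range 11).filter (fun p => c (p.1 + 1, p.2) = c (p.1 + 1, p.2 + 1) ∧
    ¬ (c (p.1, p.2) = c (p.1, p.2 + 1) ∧ c (p.1, p.2) = c (p.1 + 1, p.2)))).image (fun p => ((p.1 + 1, p.2), (p.1 + 1, p.2 + 1)))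
def EE (c : ℕ × ℕ → Bool) (j : ℕ) : Finset ((ℕ × ℕ) × (ℕ × ℕ)) := EV c ∪ EH0 c j ∪ EH1 c
def RR (c : ℕ × ℕ → Bool) (j : ℕ) : ℕ × ℕ → ℕ × ℕ → Prop := Relation.EqvGen (fun a b => (a, b) ∈ EE c j)
variable {c : ℕ × ℕ → Bool} {j : ℕ}
theorem RR.trans {a b d : ℕ × ℕ} (h : RR c j a b) (h' : RR c j b d) : RR c j a d := Relation.EqvGen.trans _ _ _ h h'
theorem RR.symm {a b : ℕ × ℕ} (h : RR c j a b) : RR c j b a := Relation.EqvGen.symm _ _ h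
theorem RR_v (r k : ℕ) (hr : r < 11) (hk : k < 12) (h : c (r, k) = c (r + 1, k)) : RR c j (r, k) (r + 1, k) := by
  apply Relation.EqvGen.rel
  simp only [EE, Finset.mem_union]
  refine Or.inl (Or.inl ?_)
  rw [EV, Finset.mem_image]
  exact ⟨(r, k), by simp [h, hr, hk], rfl⟩
theorem RR_h0 (k : ℕ) (hk : k < 11) (hj : k ≠ j) (h : c (0, k) = c (0, k + 1)) : RR c j (0, k) (0, k + 1) := by
  apply Relation.EqvGen.rel
  simp only [EE, Finset.mem_union]
  refine Or.inl (Or.inr ?_)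
  rw [EH0, Finset.mem_image]
  exact ⟨k, by simp [h, hj, hk], rfl⟩
theorem RR_h1 (r k : ℕ) (hr : r < 11) (hk : k < 11) (h : c (r + 1, k) = c (r + 1, k + 1))
    (h' : c (r, k) = c (r, k + 1) → c (r, k) = c (r + 1, k) → RR c j (r, k) (r, k + 1)) : RR c j (r + 1, k) (r + 1, k + 1) := by
  by_cases hm : c (r, k) = c (r, k + 1) ∧ c (r, k) = c (r + 1, k)
  · refine (RR_v r k hr (by omega) hm.2).symm.trans ((h' hm.1 hm.2).trans (RR_v r (k + 1) hr (by omega) ?_))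
    rw [← hm.1, hm.2, h]
  · apply Relation.EqvGen.rel
    simp only [EE, Finset.mem_union]
    refine Or.inr ?_
    rw [EH1, Finset.mem_image]
    exact ⟨(r, k), by simp only [Finset.mem_filter, Finset.mem_product, Finset.mem_range]; exact ⟨⟨hr, hk⟩, h, hm⟩, rfl⟩
theorem RR_h (r k : ℕ) (hr : r < 12) (hk : k < 11) (h0 : c (0, k) = c (0, k + 1) → RR c j (0, k) (0, k + 1)) (h : c (r, k) = c (r, k + 1)) : RR c j (r, k) (r, k + 1) := by
  induction r with
  | zero => exact h0 h
  | succ r ih => exact RR_h1 r k (by omega) hk h (fun h1 _ => ih (by omega) h1)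
theorem RR_h2 (r k x : ℕ) (hr : r < 12) (hk : k < 11) (hx : x ≤ r) (hc : c (x, k) ≠ c (r, k)) (h : c (r, k) = c (r, k + 1)) : RR c j (r, k) (r, k + 1) := by
  induction r with
  | zero => rw [show x = 0 by omega] at hc; exact absurd rfl hc
  | succ r ih =>
    have : x ≤ r := by
      rcases (show x ≤ r ∨ x = r + 1 by omega) with h | rfl
      · exact h
      · exact absurd rfl hc
    exact RR_h1 r k (by omega) hk h (fun h1 h2 => ih (by omega) this (by rwa [h2]) h1)
theorem RR_path (γ : ℕ → ℕ × ℕ) (m n : ℕ) (hmn : m ≤ n) (h : ∀ k, m ≤ k → k < n → RR c j (γ k) (γ (k + 1))) : RR c j (γ m) (γ n) := by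
  induction n, hmn using Nat.le_induction with
  | base => exact Relation.EqvGen.refl _
  | succ n hn ih => exact (ih (fun k h1 h2 => h k h1 (by omega))).trans (h n hn (by omega))
theorem RR_all (h : ∀ r k, r < 12 → k < 11 → c (r, k) = c (r, k + 1) → RR c j (r, k) (r, k + 1)) (u v : ℕ × ℕ) (hC : Co ad c Bd u v) : RR c j u v := by
  induction hC with
  | refl => exact Relation.EqvGen.refl _
  | @tail v w _ hvw ih =>
    refine ih.trans ?_
    obtain ⟨h1, h2, h3, h4⟩ := hvw
    obtain ⟨x, y⟩ := v
    obtain ⟨x', y'⟩ := w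
    simp only [Bd, Set.mem_setOf_eq] at h2 h3
    simp only [ad] at h1
    rcases h1 with ⟨rfl, rfl | rfl⟩ | ⟨rfl, rfl | rfl⟩
    · exact h _ _ h2.1 (by omega) h4
    · exact (h _ _ h2.1 (by omega) h4.symm).symm
    · exact RR_v _ _ (by omega) h2.2 h4
    · exact (RR_v _ _ (by omega) h2.2 h4.symm).symm
theorem EE_card (hV : Valid c) (h : ∀ r k, r < 12 → k < 11 → c (r, k) = c (r, k + 1) → RR c j (r, k) (r, k + 1)) : 142 ≤ (EE c j).card := by
  obtain ⟨⟨x, hx, hcx⟩, ⟨y, hy, hcy⟩, hco⟩ := hV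
  have hB : ∀ u, u ∈ Bd ↔ u ∈ Finset.range 12 ×ˢ Finset.range 12 := by
    rintro ⟨a, b⟩
    simp [Bd]
  have := tree_bound (Finset.range 12 ×ˢ Finset.range 12) (insert (x, y) (EE c j)) ?_ ⟨x, (hB x).1 hx⟩ ?_
  · have h1 := Finset.card_insert_le (x, y) (EE c j)
    rw [Finset.card_product, Finset.card_range] at this
    omega
  · intro p hp
    rw [Finset.mem_insert] at hp
    rcases hp with rfl | hp
    · exact ⟨(hB _).1 hx, (hB _).1 hy⟩
    · simp only [EE, Finset.mem_union, EV, EH0, EH1, Finset.mem_image, Finset.mem_filter, Finset.mem_product, Finset.mem_range] at hp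
      rcases hp with (⟨q, hq, rfl⟩ | ⟨q, hq, rfl⟩) | ⟨q, hq, rfl⟩ <;> simp only [Finset.mem_product, Finset.mem_range] <;> omega
  · intro u hu v hv
    rw [← hB] at hu hv
    have mono : ∀ a b, RR c j a b → Relation.EqvGen (fun a b => (a, b) ∈ insert (x, y) (EE c j)) a b := by
      intro a b hab
      induction hab with
      | rel a b h => exact Relation.EqvGen.rel _ _ (Finset.mem_insert_of_mem h)
      | refl a => exact Relation.EqvGen.refl _
      | symm a b _ ih => exact Relation.EqvGen.symm _ _ ih
      | trans a b d _ _ ih1 ih2 => exact Relation.EqvGen.trans _ _ _ ih1 ih2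
    have key : ∀ u ∈ Bd, Relation.EqvGen (fun a b => (a, b) ∈ insert (x, y) (EE c j)) u x := by
      intro u hu
      cases hcu : c u with
      | true => exact mono _ _ (RR_all h u x (hco u hu x hx (by rw [hcu, hcx])))
      | false =>
        refine Relation.EqvGen.trans _ _ _ (mono _ _ (RR_all h u y (hco u hu y hy (by rw [hcu, hcy])))) ?_
        exact Relation.EqvGen.symm _ _ (Relation.EqvGen.rel _ _ (Finset.mem_insert_self _ _))
    exact Relation.EqvGen.trans _ _ _ (key u hu) (Relation.EqvGen.symm _ _ (key v hv))
end G
end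

set_option linter.all false
noncomputable section
namespace G
variable {c : ℕ × ℕ → Bool} {j : ℕ}
/-- indicator of different values -/
def df (x y : Bool) : ℕ := if x = y then 0 else 1
def qi (c : ℕ × ℕ → Bool) (r k : ℕ) : ℕ := if c (r + 1, k) = c (r + 1, k + 1) ∧ ¬ (c (r, k) = c (r, k + 1) ∧ c (r, k) = c (r + 1, k)) then 1 else 0
def ki (c : ℕ × ℕ → Bool) (r k : ℕ) : ℕ := if c (r, k) ≠ c (r, k + 1) ∧ c (r + 1, k) ≠ c (r + 1, k + 1) ∧ c (r, k) ≠ c (r + 1, k) then 1 else 0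
theorem sq_id (r k : ℕ) : 2 * qi c r k + df (c (r + 1, k)) (c (r + 1, k + 1)) + 2 * ki c r k =
    df (c (r, k)) (c (r + 1, k)) + df (c (r, k + 1)) (c (r + 1, k + 1)) + df (c (r, k)) (c (r, k + 1)) := by
  unfold qi ki df
  generalize c (r, k) = x
  generalize c (r + 1, k) = y
  generalize c (r, k + 1) = z
  generalize c (r + 1, k + 1) = w
  revert x y z w
  decide
theorem row_id (c : ℕ × ℕ → Bool) (r n : ℕ) : 2 * (∑ k ∈ Finset.range n, qi c r k) + (∑ k ∈ Finset.range n, df (c (r + 1, k)) (c (r + 1, k + 1))) +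
    2 * (∑ k ∈ Finset.range n, ki c r k) + df (c (r, 0)) (c (r + 1, 0)) + df (c (r, n)) (c (r + 1, n)) =
    2 * (∑ k ∈ Finset.range (n + 1), df (c (r, k)) (c (r + 1, k))) + ∑ k ∈ Finset.range n, df (c (r, k)) (c (r, k + 1)) := by
  induction n with
  | zero => simp; omega
  | succ n ih =>
    have := sq_id (c := c) r n
    rw [Finset.sum_range_succ _ (n + 1)]
    simp only [Finset.sum_range_succ _ n] at ih ⊢
    omega
theorem all_id (c : ℕ × ℕ → Bool) (N : ℕ) : 2 * (∑ r ∈ Finset.range N, ∑ k ∈ Finset.range 11, qi c r k) + (∑ k ∈ Finset.range 11, df (c (N, k)) (c (N, k + 1))) +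
    2 * (∑ r ∈ Finset.range N, ∑ k ∈ Finset.range 11, ki c r k) + (∑ r ∈ Finset.range N, df (c (r, 0)) (c (r + 1, 0))) + (∑ r ∈ Finset.range N, df (c (r, 11)) (c (r + 1, 11))) =
    2 * (∑ r ∈ Finset.range N, ∑ k ∈ Finset.range 12, df (c (r, k)) (c (r + 1, k))) + ∑ k ∈ Finset.range 11, df (c (0, k)) (c (0, k + 1)) := by
  induction N with
  | zero => simp
  | succ N ih =>
    have := row_id c N 11
    rw [show 11 + 1 = 12 from rfl] at this
    simp only [Finset.sum_range_succ _ N] at ih ⊢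
    omega
theorem EV_card (c : ℕ × ℕ → Bool) : (EV c).card + (∑ r ∈ Finset.range 11, ∑ k ∈ Finset.range 12, df (c (r, k)) (c (r + 1, k))) ≤ 132 := by
  have h1 : (EV c).card ≤ _ := Finset.card_image_le
  rw [Finset.card_filter, Finset.sum_product] at h1
  refine (Nat.add_le_add_right h1 _).trans (le_of_eq ?_)
  rw [← Finset.sum_add_distrib]
  refine (Finset.sum_congr rfl (fun r _ => ?_)).trans (b := ∑ r ∈ Finset.range 11, 12) (by simp)
  rw [← Finset.sum_add_distrib]
  refine (Finset.sum_congr rfl (fun k _ => ?_)).trans (b := ∑ r ∈ Finset.range 12, 1) (by simp)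
  unfold df
  dsimp only
  split_ifs <;> rfl
theorem EH1_card (c : ℕ × ℕ → Bool) : (EH1 c).card ≤ (∑ r ∈ Finset.range 11, ∑ k ∈ Finset.range 11, qi c r k) := by
  have h1 : (EH1 c).card ≤ _ := Finset.card_image_le
  rw [Finset.card_filter, Finset.sum_product] at h1
  exact h1
theorem EH0_card (c : ℕ × ℕ → Bool) (j : ℕ) : (EH0 c j).card + ∑ k ∈ Finset.range 11, df (c (0, k)) (c (0, k + 1)) ≤ 11 := by
  have h1 : (EH0 c j).card ≤ _ := Finset.card_image_le
  rw [Finset.card_filter] at h1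
  refine (Nat.add_le_add_right h1 _).trans ?_
  rw [← Finset.sum_add_distrib]
  refine (Finset.sum_le_sum (g := fun _ => 1) (fun k _ => ?_)).trans (by simp)
  unfold df
  split_ifs with h h' <;> first | omega | exact absurd h.1 h'
theorem EH0_card' (c : ℕ × ℕ → Bool) (j : ℕ) (hj : j < 11) : (EH0 c j).card ≤ 10 := by
  have h1 : (EH0 c j).card ≤ _ := Finset.card_image_le
  refine h1.trans ((Finset.card_le_card (t := (Finset.range 11).erase j) ?_).trans ?_)
  · intro k hk
    rw [Finset.mem_filter] at hk
    exact Finset.mem_erase.2 ⟨hk.2.2, hk.1⟩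
  · rw [Finset.card_erase_of_mem (Finset.mem_range.2 hj)]; simp
theorem EE_le (c : ℕ × ℕ → Bool) (j : ℕ) : (EE c j).card ≤ (EV c).card + (EH0 c j).card + (EH1 c).card :=
  (Finset.card_union_le _ _).trans (Nat.add_le_add_right (Finset.card_union_le _ _) _)
theorem chF_df (g : ℕ → Bool) (n : ℕ) : chF g n = ∑ k ∈ Finset.range n, df (g k) (g (k + 1)) := rfl
/-- number of checkerboard squares -/
def KK (c : ℕ × ℕ → Bool) : ℕ := ∑ r ∈ Finset.range 11, ∑ k ∈ Finset.range 11, ki c r k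
def sL (c : ℕ × ℕ → Bool) : ℕ := chF (fun r => c (r, 0)) 11
def sR (c : ℕ × ℕ → Bool) : ℕ := chF (fun r => c (r, 11)) 11
def sT (c : ℕ × ℕ → Bool) : ℕ := chF (fun k => c (0, k)) 11
def sB (c : ℕ × ℕ → Bool) : ℕ := chF (fun k => c (11, k)) 11
theorem euler1 (hV : Valid c) : 2 * KK c + (sL c + sT c + sR c + sB c) ≤ 2 := by
  have h1 := EE_card (j := 11) hV (fun r k hr hk h => RR_h r k hr hk (RR_h0 k hk (by omega)) h)
  have h2 := EE_le c 11
  have h3 := EV_card c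
  have h4 := EH0_card c 11
  have h5 := EH1_card c
  have h6 := all_id c 11
  simp only [KK, sL, sT, sR, sB, chF_df]
  omega
theorem euler2 (hV : Valid c) (h0 : sL c + sT c + sR c + sB c = 0) : KK c = 0 := by
  have hT := chF_zero (show sT c = 0 by omega)
  have hL := chF_zero (show sL c = 0 by omega)
  have hR := chF_zero (show sR c = 0 by omega)
  have hB := chF_zero (show sB c = 0 by omega)
  have hB' : ∀ k, k ≤ 11 → c (11, k) = c (0, 0) := fun k hk => (hB k hk).trans (hL 11 le_rfl)
  have hR' : ∀ k, k ≤ 11 → c (k, 11) = c (0, 0) := fun k hk => (hR k hk).trans (hT 11 le_rfl)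
  have : ∃ x y, x < 12 ∧ y < 12 ∧ c (x, y) ≠ c (0, 0) := by
    obtain ⟨⟨⟨x, y⟩, hu, hcu⟩, ⟨⟨x', y'⟩, hv, hcv⟩, -⟩ := hV
    cases h : c (0, 0) with
    | true => exact ⟨x', y', hv.1, hv.2, by rw [hcv]; simp⟩
    | false => exact ⟨x, y, hu.1, hu.2, by rw [hcu]; simp⟩
  obtain ⟨x, y, hx, hy, hxy⟩ := this
  have hy1 : y < 11 := by
    rcases (show y < 11 ∨ y = 11 by omega) with h | rfl
    · exact h
    · exact absurd (hR' x (by omega)) hxy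
  have hk : ∀ r k, r < 12 → k < 11 → k ≠ y → c (r, k) = c (r, k + 1) → RR c y (r, k) (r, k + 1) :=
    fun r k hr hk hky h => RR_h r k hr hk (RR_h0 k hk hky) h
  have htop : RR c y (0, y) (0, y + 1) := by
    have t1 : RR c y (0, 0) (0, y) := RR_path (fun k => (0, k)) 0 y (by omega) (fun k h1 h2 => hk 0 k (by omega) (by omega) (by omega) ((hT k (by omega)).trans (hT (k + 1) (by omega)).symm))
    have t2 : RR c y (0, y + 1) (0, 11) := RR_path (fun k => (0, k)) (y + 1) 11 (by omega) (fun k h1 h2 => hk 0 k (by omega) (by omega) (by omega) ((hT k (by omega)).trans (hT (k + 1) (by omega)).symm))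
    have t3 : RR c y (0, 0) (11, 0) := RR_path (fun k => (k, 0)) 0 11 (by omega) (fun k h1 h2 => RR_v k 0 (by omega) (by omega) ((hL k (by omega)).trans (hL (k + 1) (by omega)).symm))
    have t4 : RR c y (0, 11) (11, 11) := RR_path (fun k => (k, 11)) 0 11 (by omega) (fun k h1 h2 => RR_v k 11 (by omega) (by omega) ((hR k (by omega)).trans (hR (k + 1) (by omega)).symm))
    have t5 : RR c y (11, 0) (11, 11) := RR_path (fun k => (11, k)) 0 11 (by omega) (fun k h1 h2 => by
      have he : c (11, k) = c (11, k + 1) := (hB k (by omega)).trans (hB (k + 1) (by omega)).symm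
      by_cases hky : k = y
      · subst hky
        exact RR_h2 11 k x (by omega) (by omega) (by omega) (by rw [hB' k (by omega)]; exact hxy) he
      · exact hk 11 k (by omega) (by omega) hky he)
    exact t1.symm.trans (t3.trans (t5.trans (t4.symm.trans t2.symm)))
  have h1 := EE_card (j := y) hV (fun r k hr hk' h => by
    by_cases hky : k = y
    · subst hky
      exact RR_h r k hr hk' (fun _ => htop) h
    · exact hk r k hr hk' hky h)
  have h2 := EE_le c y
  have h3 := EV_card c
  have h4 := EH0_card' c y hy1
  have h5 := EH1_card c
  have h6 := all_id c 11
  simp only [KK, sL, sT, sR, sB, chF_df] at h0 ⊢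
  omega
theorem valid_KK (hV : Valid c) : KK c = 0 := by
  by_cases h : sL c + sT c + sR c + sB c = 0
  · exact euler2 hV h
  · have := euler1 hV; omega
theorem valid_NC (hV : Valid c) : NC c := by
  have h := valid_KK hV
  have hk : ∀ r k, r < 11 → k < 11 → ki c r k = 0 := by
    intro r k hr hk
    rw [KK, Finset.sum_eq_zero_iff] at h
    have h1 := h r (Finset.mem_range.2 hr)
    rw [Finset.sum_eq_zero_iff] at h1
    exact h1 k (Finset.mem_range.2 hk)
  rintro r j j' hr hj hj' (rfl | rfl) ⟨h1, h2, h3⟩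
  · have := hk r j (by omega) (by omega)
    rw [ki, if_pos ⟨h1, h2, h3⟩] at this
    exact one_ne_zero this
  · have := hk r j' (by omega) (by omega)
    have h4 : c (r, j') ≠ c (r + 1, j') := by
      clear this hk h
      generalize c (r, j' + 1) = x at *
      generalize c (r + 1, j' + 1) = y at *
      generalize c (r, j') = z at *
      generalize c (r + 1, j') = w at *
      revert x y z w; decide
    rw [ki, if_pos ⟨h1.symm, h2.symm, h4⟩] at this
    exact one_ne_zero this
theorem DT_full (c : ℕ × ℕ → Bool) [Decidable (Valid c)] : DT (full c) = if Valid c then om c else 0 := by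
  rw [DT_eq valid_NC]
  congr
end G
end

set_option linter.all false
noncomputable section
namespace G
theorem chF_par (g : ℕ → Bool) (n : ℕ) : g n = xor (g 0) (decide (chF g n % 2 = 1)) := by
  induction n with
  | zero => simp [chF]
  | succ n ih =>
    rw [chF_succ]
    by_cases h : g n = g (n + 1)
    · rw [if_pos h, ← h]; exact ih
    · rw [if_neg h]
      have h1 : g (n + 1) = !(g n) := by
        revert h; generalize g n = x; generalize g (n + 1) = y; revert x y; decide
      rw [h1, ih]
      rcases Nat.mod_two_eq_zero_or_one (chF g n) with h2 | h2
      · rw [h2, show (chF g n + 1) % 2 = 1 by omega]; simp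
      · rw [h2, show (chF g n + 1) % 2 = 0 by omega]; simp
def prd (g : ℕ → Bool) (n : ℕ) : ℕ := ∏ k ∈ Finset.range n, rho (g k) (g (k + 1))
theorem prd_eq (g : ℕ → Bool) (n : ℕ) : prd g n = if chF g n = 0 then 1 else if chF g n = 1 ∧ g 0 = true then 4 else 0 := by
  induction n with
  | zero => simp [prd, chF]
  | succ n ih =>
    rw [prd, Finset.prod_range_succ, ← prd, ih, chF_succ]
    have hp := chF_par g n
    by_cases h : g n = g (n + 1)
    · rw [if_pos h, ← h]; simp [rho]
    · rw [if_neg h]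
      have h1 : g (n + 1) = !(g n) := by
        revert h; generalize g n = x; generalize g (n + 1) = y; revert x y; decide
      rw [h1, if_neg (show ¬ chF g n + 1 = 0 by omega)]
      by_cases h0 : chF g n = 0
      · rw [h0] at hp ⊢
        simp at hp
        rw [hp]
        cases g 0 <;> simp [rho]
      · rw [if_neg h0, if_neg (show ¬ (chF g n + 1 = 1 ∧ g 0 = true) by omega)]
        by_cases h2 : chF g n = 1 ∧ g 0 = true
        · rw [h2.1, h2.2] at hp
          simp at hp
          rw [hp]
          simp [rho]
        · rw [if_neg h2, zero_mul]
theorem rem_eq (c : ℕ × ℕ → Bool) (m r : ℕ) : rem c m r = (∏ i ∈ Finset.range m, (c (r + i + 1, 0)).toNat) *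
    ((∏ i ∈ Finset.range m, rho (c (r + i, 11)) (c (r + i + 1, 11))) * wb c) := by
  induction m generalizing r with
  | zero => simp [rem]
  | succ m ih =>
    rw [rem, ih, Finset.prod_range_succ', Finset.prod_range_succ' (fun i => rho _ _)]
    simp only [add_zero, show ∀ i, r + 1 + i = r + (i + 1) by intro i; omega]
    ring
def wB (n : ℕ) : ℕ := if n ≤ 1 then 1 else if n = 2 then 4 else 0
def wR (t r : ℕ) : ℕ := if r = 0 then 1 else if r = 1 ∧ t % 2 = 0 then 4 else 0
def FF (l t r b : ℕ) : ℕ := if l = 0 then wt t * (wR t r * wB b) else 0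
theorem wb_eq (c : ℕ × ℕ → Bool) : wb c = wB (sB c) := rfl
theorem om_eq (c : ℕ × ℕ → Bool) : om c = (c (0, 0)).toNat * FF (sL c) (sT c) (sR c) (sB c) := by
  rw [om, rem_eq, wb_eq]
  cases h0 : c (0, 0) with
  | false => simp
  | true =>
    simp only [Bool.toNat_true, one_mul, zero_add]
    have e1 := prd_eq (fun k => c (k, 11)) 11
    rw [prd] at e1
    rw [e1]
    have hR : chF (fun k => c (k, 11)) 11 = sR c := rfl
    have hT : chF (fun k => c (0, k)) 11 = sT c := rfl
    rw [hR, hT]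
    have hp := chF_par (fun k => c (0, k)) 11
    simp only [hT, h0] at hp
    have e2 : (if sR c = 0 then 1 else if sR c = 1 ∧ c (0, 11) = true then 4 else 0) = wR (sT c) (sR c) := by
      rw [wR, hp]
      rcases Nat.mod_two_eq_zero_or_one (sT c) with h2 | h2 <;> rw [h2] <;> simp
    rw [e2, FF]
    by_cases hL : sL c = 0
    · rw [if_pos hL]
      have := chF_zero hL
      rw [Finset.prod_eq_one (fun i hi => by rw [this (i + 1) (by rw [Finset.mem_range] at hi; omega), h0]; rfl), one_mul]
    · rw [if_neg hL]
      have : ∃ i ∈ Finset.range 11, (c (i + 1, 0)).toNat = 0 := by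
        by_contra hne
        push Not at hne
        apply hL
        have ht : ∀ k, k ≤ 11 → c (k, 0) = true := by
          intro k hk
          rcases k with _ | k
          · exact h0
          · have := hne k (Finset.mem_range.2 (by omega))
            revert this; cases c (k + 1, 0) <;> simp
        rw [sL, chF]
        apply Finset.sum_eq_zero
        intro k hk
        rw [Finset.mem_range] at hk
        rw [if_pos]
        rw [ht k (by omega), ht (k + 1) (by omega)]
      rw [Finset.prod_eq_zero_iff.2 this]; simp
theorem chF_not (g : ℕ → Bool) (n : ℕ) : chF (fun k => !(g k)) n = chF g n := by
  simp [chF]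
theorem om_not (c : ℕ × ℕ → Bool) : om c + om (fun u => !(c u)) = FF (sL c) (sT c) (sR c) (sB c) := by
  rw [om_eq, om_eq]
  have h1 : sL (fun u => !(c u)) = sL c := chF_not _ _
  have h2 : sT (fun u => !(c u)) = sT c := chF_not _ _
  have h3 : sR (fun u => !(c u)) = sR c := chF_not _ _
  have h4 : sB (fun u => !(c u)) = sB c := chF_not _ _
  rw [h1, h2, h3, h4]
  cases c (0, 0) <;> simp
theorem FF_sum (l t r b : ℕ) (h : l + t + r + b ≤ 2) (h' : (l + t + r + b) % 2 = 0) :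
    FF l t r b + FF t r b l + FF r b l t + FF b l t r = 4 := by
  have hl : l < 3 := by omega
  have ht : t < 3 := by omega
  have hr : r < 3 := by omega
  have hb : b < 3 := by omega
  revert h h'
  interval_cases l <;> interval_cases t <;> interval_cases r <;> interval_cases b <;> decide
theorem FF_le (l t r b : ℕ) (h : l + t + r + b ≤ 2) (h' : (l + t + r + b) % 2 = 0) : FF l t r b ≤ 4 := by
  have := FF_sum l t r b h h'; omega
theorem ring_par (c : ℕ × ℕ → Bool) : (sL c + sT c + sR c + sB c) % 2 = 0 := by
  have h1 := chF_par (fun k => c (0, k)) 11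
  have h2 := chF_par (fun k => c (k, 0)) 11
  have h3 := chF_par (fun k => c (11, k)) 11
  have h4 := chF_par (fun k => c (k, 11)) 11
  have hR : chF (fun k => c (k, 11)) 11 = sR c := rfl
  have hT : chF (fun k => c (0, k)) 11 = sT c := rfl
  have hL : chF (fun k => c (k, 0)) 11 = sL c := rfl
  have hB : chF (fun k => c (11, k)) 11 = sB c := rfl
  rw [hT] at h1
  rw [hL] at h2
  rw [hB] at h3
  rw [hR] at h4
  rw [h4, h1, h2] at h3
  generalize sL c = l at *
  generalize sT c = t at *
  generalize sR c = r at *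
  generalize sB c = b at *
  generalize c (0, 0) = x at *
  clear h1 h2 h4 hR hT hL hB
  rcases Nat.mod_two_eq_zero_or_one l with a1 | a1 <;> rcases Nat.mod_two_eq_zero_or_one t with a2 | a2 <;>
    rcases Nat.mod_two_eq_zero_or_one r with a3 | a3 <;> rcases Nat.mod_two_eq_zero_or_one b with a4 | a4 <;>
    rw [a1, a2, a3, a4] at h3 <;> first | omega | (exfalso; revert h3; cases x <;> decide)
theorem chF_rev (g : ℕ → Bool) : chF (fun k => g (11 - k)) 11 = chF g 11 := by
  unfold chF
  rw [← Finset.sum_range_reflect (fun k => if g k = g (k + 1) then 0 else 1) 11]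
  apply Finset.sum_congr rfl
  intro k hk
  rw [Finset.mem_range] at hk
  rw [show 11 - 1 - k = 11 - (k + 1) by omega, show 11 - (k + 1) + 1 = 11 - k by omega]
  simp only [eq_comm]
theorem chF_congr {g g' : ℕ → Bool} {n : ℕ} (h : ∀ k, k ≤ n → g k = g' k) : chF g n = chF g' n := by
  apply Finset.sum_congr rfl
  intro k hk
  rw [Finset.mem_range] at hk
  rw [h k (by omega), h (k + 1) (by omega)]
end G
end

set_option linter.all false
noncomputable section
namespace G
theorem bsum_fin (k : ℕ) (g : List Bool → ℕ) : bsum k g = ∑ f : Fin k → Bool, g (List.ofFn f) := by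
  induction k generalizing g with
  | zero => simp [bsum]
  | succ k ih =>
    rw [bsum, ih, ih, ← (Fin.consEquiv (fun _ : Fin (k + 1) => Bool)).sum_comp, Fintype.sum_prod_type, Fintype.sum_bool]
    simp [Fin.consEquiv, List.ofFn_succ]
theorem tsum_fin (k : ℕ) (g : List (List Bool) → ℕ) : tsum k g = ∑ F : Fin k → Fin 12 → Bool, g (List.ofFn (fun i => List.ofFn (F i))) := by
  induction k generalizing g with
  | zero => simp [tsum]
  | succ k ih =>
    rw [tsum, bsum_fin, ← (Fin.consEquiv (fun _ : Fin (k + 1) => Fin 12 → Bool)).sum_comp, Fintype.sum_prod_type]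
    refine Finset.sum_congr rfl (fun f _ => ?_)
    rw [ih]
    simp [Fin.consEquiv, List.ofFn_succ]
abbrev FC := Fin 12 → Fin 12 → Bool
def col (F : FC) (u : ℕ × ℕ) : Bool := if h : u.1 < 12 ∧ u.2 < 12 then F ⟨u.1, h.1⟩ ⟨u.2, h.2⟩ else false
/-- direction of row `i` -/
def dr (i : ℕ) : Bool := i == 0 || i % 2 == 1
def sF (b : Bool) (k : Fin 12) : Fin 12 := cond b k (Fin.rev k)
theorem sF_sF (b : Bool) (k : Fin 12) : sF b (sF b k) = k := by cases b <;> simp [sF]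
theorem sF_val (b : Bool) (k : Fin 12) : ((sF b k : Fin 12) : ℕ) = sg b k := by
  cases b
  · simp [sF, sg, Fin.val_rev]
  · rfl
def snake : FC ≃ FC where
  toFun F i k := F i (sF (dr i) k)
  invFun F i k := F i (sF (dr i) k)
  left_inv F := by funext i k; simp only [sF_sF]
  right_inv F := by funext i k; simp only [sF_sF]
theorem row_ofFn (f : ℕ → Bool) (b : Bool) : (f (sg b 0) :: (List.range' 1 11).map (fun k => f (sg b k))) = List.ofFn (fun k : Fin 12 => f (sg b k)) := rfl
theorem full_ofFn (c : ℕ × ℕ → Bool) : full c = List.ofFn (fun i : Fin 12 => List.ofFn (fun k : Fin 12 => c (i, sg (dr i) k))) := by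
  have h : ∀ b x, (c (x, sg b 0) :: (List.range' 1 11).map (fun k => c (x, sg b k))) = List.ofFn (fun k : Fin 12 => c (x, sg b k)) := fun b x => row_ofFn (fun k => c (x, k)) b
  have h0 := h true 0
  rw [full, show (c (0, 0) :: (List.range' 1 11).map (fun k => c (0, k))) = List.ofFn (fun k : Fin 12 => c (0, sg true k)) from h0]
  simp only [rows, h]
  rfl
theorem full_col (F : FC) : full (col F) = List.ofFn (fun i => List.ofFn (snake F i)) := by
  rw [full_ofFn]
  congr 1
  funext i
  congr 1
  funext k
  rw [← sF_val, col, dif_pos ⟨i.2, (sF _ k).2⟩]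
  rfl
def bc (F : FC) : ℕ := ∑ i, ∑ k, (F i k).toNat
theorem cntc_full (F : FC) : cntc (full (col F)) = bc F := by
  rw [full_col, cntc, List.map_ofFn, List.sum_ofFn, bc]
  refine Finset.sum_congr rfl (fun i _ => ?_)
  simp only [Function.comp, cnt1, List.map_ofFn, List.sum_ofFn]
  have e : Function.Involutive (sF (dr i)) := sF_sF (dr i)
  exact Equiv.sum_comp (e.toPerm) (fun k => (F i k).toNat)
open Classical in
theorem WK_eq (a : ℕ) : WK 12 a = ∑ F : FC, if bc F = a ∧ Valid (col F) then om (col F) else 0 := by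
  rw [WK, tsum_fin, ← snake.sum_comp]
  refine Finset.sum_congr rfl (fun F _ => ?_)
  rw [← full_col, cntc_full, DT_full]
  split_ifs <;> simp_all
theorem col_in (F : FC) (x y : ℕ) (hx : x < 12) (hy : y < 12) : col F (x, y) = F ⟨x, hx⟩ ⟨y, hy⟩ := by
  rw [col, dif_pos ⟨hx, hy⟩]
def rot : FC ≃ FC where
  toFun F i k := F k (Fin.rev i)
  invFun F i k := F (Fin.rev k) i
  left_inv F := by funext i k; simp
  right_inv F := by funext i k; simp
theorem col_rot (F : FC) (x y : ℕ) (hx : x < 12) (hy : y < 12) : col (rot F) (x, y) = col F (y, 11 - x) := by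
  rw [col_in _ _ _ hx hy, col_in _ _ _ hy (by omega)]
  have : Fin.rev (⟨x, hx⟩ : Fin 12) = ⟨11 - x, by omega⟩ := by ext; simp [Fin.val_rev]
  simp only [rot, Equiv.coe_fn_mk, this]
def neg : FC ≃ FC where
  toFun F i k := !(F i k)
  invFun F i k := !(F i k)
  left_inv F := by funext i k; simp
  right_inv F := by funext i k; simp
theorem col_neg (F : FC) (x y : ℕ) (hx : x < 12) (hy : y < 12) : col (neg F) (x, y) = !(col F (x, y)) := by
  rw [col_in _ _ _ hx hy, col_in _ _ _ hx hy]; rfl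
theorem bc_rot (F : FC) : bc (rot F) = bc F := by
  unfold bc
  rw [Finset.sum_comm]
  refine Finset.sum_congr rfl (fun i _ => ?_)
  exact Equiv.sum_comp (Fin.revPerm) (fun k => (F i k).toNat)
theorem bc_neg (F : FC) : bc (neg F) + bc F = 144 := by
  unfold bc
  rw [← Finset.sum_add_distrib]
  refine (Finset.sum_congr rfl (fun i _ => ?_)).trans (b := ∑ i : Fin 12, 12) (by simp)
  rw [← Finset.sum_add_distrib]
  refine (Finset.sum_congr rfl (fun k _ => ?_)).trans (b := ∑ i : Fin 12, 1) (by simp)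
  simp only [neg, Equiv.coe_fn_mk]
  cases F i k <;> rfl
theorem sL_rot (F : FC) : sL (col (rot F)) = sT (col F) := by
  rw [sL, sT, ← chF_rev (fun k => col F (0, k))]
  exact chF_congr (fun k hk => col_rot F k 0 (by omega) (by omega))
theorem sT_rot (F : FC) : sT (col (rot F)) = sR (col F) := chF_congr (fun k hk => col_rot F 0 k (by omega) (by omega))
theorem sR_rot (F : FC) : sR (col (rot F)) = sB (col F) := by
  rw [sR, sB, ← chF_rev (fun k => col F (11, k))]
  exact chF_congr (fun k hk => col_rot F k 11 (by omega) (by omega))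
theorem sB_rot (F : FC) : sB (col (rot F)) = sL (col F) := by
  refine chF_congr (fun k hk => (col_rot F 11 k (by omega) (by omega)))
theorem Valid_map {c c' : ℕ × ℕ → Bool} (b : Bool) (σ τ : ℕ × ℕ → ℕ × ℕ) (hσ : ∀ u ∈ Bd, σ u ∈ Bd) (hτ : ∀ u ∈ Bd, τ u ∈ Bd)
    (hτσ : ∀ u ∈ Bd, τ (σ u) = u) (hστ : ∀ u ∈ Bd, σ (τ u) = u) (had : ∀ u ∈ Bd, ∀ v ∈ Bd, ad u v → ad (τ u) (τ v)) (hc : ∀ u ∈ Bd, c' u = xor b (c (σ u)))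
    (hV : Valid c) : Valid c' := by
  obtain ⟨⟨x, hx, hcx⟩, ⟨y, hy, hcy⟩, hco⟩ := hV
  have hm : ∀ u v, u ∈ Bd → Co ad c Bd u v → Co ad c' Bd (τ u) (τ v) := by
    intro u v hu h
    induction h with
    | refl => exact Co.refl _
    | @tail w v _ h ih =>
      refine ih.trans (Co.single (had _ h.2.1 _ h.2.2.1 h.1) (hτ _ h.2.1) (hτ _ h.2.2.1) ?_)
      rw [hc _ (hτ _ h.2.1), hc _ (hτ _ h.2.2.1), hστ _ h.2.1, hστ _ h.2.2.1, h.2.2.2]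
  refine ⟨?_, ?_, ?_⟩
  · cases b with
    | true => exact ⟨τ y, hτ y hy, by rw [hc _ (hτ y hy), hστ y hy, hcy]; rfl⟩
    | false => exact ⟨τ x, hτ x hx, by rw [hc _ (hτ x hx), hστ x hx, hcx]; rfl⟩
  · cases b with
    | true => exact ⟨τ x, hτ x hx, by rw [hc _ (hτ x hx), hστ x hx, hcx]; rfl⟩
    | false => exact ⟨τ y, hτ y hy, by rw [hc _ (hτ y hy), hστ y hy, hcy]; rfl⟩
  · intro u hu v hv h
    have := hm (σ u) (σ v) (hσ u hu) (hco _ (hσ u hu) _ (hσ v hv) (by rw [hc u hu, hc v hv] at h; revert h; cases b <;> simp))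
    rwa [hτσ u hu, hτσ v hv] at this
theorem valid_rot (F : FC) : Valid (col (rot F)) ↔ Valid (col F) := by
  have p1 : ∀ u ∈ Bd, (u.2, 11 - u.1) ∈ Bd := by rintro ⟨x, y⟩ h; simp only [Bd, Set.mem_setOf_eq] at *; omega
  have p2 : ∀ u ∈ Bd, (11 - u.2, u.1) ∈ Bd := by rintro ⟨x, y⟩ h; simp only [Bd, Set.mem_setOf_eq] at *; omega
  have p3 : ∀ u ∈ Bd, (11 - (11 - u.1), u.2) = u := by rintro ⟨x, y⟩ h; simp only [Bd, Set.mem_setOf_eq] at h; rw [Prod.mk.injEq]; simp only [and_true]; omega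
  have p4 : ∀ u ∈ Bd, (u.1, 11 - (11 - u.2)) = u := by rintro ⟨x, y⟩ h; simp only [Bd, Set.mem_setOf_eq] at h; rw [Prod.mk.injEq]; simp only [true_and]; omega
  have p5 : ∀ u ∈ Bd, ∀ v ∈ Bd, ad u v → ad (u.2, 11 - u.1) (v.2, 11 - v.1) := by
    rintro ⟨x, y⟩ h ⟨x', y'⟩ h' h2; simp only [Bd, Set.mem_setOf_eq, ad] at *; omega
  have p6 : ∀ u ∈ Bd, ∀ v ∈ Bd, ad u v → ad (11 - u.2, u.1) (11 - v.2, v.1) := by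
    rintro ⟨x, y⟩ h ⟨x', y'⟩ h' h2; simp only [Bd, Set.mem_setOf_eq, ad] at *; omega
  constructor
  · refine Valid_map false (fun u => (11 - u.2, u.1)) (fun u => (u.2, 11 - u.1)) p2 p1 p4 p3 p5 ?_
    rintro ⟨x, y⟩ h
    have h1 : x < 12 := h.1
    have h2 : y < 12 := h.2
    rw [Bool.false_xor]
    simp only
    rw [col_rot _ _ _ (by omega) h1, show 11 - (11 - y) = y by omega]
  · refine Valid_map false (fun u => (u.2, 11 - u.1)) (fun u => (11 - u.2, u.1)) p1 p2 p3 p4 p6 ?_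
    rintro ⟨x, y⟩ h
    rw [Bool.false_xor]
    exact col_rot F x y h.1 h.2
theorem valid_neg (F : FC) : Valid (col (neg F)) ↔ Valid (col F) := by
  constructor
  · refine Valid_map true id id (fun u h => h) (fun u h => h) (fun u h => rfl) (fun u h => rfl) (fun u _ v _ h => h) ?_
    rintro ⟨x, y⟩ h
    rw [id, Bool.true_xor, col_neg _ _ _ h.1 h.2, Bool.not_not]
  · refine Valid_map true id id (fun u h => h) (fun u h => h) (fun u h => rfl) (fun u h => rfl) (fun u _ v _ h => h) ?_
    rintro ⟨x, y⟩ h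
    rw [id, Bool.true_xor, col_neg _ _ _ h.1 h.2]
def Fs (F : FC) : ℕ := FF (sL (col F)) (sT (col F)) (sR (col F)) (sB (col F))
theorem om_neg (F : FC) : om (col F) + om (col (neg F)) = Fs F := by
  rw [Fs, ← om_not, om_eq (col (neg F)), om_eq (fun u => !(col F u)), col_neg _ _ _ (by omega) (by omega)]
  have h1 : sL (col (neg F)) = sL (fun u => !(col F u)) := chF_congr (fun k hk => col_neg _ _ _ (by omega) (by omega))
  have h2 : sT (col (neg F)) = sT (fun u => !(col F u)) := chF_congr (fun k hk => col_neg _ _ _ (by omega) (by omega))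
  have h3 : sR (col (neg F)) = sR (fun u => !(col F u)) := chF_congr (fun k hk => col_neg _ _ _ (by omega) (by omega))
  have h4 : sB (col (neg F)) = sB (fun u => !(col F u)) := chF_congr (fun k hk => col_neg _ _ _ (by omega) (by omega))
  rw [h1, h2, h3, h4]
theorem Fs_rot (F : FC) (hV : Valid (col F)) : Fs F + Fs (rot F) + Fs (rot (rot F)) + Fs (rot (rot (rot F))) = 4 := by
  simp only [Fs, sL_rot, sT_rot, sR_rot, sB_rot]
  exact FF_sum _ _ _ _ (by have := euler1 hV; omega) (ring_par _)
open Classical in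
theorem sum_Fs (n : ℕ) : (∑ F : FC, if bc F = n ∧ Valid (col F) then 1 else 0) = ∑ F : FC, if bc F = n ∧ Valid (col F) then Fs F else 0 := by
  have hr : ∀ f : FC → ℕ, (∑ F : FC, if bc F = n ∧ Valid (col F) then f (rot F) else 0) = ∑ F : FC, if bc F = n ∧ Valid (col F) then f F else 0 := by
    intro f
    rw [← rot.sum_comp (fun F => if bc F = n ∧ Valid (col F) then f F else 0)]
    refine Finset.sum_congr rfl (fun F _ => ?_)
    simp only [bc_rot, valid_rot]
  have h1 := hr Fs
  have h2 := hr (fun F => Fs (rot F))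
  have h3 := hr (fun F => Fs (rot (rot F)))
  have h4 : (∑ F : FC, if bc F = n ∧ Valid (col F) then Fs F else 0) + (∑ F : FC, if bc F = n ∧ Valid (col F) then Fs (rot F) else 0) +
    (∑ F : FC, if bc F = n ∧ Valid (col F) then Fs (rot (rot F)) else 0) + (∑ F : FC, if bc F = n ∧ Valid (col F) then Fs (rot (rot (rot F))) else 0) =
    4 * (∑ F : FC, if bc F = n ∧ Valid (col F) then 1 else 0) := by
    rw [← Finset.sum_add_distrib, ← Finset.sum_add_distrib, ← Finset.sum_add_distrib, Finset.mul_sum]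
    refine Finset.sum_congr rfl (fun F _ => ?_)
    by_cases h : bc F = n ∧ Valid (col F)
    · simp only [if_pos h, Fs_rot F h.2, mul_one]
    · simp only [if_neg h, mul_zero, add_zero]
  omega
open Classical in
theorem sum_om (n : ℕ) (hn : n = 72) : (∑ F : FC, if bc F = n ∧ Valid (col F) then om (col F) else 0) = ∑ F : FC, if bc F = n ∧ Valid (col F) then om (col (neg F)) else 0 := by
  rw [← neg.sum_comp]
  refine Finset.sum_congr rfl (fun F _ => ?_)
  have := bc_neg F
  simp only [valid_neg, show (bc (neg F) = n) = (bc F = n) from propext (by omega)]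
open Classical in
theorem sum_om2 (n : ℕ) : (∑ F : FC, if bc F = n ∧ Valid (col F) then om (col F) else 0) + (∑ F : FC, if bc F = n ∧ Valid (col F) then om (col (neg F)) else 0) =
    ∑ F : FC, if bc F = n ∧ Valid (col F) then Fs F else 0 := by
  rw [← Finset.sum_add_distrib]
  refine Finset.sum_congr rfl (fun F _ => ?_)
  rw [← om_neg]
  split_ifs <;> rfl
open Classical in
theorem count_eq (n : ℕ) (hn : n = 72) : (∑ F : FC, if bc F = n ∧ Valid (col F) then 1 else 0) = 2 * WK 12 n := by
  have h1 := sum_om2 n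
  rw [← sum_om n hn, ← WK_eq, ← sum_Fs] at h1
  rw [← h1, two_mul]
end G
end

set_option linter.all false
noncomputable section
namespace G
theorem left_of_om (F : FC) (h : om (col F) ≠ 0) (i : Fin 12) : F i 0 = true := by
  rw [om_eq, FF] at h
  have h0 : col F (0, 0) = true := by
    by_contra h1
    rw [Bool.not_eq_true] at h1
    rw [h1] at h; simp at h
  have hL : sL (col F) = 0 := by
    by_contra h1
    rw [if_neg h1] at h; simp at h
  have := chF_zero hL i (by omega)
  rw [← h0, ← this, col_in _ _ _ i.2 (by omega)]
  rfl
theorem om_le (F : FC) (hV : Valid (col F)) : om (col F) ≤ 4 := by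
  have h1 := euler1 hV
  have h2 := FF_le _ _ _ _ (show sL (col F) + sT (col F) + sR (col F) + sB (col F) ≤ 2 by omega) (ring_par _)
  rw [om_eq]
  cases col F (0, 0) <;> simp [h2]
theorem left_card (b : Bool) : (Finset.univ.filter (fun F : FC => ∀ i, F i 0 = b)).card ≤ 2 ^ 132 := by
  have h1 : (Finset.univ : Finset (Fin 12 → Fin 11 → Bool)).card = 2 ^ 132 := by
    rw [Finset.card_univ, Fintype.card_fun, Fintype.card_fun, Fintype.card_bool, Fintype.card_fin, Fintype.card_fin, ← pow_mul]
  rw [← h1]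
  apply Finset.card_le_card_of_injOn (fun F i k => F i (Fin.succ k)) (fun _ _ => Finset.mem_coe.2 (Finset.mem_univ _))
  intro F hF F' hF' h
  rw [Finset.mem_coe, Finset.mem_filter] at hF hF'
  funext i k
  refine Fin.cases ?_ (fun k => ?_) k
  · rw [hF.2, hF'.2]
  · exact congrFun (congrFun h i) k
open Classical in
theorem WK_le (b : Bool) (hb : b = true) (a M : ℕ) (hM : 2 ^ 132 = M) : WK 12 a ≤ M * 4 := by
  rw [WK_eq]
  have h : ∀ F : FC, (if bc F = a ∧ Valid (col F) then om (col F) else 0) ≤ if (∀ i, F i 0 = b) then 4 else 0 := by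
    intro F
    split_ifs with h1 h2 h2
    · exact om_le F h1.2
    · by_contra h3
      exact h2 (fun i => hb.symm ▸ left_of_om F (by omega) i)
    · exact Nat.zero_le _
    · exact le_rfl
  refine (Finset.sum_le_sum (fun F _ => h F)).trans ?_
  rw [← Finset.sum_filter, Finset.sum_const, smul_eq_mul]
  refine Nat.mul_le_mul_right 4 (le_trans (le_of_eq ?_) (hM ▸ left_card b))
  congr
theorem X_gt : 2 ^ 132 * 4 < X := by decide
theorem WK_lt (a : ℕ) : WK 12 a < X := lt_of_le_of_lt (WK_le true rfl a _ rfl) X_gt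
end G
end

set_option linter.all false
noncomputable section
namespace G
def vl (p : Fin 12 × Fin 12) : ℕ × ℕ := (p.1, p.2)
theorem vl_mem (p : Fin 12 × Fin 12) : vl p ∈ Bd := ⟨p.1.2, p.2.2⟩
theorem col_vl (F : FC) (p : Fin 12 × Fin 12) : col F (vl p) = F p.1 p.2 := col_in F _ _ p.1.2 p.2.2
theorem ex_vl (u : ℕ × ℕ) (hu : u ∈ Bd) : ∃ p, vl p = u := ⟨(⟨u.1, hu.1⟩, ⟨u.2, hu.2⟩), rfl⟩
theorem adj_iff (p q : Fin 12 × Fin 12) : (gridGraph 12 12).Adj p q ↔ ad (vl p) (vl q) := by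
  obtain ⟨a, b⟩ := p
  obtain ⟨a', b'⟩ := q
  simp only [gridGraph, SimpleGraph.fromRel_adj, ad, vl, ne_eq, Prod.mk.injEq, Fin.ext_iff]
  omega
theorem CR_iff (F : FC) (b : Bool) (S : Finset (Fin 12 × Fin 12)) (hS : ∀ p, p ∈ S ↔ F p.1 p.2 = b) :
    ConnectedRegion 12 12 S ↔ (∃ u ∈ Bd, col F u = b) ∧ ∀ u ∈ Bd, ∀ v ∈ Bd, col F u = b → col F v = b → Co ad (col F) Bd u v := by
  have hc : ∀ p, p ∈ S ↔ col F (vl p) = b := fun p => by rw [col_vl]; exact hS p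
  constructor
  · intro h
    refine ⟨?_, ?_⟩
    · obtain ⟨⟨p, hp⟩⟩ := h.nonempty
      exact ⟨vl p, vl_mem p, (hc p).1 hp⟩
    · intro u hu v hv h1 h2
      obtain ⟨p, rfl⟩ := ex_vl u hu
      obtain ⟨q, rfl⟩ := ex_vl v hv
      have hr := h.preconnected ⟨p, (hc p).2 h1⟩ ⟨q, (hc q).2 h2⟩
      rw [SimpleGraph.reachable_iff_reflTransGen] at hr
      have key : ∀ x y : (S : Set (Fin 12 × Fin 12)), Relation.ReflTransGen ((gridGraph 12 12).induce (S : Set (Fin 12 × Fin 12))).Adj x y → Co ad (col F) Bd (vl x.1) (vl y.1) := by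
        intro x y hxy
        induction hxy with
        | refl => exact Co.refl _
        | @tail w y _ hwy ih =>
          refine ih.trans (Co.single ((adj_iff _ _).1 hwy) (vl_mem _) (vl_mem _) ?_)
          rw [(hc _).1 w.2, (hc _).1 y.2]
      exact key _ _ hr
  · rintro ⟨⟨u, hu, hub⟩, h⟩
    obtain ⟨p, rfl⟩ := ex_vl u hu
    have key : ∀ (x : (S : Set (Fin 12 × Fin 12))) (v : ℕ × ℕ), Co ad (col F) Bd (vl x.1) v → ∀ y : (S : Set (Fin 12 × Fin 12)), vl y.1 = v →
        ((gridGraph 12 12).induce (S : Set (Fin 12 × Fin 12))).Reachable x y := by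
      intro x v hv
      induction hv with
      | refl =>
        intro y hy
        have : x = y := by
          apply Subtype.ext
          simp only [vl, Prod.mk.injEq] at hy
          exact Prod.ext (Fin.ext hy.1.symm) (Fin.ext hy.2.symm)
        rw [this]
      | @tail w v _ hwv ih =>
        intro y hy
        obtain ⟨q, rfl⟩ := ex_vl w hwv.2.1
        subst hy
        have hq : q ∈ S := by rw [hc, hwv.2.2.2]; exact (hc _).1 y.2
        refine (ih ⟨q, hq⟩ rfl).trans (SimpleGraph.Adj.reachable ?_)
        exact (adj_iff _ _).2 hwv.1
    haveI : Nonempty (S : Set (Fin 12 × Fin 12)) := ⟨⟨p, (hc p).2 hub⟩⟩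
    refine ⟨fun x y => key x _ (h _ (vl_mem _) _ (vl_mem _) ((hc _).1 x.2) ((hc _).1 y.2)) y rfl⟩
theorem valid_iff (F : FC) (S : Finset (Fin 12 × Fin 12)) (hS : ∀ p, p ∈ S ↔ F p.1 p.2 = true) :
    ConnectedRegion 12 12 S ∧ ConnectedRegion 12 12 Sᶜ ↔ Valid (col F) := by
  rw [CR_iff F true S hS, CR_iff F false Sᶜ (fun p => by rw [Finset.mem_compl, hS, Bool.not_eq_true])]
  constructor
  · rintro ⟨⟨h1, h2⟩, h3, h4⟩
    refine ⟨h1, h3, fun u hu v hv h => ?_⟩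
    cases hh : col F u with
    | true => exact h2 u hu v hv hh (h.symm.trans hh)
    | false => exact h4 u hu v hv hh (h.symm.trans hh)
  · rintro ⟨h1, h2, h3⟩
    exact ⟨⟨h1, fun u hu v hv a b => h3 u hu v hv (a.trans b.symm)⟩, h2, fun u hu v hv a b => h3 u hu v hv (a.trans b.symm)⟩
def toF : Finset (Fin 12 × Fin 12) ≃ FC where
  toFun S i k := decide ((i, k) ∈ S)
  invFun F := Finset.univ.filter (fun p => F p.1 p.2 = true)
  left_inv S := by ext p; simp
  right_inv F := by funext i k; simp
theorem bc_toF (S : Finset (Fin 12 × Fin 12)) : bc (toF S) = S.card := by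
  have h : S.card = ∑ p : Fin 12 × Fin 12, if p ∈ S then 1 else 0 := by
    rw [← Finset.card_filter]; simp
  rw [h, bc, Fintype.sum_prod_type]
  refine Finset.sum_congr rfl (fun i _ => Finset.sum_congr rfl (fun k _ => ?_))
  simp only [toF, Equiv.coe_fn_mk]
  by_cases hp : (i, k) ∈ S <;> simp [hp]
open Classical in
theorem card_sum (n : ℕ) : Nat.card {S : Finset (Fin 12 × Fin 12) // S.card = n ∧ ConnectedRegion 12 12 S ∧ ConnectedRegion 12 12 Sᶜ} =
    ∑ F : FC, if bc F = n ∧ Valid (col F) then 1 else 0 := by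
  rw [Nat.card_congr (toF.subtypeEquiv (q := fun F => bc F = n ∧ Valid (col F)) (fun S => by
    rw [bc_toF, valid_iff (toF S) S (fun p => by simp [toF])]))]
  rw [Nat.card_eq_fintype_card, Fintype.card_subtype, Finset.card_filter]
theorem final_card (n : ℕ) (hn : n = 72) : Nat.card {S : Finset (Fin 12 × Fin 12) // S.card = n ∧ ConnectedRegion 12 12 S ∧ ConnectedRegion 12 12 Sᶜ} =
    Nat.mul 2 (WK 12 n) := by
  classical
  exact (card_sum n).trans (count_eq n hn)
theorem final_card2 (hcnt : ∀ n, n = 72 → WK 12 n = cntf X val) :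
  ∀ n, n = 72 → Nat.card {S : Finset (Fin 12 × Fin 12) // S.card = n ∧ ConnectedRegion 12 12 S ∧ ConnectedRegion 12 12 Sᶜ} =
    Nat.mul 2 (cntf X val) := fun n hn => (final_card n hn).trans (congrArg (Nat.mul 2) (hcnt n hn))
theorem hcnt : ∀ n, n = 72 → WK 12 n = cntf X val := fun n hn => (congrArg (WK 12) hn).trans (cnt_eq WK_lt).symm
end G
end

namespace G
theorem ker : Nat.mul 2 (cntf X val) = 56578717186086829451888706 := by decide +kernel
end G

/-- The number of subsets `S` of the 12×12 board with `|S| = 72` such that both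
`S` and its complement are connected equals 56578717186086829451888706; equivalently, the
gerrymander number (dissections into two connected polyominoes of equal area)
for this board is half of that. -/
theorem gerrymander_count_12x12 :
    Nat.card {S : Finset (Fin 12 × Fin 12) //
      S.card = 72 ∧ ConnectedRegion 12 12 S ∧ ConnectedRegion 12 12 Sᶜ} = 56578717186086829451888706 := by
  exact (G.final_card2 G.hcnt 72 rfl).trans G.ker
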